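/- Let Z be a germ at 0 of a holomorphic vector field on ℂ² with a saddle-node singularity at 0 that is convergent. Then there exist an integer k ≥ 1, a complex number μ, a polynomial P ∈ ℂ[x] of degree at most k with P(0) ≠ 0, convergent power series G(x,u) = Σ_{n>0} G_n(x)u^n and R(x,u) = Σ_{n>0} R_n(x)u^n defining holomorphic functions on a neighborhood of (0,0) ∈ ℂ² in which every G_n and every R_n is a polynomial in x of degree at most k−1, and a germ of a biholomorphism Ψ of (ℂ²,0) fixing 0, such that Ψ conjugates Z to the vector field Z_norm(x,y) := [P(x)/(1+x·P(x)·G(x,x^σ y))]·(x^{k+1} ∂/∂x + y(1+μx^k+x·R(x,x^σ y)) ∂/∂y), i.e. DΨ(p)·Z_norm(p) = Z(Ψ(p)) for all p in a neighborhood of 0; here σ := 0 if μ ∉ ℝ_{≤0} and σ := ⌊−μ⌋+1 if μ ∈ ℝ_{≤0}. -/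

import Mathlib

open Complex Set Filter Metric Topology

noncomputable section

lemma HasSum.congr_fun' {ι : Type*} {f g : ι → ℂ} {a : ℂ} (h : HasSum f a) (e : ∀ i, g i = f i) :
    HasSum g a := by
  rw [show g = f from funext e]; exact h

lemma ds_geom_summable {x y : ℂ} {R C : ℝ} (hR : 0 < R) {c : ℕ → ℕ → ℂ}
    (hc : ∀ n j, ‖c n j‖ ≤ C / R ^ (n + j)) (hx : ‖x‖ < R) (hy : ‖y‖ < R) :
    Summable fun q : ℕ × ℕ => ‖c q.1 q.2‖ * ‖x‖ ^ q.2 * ‖y‖ ^ q.1 := by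
  have h1 : Summable fun n : ℕ => (‖y‖ / R) ^ n :=
    summable_geometric_of_lt_one (by positivity) ((div_lt_one hR).2 hy)
  have h2 : Summable fun n : ℕ => (‖x‖ / R) ^ n :=
    summable_geometric_of_lt_one (by positivity) ((div_lt_one hR).2 hx)
  have h3 := (h1.mul_of_nonneg h2 (fun _ => by positivity) (fun _ => by positivity)).mul_left C
  refine Summable.of_nonneg_of_le (fun _ => by positivity) (fun q => ?_) h3
  calc ‖c q.1 q.2‖ * ‖x‖ ^ q.2 * ‖y‖ ^ q.1
      ≤ (C / R ^ (q.1 + q.2)) * ‖x‖ ^ q.2 * ‖y‖ ^ q.1 := by gcongr; exact hc _ _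
    _ = C * ((‖y‖ / R) ^ q.1 * (‖x‖ / R) ^ q.2) := by
        rw [div_pow, div_pow, pow_add]; field_simp

lemma ds_expand (f : ℂ × ℂ → ℂ) (R R' : ℝ) (hR : 0 < R) (hRR : R < R')
    (hf : DifferentiableOn ℂ f (ball 0 R')) :
    ∃ (c : ℕ → ℕ → ℂ) (C : ℝ), (∀ n j, ‖c n j‖ ≤ C / R ^ (n + j)) ∧
      ∀ x y : ℂ, ‖x‖ < R → ‖y‖ < R →
        HasSum (fun q : ℕ × ℕ => c q.1 q.2 * x ^ q.2 * y ^ q.1) (f (x, y)) := by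
  have hmem : ∀ x y : ℂ, ‖x‖ ≤ R → ‖y‖ ≤ R → (x, y) ∈ ball (0 : ℂ × ℂ) R' := by
    intro x y hx hy
    rw [mem_ball_zero_iff, Prod.norm_def]
    exact lt_of_le_of_lt (max_le hx hy) hRR
  have hcont : ContinuousOn f (closedBall 0 R) :=
    hf.continuousOn.mono (closedBall_subset_ball hRR)
  obtain ⟨M, hM⟩ := (isCompact_closedBall (0 : ℂ × ℂ) R).exists_bound_of_continuousOn hcont
  have hM' : ∀ x y : ℂ, ‖x‖ ≤ R → ‖y‖ ≤ R → ‖f (x, y)‖ ≤ M := by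
    intro x y hx hy
    apply hM
    rw [mem_closedBall_zero_iff, Prod.norm_def]
    exact max_le hx hy
  have hM0 : 0 ≤ M := (norm_nonneg _).trans (hM' 0 0 (by simpa using hR.le) (by simpa using hR.le))
  have hcm : ∀ θ : ℝ, ‖circleMap 0 R θ‖ ≤ R := fun θ => by simp [abs_of_pos hR]
  have hcm' : ∀ θ : ℝ, ‖circleMap 0 R θ‖ = R := fun θ => by simp [abs_of_pos hR]
  have hcm0 : ∀ θ : ℝ, circleMap 0 R θ ≠ 0 := fun θ => by
    rw [← norm_pos_iff, hcm']; exact hR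
  have hccont : Continuous (circleMap 0 R) := continuous_circleMap 0 R
  -- normalized Cauchy coefficients as interval integrals
  let K : (ℝ → ℂ) → ℕ → ℂ := fun g n =>
    (2 * Real.pi : ℂ)⁻¹ * ∫ θ in (0:ℝ)..2 * Real.pi, (circleMap 0 R θ)⁻¹ ^ n * g θ
  have hKb : ∀ (g : ℝ → ℂ) (B : ℝ), (∀ θ, ‖g θ‖ ≤ B) → ∀ n, ‖K g n‖ ≤ B / R ^ n := by
    intro g B hg n
    have : ‖∫ θ in (0:ℝ)..2 * Real.pi, (circleMap 0 R θ)⁻¹ ^ n * g θ‖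
        ≤ (B / R ^ n) * |2 * Real.pi - 0| := by
      apply intervalIntegral.norm_integral_le_of_norm_le_const
      intro θ _
      rw [norm_mul, norm_pow, norm_inv, hcm', inv_pow, div_eq_inv_mul]
      gcongr
      exact hg θ
    simp only [K, norm_mul]
    rw [sub_zero, abs_of_pos Real.two_pi_pos] at this
    calc _ ≤ ‖(2 * Real.pi : ℂ)⁻¹‖ * ((B / R ^ n) * (2 * Real.pi)) := by gcongr
      _ = B / R ^ n := by
        have : ‖(2 * Real.pi : ℂ)⁻¹‖ = (2 * Real.pi)⁻¹ := by
          simp [abs_of_pos Real.pi_pos]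
        rw [this]; field_simp
  have hKs : ∀ (g : ℂ → ℂ), DifferentiableOn ℂ g (ball 0 R') → ∀ x : ℂ, ‖x‖ < R →
      HasSum (fun n => K (fun θ => g (circleMap 0 R θ)) n * x ^ n) (g x) := by
    intro g hg x hx
    have hd : DiffContOnCl ℂ g (ball 0 R) := by
      apply DifferentiableOn.diffContOnCl
      rw [closure_ball _ hR.ne']
      exact hg.mono (closedBall_subset_ball hRR)
    have h1 : CircleIntegrable g 0 R := by
      apply ContinuousOn.circleIntegrable hR.le
      exact (hg.continuousOn.mono (closedBall_subset_ball hRR)).mono sphere_subset_closedBall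
    have h2 := hasSum_cauchyPowerSeries_integral h1 hx
    rw [zero_add, hd.two_pi_i_inv_smul_circleIntegral_sub_inv_smul (by simpa using hx)] at h2
    refine h2.congr_fun' fun n => ?_
    rw [cauchyPowerSeries_apply]
    simp only [K, circleIntegral, smul_eq_mul, deriv_circleMap, sub_zero]
    have : ∀ θ : ℝ, circleMap 0 R θ * I * ((x / circleMap 0 R θ) ^ n *
        ((circleMap 0 R θ)⁻¹ * g (circleMap 0 R θ))) =
        (I * x ^ n) * ((circleMap 0 R θ)⁻¹ ^ n * g (circleMap 0 R θ)) := by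
      intro θ
      have := hcm0 θ
      rw [div_pow, inv_pow]
      field_simp
    simp only [this]
    rw [intervalIntegral.integral_const_mul]
    have : (Real.pi : ℂ) ≠ 0 := by exact_mod_cast Real.pi_ne_zero
    field_simp
  let d : ℕ → ℝ → ℂ := fun j φ => K (fun θ => f (circleMap 0 R θ, circleMap 0 R φ)) j
  have hdb : ∀ j φ, ‖d j φ‖ ≤ M / R ^ j := fun j φ => hKb _ M (fun θ => hM' _ _ (hcm _) (hcm _)) j
  have hdc : ∀ j, Continuous (d j) := by
    intro j
    apply Continuous.mul continuous_const
    apply intervalIntegral.continuous_parametric_intervalIntegral_of_continuous'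
    have : Continuous fun p : ℝ × ℝ => f (circleMap 0 R p.2, circleMap 0 R p.1) := by
      apply hcont.comp_continuous (by fun_prop)
      intro p
      rw [mem_closedBall_zero_iff, Prod.norm_def]
      exact max_le (hcm _) (hcm _)
    apply Continuous.mul _ this
    apply Continuous.pow
    exact Continuous.inv₀ (by fun_prop) (fun p => hcm0 _)
  let c : ℕ → ℕ → ℂ := fun n j => K (d j) n
  have hcb : ∀ n j, ‖c n j‖ ≤ M / R ^ (n + j) := by
    intro n j
    refine (hKb _ _ (hdb j) n).trans (le_of_eq ?_)
    rw [pow_add]; field_simp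
  refine ⟨c, M, hcb, fun x y hx hy => ?_⟩
  have hsum : Summable fun q : ℕ × ℕ => c q.1 q.2 * x ^ q.2 * y ^ q.1 := by
    apply Summable.of_norm
    simpa only [norm_mul, norm_pow] using ds_geom_summable hR hcb hx hy
  let A : ℕ → ℂ := fun n => K (fun φ => f (x, circleMap 0 R φ)) n
  have hA : ∀ n, HasSum (fun j => c n j * x ^ j) (A n) := by
    intro n
    have key : HasSum (fun j => ∫ φ in (0:ℝ)..2 * Real.pi,
        (circleMap 0 R φ)⁻¹ ^ n * (d j φ * x ^ j))
        (∫ φ in (0:ℝ)..2 * Real.pi, (circleMap 0 R φ)⁻¹ ^ n * f (x, circleMap 0 R φ)) := by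
      refine intervalIntegral.hasSum_integral_of_dominated_convergence
        (fun j _ => (R⁻¹ ^ n * M) * (‖x‖ / R) ^ j) ?_ ?_ ?_ ?_ ?_
      · intro j
        apply Continuous.aestronglyMeasurable
        apply Continuous.mul _ ((hdc j).mul continuous_const)
        exact (Continuous.inv₀ hccont (fun p => hcm0 _)).pow n
      · intro j
        refine Eventually.of_forall fun φ _ => ?_
        have e1 : ‖(circleMap 0 R φ)⁻¹ ^ n * (d j φ * x ^ j)‖ = R⁻¹ ^ n * (‖d j φ‖ * ‖x‖ ^ j) := by
          rw [norm_mul, norm_mul, norm_pow, norm_pow, norm_inv, hcm']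
        have e2 : ‖d j φ‖ * ‖x‖ ^ j ≤ M / R ^ j * ‖x‖ ^ j :=
          mul_le_mul_of_nonneg_right (hdb j φ) (by positivity)
        rw [e1]
        calc _ ≤ R⁻¹ ^ n * (M / R ^ j * ‖x‖ ^ j) := mul_le_mul_of_nonneg_left e2 (by positivity)
          _ = _ := by rw [div_pow]; ring
      · exact Eventually.of_forall fun φ _ => (summable_geometric_of_lt_one (by positivity)
          ((div_lt_one hR).2 hx)).mul_left _
      · exact intervalIntegrable_const
      · refine Eventually.of_forall fun φ _ => HasSum.mul_left _ ?_
        refine hKs (fun z => f (z, circleMap 0 R φ)) ?_ x hx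
        apply hf.comp (by fun_prop)
        intro z hz
        rw [mem_ball_zero_iff, Prod.norm_def]
        exact max_lt (by simpa using hz) (lt_of_le_of_lt (hcm _) hRR)
    have := key.mul_left (2 * Real.pi : ℂ)⁻¹
    refine this.congr_fun' fun j => ?_
    simp only [c, K]
    rw [mul_assoc, ← intervalIntegral.integral_mul_const]
    congr 2
    ext φ
    ring
  have hf1 : HasSum (fun n => A n * y ^ n) (f (x, y)) := by
    refine hKs (fun z => f (x, z)) ?_ y hy
    apply hf.comp (by fun_prop)
    intro z hz
    rw [mem_ball_zero_iff, Prod.norm_def]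
    exact max_lt (lt_trans hx hRR) (by simpa using hz)
  have h2 := hsum.hasSum.prod_fiberwise (fun n => (hA n).mul_right (y ^ n))
  rw [hf1.unique h2]
  exact hsum.hasSum

lemma prod_fin_ite (x y : ℂ) (m j : ℕ) (hj : j ≤ m) :
    ∏ i : Fin m, (if (i : ℕ) < j then x else y) = x ^ j * y ^ (m - j) := by
  rw [Fin.prod_univ_eq_prod_range (fun i => if i < j then x else y)]
  obtain ⟨d, rfl⟩ := Nat.exists_eq_add_of_le hj
  rw [Finset.prod_range_add]
  have h1 : ∏ i ∈ Finset.range j, (if i < j then x else y) = x ^ j := by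
    rw [Finset.prod_congr rfl (g := fun _ => x)]
    · simp
    · intro i hi; simp [Finset.mem_range.1 hi]
  rw [h1]; simp

lemma ds_analyticAt {f : ℂ × ℂ → ℂ} {c : ℕ → ℕ → ℂ} {R C : ℝ} (hR : 0 < R)
    (hc : ∀ n j, ‖c n j‖ ≤ C / R ^ (n + j))
    (hf : ∀ x y : ℂ, ‖x‖ < R → ‖y‖ < R →
        HasSum (fun q : ℕ × ℕ => c q.1 q.2 * x ^ q.2 * y ^ q.1) (f (x, y))) :
    AnalyticAt ℂ f 0 := by
  let mon : (m : ℕ) → ℕ → ContinuousMultilinearMap ℂ (fun _ : Fin m => ℂ × ℂ) ℂ := fun m j =>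
    (ContinuousMultilinearMap.mkPiAlgebraFin ℂ m ℂ).compContinuousLinearMap
      (fun i => if (i : ℕ) < j then ContinuousLinearMap.fst ℂ ℂ ℂ else ContinuousLinearMap.snd ℂ ℂ ℂ)
  have hmon1 : ∀ m j, ‖mon m j‖ ≤ 1 := by
    intro m j
    refine (ContinuousMultilinearMap.norm_compContinuousLinearMap_le _ _).trans ?_
    rw [ContinuousMultilinearMap.norm_mkPiAlgebraFin, one_mul]
    apply Finset.prod_le_one (fun _ _ => norm_nonneg _)
    intro i _
    split_ifs
    · exact ContinuousLinearMap.norm_fst_le ℂ ℂ ℂ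
    · exact ContinuousLinearMap.norm_snd_le ℂ ℂ ℂ
  have hmon2 : ∀ m j (x y : ℂ), j ≤ m → mon m j (fun _ => (x, y)) = x ^ j * y ^ (m - j) := by
    intro m j x y hj
    rw [← prod_fin_ite x y m j hj]
    simp only [mon, ContinuousMultilinearMap.compContinuousLinearMap_apply,
      ContinuousMultilinearMap.mkPiAlgebraFin_apply, List.prod_ofFn]
    apply Finset.prod_congr rfl
    intro i _
    split_ifs <;> simp
  let p : FormalMultilinearSeries ℂ (ℂ × ℂ) ℂ := fun m =>
    ∑ j ∈ Finset.range (m + 1), c (m - j) j • mon m j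
  have hpn : ∀ m, ‖p m‖ ≤ (m + 1) * (C / R ^ m) := by
    intro m
    refine (norm_sum_le _ _).trans ?_
    have : ∀ j ∈ Finset.range (m + 1), ‖c (m - j) j • mon m j‖ ≤ C / R ^ m := by
      intro j hj
      have hj' : j ≤ m := Nat.lt_succ_iff.1 (Finset.mem_range.1 hj)
      rw [norm_smul]
      have := hc (m - j) j
      rw [Nat.sub_add_cancel hj'] at this
      calc _ ≤ ‖c (m - j) j‖ * 1 := by gcongr; exact hmon1 m j
        _ ≤ _ := by simpa using this
    refine (Finset.sum_le_sum this).trans ?_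
    simp
  have hC : 0 ≤ C := by
    have := (norm_nonneg _).trans (hc 0 0); simpa using this
  have hrad : ENNReal.ofReal (R / 2) ≤ p.radius := by
    rw [ENNReal.ofReal]
    apply p.le_radius_of_bound C
    intro m
    rw [Real.coe_toNNReal _ (by positivity)]
    have h2 : ((m : ℝ) + 1) ≤ 2 ^ m := by
      exact_mod_cast Nat.lt_two_pow_self (n := m)
    calc ‖p m‖ * (R / 2) ^ m ≤ ((m + 1) * (C / R ^ m)) * (R / 2) ^ m := by gcongr; exact hpn m
      _ = (m + 1) / 2 ^ m * C := by rw [div_pow]; field_simp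
      _ ≤ 1 * C := by gcongr; rw [div_le_one (by positivity)]; exact h2
      _ = C := one_mul C
  refine ⟨p, ENNReal.ofReal (R / 2), hrad, by simpa using hR, ?_⟩
  rintro ⟨x, y⟩ hxy
  have hxy' : ‖((x, y) : ℂ × ℂ)‖ < R / 2 := by
    rw [Metric.eball_ofReal] at hxy
    simpa using hxy
  rw [Prod.norm_def, max_lt_iff] at hxy'
  have h := hf x y (by simpa using hxy'.1.trans (by linarith)) (by simpa using hxy'.2.trans (by linarith))
  rw [← Equiv.hasSum_iff (Finset.HasAntidiagonal.sigmaAntidiagonalEquivProd (A := ℕ))] at h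
  have h2 := h.sigma (fun m => hasSum_fintype _)
  rw [zero_add]
  refine h2.congr_fun' fun m => ?_
  simp only [p, sum_apply, smul_apply, smul_eq_mul]
  have e : ∀ z : Finset.HasAntidiagonal.antidiagonal m, 
      ((fun q : ℕ × ℕ => c q.1 q.2 * x ^ q.2 * y ^ q.1) ∘ ⇑Finset.HasAntidiagonal.sigmaAntidiagonalEquivProd) ⟨m, z⟩ =
      (fun q : ℕ × ℕ => c q.1 q.2 * x ^ q.2 * y ^ q.1) (z : ℕ × ℕ) := fun z => rfl
  simp only [e]
  rw [Finset.sum_coe_sort (Finset.HasAntidiagonal.antidiagonal m) (fun q : ℕ × ℕ => c q.1 q.2 * x ^ q.2 * y ^ q.1),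
    ← Finset.Nat.sum_antidiagonal_swap, Finset.Nat.sum_antidiagonal_eq_sum_range_succ_mk]
  refine Finset.sum_congr rfl fun j hj => ?_
  rw [hmon2 m j x y (Nat.lt_succ_iff.1 (Finset.mem_range.1 hj))]
  simp [mul_assoc]

lemma analyticAt_of_diff {f : ℂ × ℂ → ℂ} (hf : ∀ᶠ p in 𝓝 (0 : ℂ × ℂ), DifferentiableAt ℂ f p) :
    AnalyticAt ℂ f 0 := by
  obtain ⟨R, hR, h⟩ := Metric.eventually_nhds_iff_ball.1 hf
  obtain ⟨c, C, hc, hs⟩ := ds_expand f (R / 2) R (by positivity) (by linarith)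
    (fun p hp => (h p hp).differentiableWithinAt)
  exact ds_analyticAt (by positivity) hc hs

lemma analyticAt_of_diff2 {f : ℂ × ℂ → ℂ × ℂ} (hf : ∀ᶠ p in 𝓝 (0 : ℂ × ℂ), DifferentiableAt ℂ f p) :
    AnalyticAt ℂ f 0 := by
  have h1 := analyticAt_of_diff (f := fun p => (f p).1) (hf.mono fun p hp => hp.fst)
  have h2 := analyticAt_of_diff (f := fun p => (f p).2) (hf.mono fun p hp => hp.snd)
  exact h1.prod h2

/-- expansion of an analytic germ -/
lemma ds_of_analyticAt {f : ℂ × ℂ → ℂ} (hf : AnalyticAt ℂ f 0) :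
    ∃ (c : ℕ → ℕ → ℂ) (C R : ℝ), 0 < R ∧ (∀ n j, ‖c n j‖ ≤ C / R ^ (n + j)) ∧
      ∀ x y : ℂ, ‖x‖ < R → ‖y‖ < R →
        HasSum (fun q : ℕ × ℕ => c q.1 q.2 * x ^ q.2 * y ^ q.1) (f (x, y)) := by
  obtain ⟨R, hR, h⟩ := Metric.eventually_nhds_iff_ball.1 hf.eventually_analyticAt
  obtain ⟨c, C, hc, hs⟩ := ds_expand f (R / 2) R (by positivity) (by linarith)
    (fun p hp => (h p hp).differentiableAt.differentiableWithinAt)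
  exact ⟨c, C, R / 2, by positivity, hc, hs⟩

/-- if `f(x,0)=0`, the coefficients of the zeroth line vanish. -/
lemma ds_zero_line {f : ℂ × ℂ → ℂ} {c : ℕ → ℕ → ℂ} {R : ℝ} (hR : 0 < R)
    (hf : ∀ x y : ℂ, ‖x‖ < R → ‖y‖ < R →
        HasSum (fun q : ℕ × ℕ => c q.1 q.2 * x ^ q.2 * y ^ q.1) (f (x, y)))
    {x : ℂ} (hx : ‖x‖ < R) : HasSum (fun j => c 0 j * x ^ j) (f (x, 0)) := by
  have h := hf x 0 hx (by simpa using hR)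
  have hinj : Function.Injective (fun j : ℕ => ((0, j) : ℕ × ℕ)) := fun a b h => by simpa using h
  rw [← hinj.hasSum_iff] at h
  · refine h.congr_fun' fun j => by simp
  · rintro ⟨n, j⟩ hn
    have : n ≠ 0 := by rintro rfl; exact hn ⟨j, rfl⟩
    simp [this]

lemma div_lemma {f : ℂ × ℂ → ℂ} (hf : AnalyticAt ℂ f 0) :
    ∃ f1 : ℂ × ℂ → ℂ, AnalyticAt ℂ f1 0 ∧ ∀ᶠ p in 𝓝 (0 : ℂ × ℂ), f p = f (p.1, 0) + p.2 * f1 p := by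
  obtain ⟨c, C, R, hR, hc, hs⟩ := ds_of_analyticAt hf
  let c' : ℕ → ℕ → ℂ := fun n j => c (n + 1) j
  have hc' : ∀ n j, ‖c' n j‖ ≤ (C / R) / R ^ (n + j) := by
    intro n j
    refine (hc (n + 1) j).trans (le_of_eq ?_)
    rw [show n + 1 + j = (n + j) + 1 by ring, pow_succ]; field_simp
  let f1 : ℂ × ℂ → ℂ := fun p => ∑' q : ℕ × ℕ, c' q.1 q.2 * p.1 ^ q.2 * p.2 ^ q.1
  have hf1 : ∀ x y : ℂ, ‖x‖ < R → ‖y‖ < R →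
      HasSum (fun q : ℕ × ℕ => c' q.1 q.2 * x ^ q.2 * y ^ q.1) (f1 (x, y)) := by
    intro x y hx hy
    refine Summable.hasSum ?_
    apply Summable.of_norm
    simpa only [norm_mul, norm_pow] using ds_geom_summable hR hc' hx hy
  refine ⟨f1, ds_analyticAt hR hc' hf1, ?_⟩
  filter_upwards [Metric.ball_mem_nhds (0 : ℂ × ℂ) hR] with ⟨x, y⟩ hp
  rw [mem_ball_zero_iff, Prod.norm_def, max_lt_iff] at hp
  obtain ⟨hx, hy⟩ := hp
  have h0 := ds_zero_line hR hs hx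
  have h1 := (hf1 x y hx hy).mul_left y
  have i0 : Function.Injective (fun j : ℕ => ((0, j) : ℕ × ℕ)) := fun a b h => by simpa using h
  have i1 : Function.Injective (fun q : ℕ × ℕ => ((q.1 + 1, q.2) : ℕ × ℕ)) := by
    rintro ⟨a, b⟩ ⟨a', b'⟩ h; simpa using h
  let F : ℕ × ℕ → ℂ := fun q : ℕ × ℕ => c q.1 q.2 * x ^ q.2 * y ^ q.1
  have h0' : HasSum (F ∘ (fun j : ℕ => ((0, j) : ℕ × ℕ))) (f (x, 0)) :=
    h0.congr_fun' fun j => by simp [F]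
  have hline : HasSum (F ∘ (fun q : ℕ × ℕ => ((q.1 + 1, q.2) : ℕ × ℕ))) (y * f1 (x, y)) :=
    h1.congr_fun' fun q => by simp only [F, Function.comp, c', pow_succ]; ring
  rw [← i0.hasSum_range_iff] at h0'
  rw [← i1.hasSum_range_iff] at hline
  have hcompl : IsCompl (range (fun j : ℕ => ((0, j) : ℕ × ℕ)))
      (range (fun q : ℕ × ℕ => ((q.1 + 1, q.2) : ℕ × ℕ))) := by
    rw [isCompl_iff, disjoint_iff_inter_eq_empty, codisjoint_iff_le_sup]
    constructor
    · ext ⟨a, b⟩; simp; omega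
    · rintro ⟨a, b⟩ -
      rcases a with _ | a
      · left; exact ⟨b, rfl⟩
      · right; exact ⟨(a, b), rfl⟩
  exact (hs x y hx hy).unique (h0'.add_isCompl hcompl hline)

/-- conjugacy of two germs of vector fields by a germ of biholomorphism fixing 0 -/
def Conj (Z Z' : ℂ × ℂ → ℂ × ℂ) : Prop :=
  ∃ Ψ : ℂ × ℂ → ℂ × ℂ, AnalyticAt ℂ Ψ 0 ∧ Ψ 0 = 0 ∧
    (∃ e : (ℂ × ℂ) ≃L[ℂ] (ℂ × ℂ), (e : (ℂ × ℂ) →L[ℂ] (ℂ × ℂ)) = fderiv ℂ Ψ 0) ∧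
    ∀ᶠ p in 𝓝 (0 : ℂ × ℂ), fderiv ℂ Ψ p (Z' p) = Z (Ψ p)

lemma Conj.trans {Z Z' Z'' : ℂ × ℂ → ℂ × ℂ} (h : Conj Z Z') (h' : Conj Z' Z'') : Conj Z Z'' := by
  obtain ⟨Ψ, ha, h0, ⟨e, he⟩, hc⟩ := h
  obtain ⟨Φ, ha', h0', ⟨e', he'⟩, hc'⟩ := h'
  have hΦ : Tendsto Φ (𝓝 0) (𝓝 0) := by
    have := ha'.continuousAt.tendsto; rwa [h0'] at this
  have ha0 : AnalyticAt ℂ Ψ (Φ 0) := by rw [h0']; exact ha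
  refine ⟨Ψ ∘ Φ, ha0.comp ha', by simp [h0, h0'], ⟨e'.trans e, ?_⟩, ?_⟩
  · rw [fderiv_comp _ ha0.differentiableAt ha'.differentiableAt, h0', ← he, ← he']
    rfl
  · filter_upwards [hΦ.eventually hc, hc', hΦ.eventually ha.eventually_analyticAt,
      ha'.eventually_analyticAt] with p h1 h2 h3 h4
    rw [fderiv_comp _ h3.differentiableAt h4.differentiableAt]
    simp only [ContinuousLinearMap.comp_apply, Function.comp]
    rw [h2, h1]

lemma Conj.congr_right {Z Z' Z'' : ℂ × ℂ → ℂ × ℂ} (h : Conj Z Z') (h' : Z'' =ᶠ[𝓝 0] Z') :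
    Conj Z Z'' := by
  obtain ⟨Ψ, ha, h0, he, hc⟩ := h
  refine ⟨Ψ, ha, h0, he, ?_⟩
  filter_upwards [hc, h'] with p h1 h2
  rw [h2, h1]

section PBB

variable {E W : Type*} [NormedAddCommGroup E] [NormedSpace ℂ E]
  [NormedAddCommGroup W] [NormedSpace ℂ W]

lemma cauchy1 {h : W → E} {c : W} {R B : ℝ} (hR : 0 < R) (hd : DifferentiableOn ℂ h (ball c R))
    (hb : ∀ z ∈ ball c R, ‖h z‖ ≤ B) : ‖fderiv ℂ h c‖ ≤ 2 * B / R := by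
  apply Complex.norm_fderiv_le_div_of_mapsTo_ball hd _ hR
  intro z hz
  rw [mem_closedBall, dist_eq_norm]
  have h1 := hb z hz
  have h2 := hb c (mem_ball_self hR)
  calc _ ≤ ‖h z‖ + ‖h c‖ := norm_sub_le _ _
    _ ≤ _ := by linarith

lemma sub_ball0 {W : Type*} [NormedAddCommGroup W] {z : W} {ρ d : ℝ} (h : ‖z‖ + d ≤ ρ) : ball z d ⊆ ball 0 ρ := by
  apply ball_subset_ball'
  rw [dist_zero_right]; linarith

lemma contfd {h : W → E} {ρ B : ℝ} (hd : DifferentiableOn ℂ h (ball 0 ρ))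
    (hb : ∀ z ∈ ball 0 ρ, ‖h z‖ ≤ B) : ContinuousOn (fderiv ℂ h) (ball 0 ρ) := by
  intro z hz
  apply ContinuousAt.continuousWithinAt
  rw [mem_ball_zero_iff] at hz
  obtain ⟨d, hd0, hdz⟩ : ∃ d : ℝ, 0 < d ∧ ‖z‖ + 3 * d ≤ ρ := ⟨(ρ - ‖z‖) / 3, by linarith, by linarith⟩
  have hdat : ∀ u ∈ ball z (3 * d), DifferentiableAt ℂ h u := fun u hu =>
    hd.differentiableAt (isOpen_ball.mem_nhds (sub_ball0 hdz hu))
  have hB : 0 ≤ B := (norm_nonneg _).trans (hb z (sub_ball0 hdz (mem_ball_self (by positivity))))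
  have hK : ∀ u ∈ ball z (2 * d), ‖fderiv ℂ h u‖ ≤ 2 * B / d := by
    intro u hu
    have : ball u d ⊆ ball 0 ρ := by
      apply sub_ball0
      rw [mem_ball, dist_eq_norm] at hu
      have := norm_le_norm_add_norm_sub' u z
      linarith
    exact cauchy1 hd0 (hd.mono this) (fun z hz => hb z (this hz))
  have hLip : ∀ u ∈ ball z (2 * d), ∀ v ∈ ball z (2 * d), ‖h v - h u‖ ≤ 2 * B / d * ‖v - u‖ := by
    intro u hu v hv
    refine (convex_ball z (2 * d)).norm_image_sub_le_of_norm_fderiv_le (𝕜 := ℂ) ?_ hK hu hv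
    intro u hu
    exact hdat u (ball_subset_ball (by linarith) hu)
  have key : ∀ z' ∈ ball z d, ‖fderiv ℂ h z' - fderiv ℂ h z‖ ≤ 2 * (2 * B / d) / d * ‖z' - z‖ := by
    intro z' hz'
    rw [mem_ball, dist_eq_norm] at hz'
    let g : W → E := fun u => h (u + (z' - z)) - h u
    have hmem : ∀ u ∈ ball z d, u + (z' - z) ∈ ball z (2 * d) := by
      intro u hu
      rw [mem_ball, dist_eq_norm] at hu ⊢
      calc ‖u + (z' - z) - z‖ = ‖(u - z) + (z' - z)‖ := by congr 1; abel
        _ ≤ _ := norm_add_le _ _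
        _ < _ := by linarith
    have h1 : ∀ u ∈ ball z d, HasFDerivAt g (fderiv ℂ h (u + (z' - z)) - fderiv ℂ h u) u := by
      intro u hu
      apply HasFDerivAt.sub
      · have := (hdat _ (ball_subset_ball (by linarith) (hmem u hu))).hasFDerivAt
        simpa [Function.comp_def] using this.comp u ((hasFDerivAt_id u).add_const (z' - z))
      · exact (hdat _ (ball_subset_ball (by linarith) hu)).hasFDerivAt
    have h2 := cauchy1 (h := g) (B := 2 * B / d * ‖z' - z‖) hd0
      (fun u hu => (h1 u hu).differentiableAt.differentiableWithinAt) (by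
        intro u hu
        have := hLip u (ball_subset_ball (by linarith) hu) _ (hmem u hu)
        simpa [g] using this)
    rw [(h1 z (mem_ball_self hd0)).fderiv] at h2
    rw [add_sub_cancel] at h2
    refine h2.trans (le_of_eq (by ring))
  rw [ContinuousAt, tendsto_iff_norm_sub_tendsto_zero]
  refine squeeze_zero' (Eventually.of_forall fun _ => norm_nonneg _)
    (g := fun z' => 2 * (2 * B / d) / d * ‖z' - z‖) ?_ ?_
  · filter_upwards [ball_mem_nhds z hd0] with z' hz' using key z' hz'
  · have : Continuous fun z' => 2 * (2 * B / d) / d * ‖z' - z‖ := by fun_prop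
    have := this.tendsto z
    simpa using this

lemma unif_lim_diff [CompleteSpace E] {f : ℕ → W → E} {g : W → E} {ρ : ℝ}
    (hf : ∀ m, DifferentiableOn ℂ (f m) (ball 0 ρ))
    (hg : TendstoUniformlyOn f g atTop (ball 0 ρ)) : DifferentiableOn ℂ g (ball 0 ρ) := by
  intro z hz
  rw [mem_ball_zero_iff] at hz
  obtain ⟨d, hd0, hdz⟩ : ∃ d : ℝ, 0 < d ∧ ‖z‖ + 2 * d ≤ ρ := ⟨(ρ - ‖z‖) / 2, by linarith, by linarith⟩
  have hsub : ∀ u ∈ ball z d, ball u d ⊆ ball 0 ρ := by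
    intro u hu
    apply sub_ball0
    rw [mem_ball, dist_eq_norm] at hu
    have := norm_le_norm_add_norm_sub' u z
    linarith
  have hsub0 : ∀ u ∈ ball z d, u ∈ ball 0 ρ := fun u hu => hsub u hu (mem_ball_self hd0)
  have hdat : ∀ m, ∀ u ∈ ball 0 ρ, DifferentiableAt ℂ (f m) u := fun m u hu =>
    (hf m).differentiableAt (isOpen_ball.mem_nhds hu)
  have hUC : UniformCauchySeqOn (fun m => fderiv ℂ (f m)) atTop (ball z d) := by
    rw [Metric.uniformCauchySeqOn_iff]
    intro ε hε
    obtain ⟨N, hN⟩ := Metric.uniformCauchySeqOn_iff.1 hg.uniformCauchySeqOn (ε * d / 4) (by positivity)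
    refine ⟨N, fun m hm n hn u hu => ?_⟩
    have := cauchy1 (h := fun z => f m z - f n z) (c := u) (B := ε * d / 4) hd0
      (((hf m).sub (hf n)).mono (hsub u hu)) (by
        intro z hz
        have := hN m hm n hn z (hsub u hu hz)
        rw [dist_eq_norm] at this; exact this.le)
    rw [fderiv_fun_sub (hdat m u (hsub0 u hu)) (hdat n u (hsub0 u hu))] at this
    rw [dist_eq_norm]
    refine this.trans_lt ?_
    have : 2 * (ε * d / 4) / d = ε / 2 := by field_simp; norm_num
    linarith
  have hlim : ∀ u ∈ ball z d, ∃ L, Tendsto (fun m => fderiv ℂ (f m) u) atTop (𝓝 L) := fun u hu =>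
    cauchySeq_tendsto_of_complete (hUC.cauchySeq hu)
  choose! g' hg' using hlim
  have hT := hUC.tendstoUniformlyOn_of_tendsto hg'
  have := hasFDerivAt_of_tendstoUniformlyOn isOpen_ball hT
    (fun n x hx => (hdat n x (hsub0 x hx)).hasFDerivAt)
    (fun x hx => hg.tendsto_at (hsub0 x hx)) (mem_ball_self hd0)
  exact this.differentiableAt.differentiableWithinAt

end PBB

section PBB2
variable {E Q : Type*} [NormedAddCommGroup E] [NormedSpace ℂ E]
  [NormedAddCommGroup Q] [NormedSpace ℂ Q]

/-- scaling of the first coordinate -/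
def scl (Q : Type*) [NormedAddCommGroup Q] [NormedSpace ℂ Q] (s : ℝ) : ℂ × Q →L[ℂ] ℂ × Q :=
  ((s : ℂ) • ContinuousLinearMap.fst ℂ ℂ Q).prod (ContinuousLinearMap.snd ℂ ℂ Q)

lemma scl_apply (s : ℝ) (w : ℂ × Q) : scl Q s w = ((s : ℂ) * w.1, w.2) := rfl

lemma scl_norm {s : ℝ} (hs : s ∈ Icc (0:ℝ) 1) (w : ℂ × Q) : ‖scl Q s w‖ ≤ ‖w‖ := by
  rw [scl_apply, Prod.norm_def, Prod.norm_def]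
  apply max_le_max _ le_rfl
  simp only [norm_mul, norm_real, Real.norm_eq_abs, abs_of_nonneg hs.1]
  exact mul_le_of_le_one_left (norm_nonneg _) hs.2

lemma scl_opnorm {s : ℝ} (hs : s ∈ Icc (0:ℝ) 1) : ‖scl Q s‖ ≤ 1 :=
  ContinuousLinearMap.opNorm_le_bound _ zero_le_one fun w => by
    rw [one_mul]; exact scl_norm hs w

lemma scl_cont : Continuous (scl Q) := by
  have : scl Q = fun s : ℝ => (s : ℂ) • (((ContinuousLinearMap.fst ℂ ℂ Q).prod 0)) +
      (ContinuousLinearMap.prod 0 (ContinuousLinearMap.snd ℂ ℂ Q)) := by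
    funext s
    ext <;> simp [scl_apply]
  rw [this]
  fun_prop

lemma scl_contOn {E : Type*} [TopologicalSpace E] {h : ℂ × Q → E} {ρ : ℝ} (hd : ContinuousOn h (ball 0 ρ)) {w : ℂ × Q}
    (hw : w ∈ ball 0 ρ) : ContinuousOn (fun s : ℝ => h (scl Q s w)) (Icc 0 1) := by
  apply hd.comp
  · exact (scl_cont.clm_apply continuous_const).continuousOn
  · intro s hs
    rw [mem_ball_zero_iff] at hw ⊢
    exact (scl_norm hs w).trans_lt hw

lemma param_diff {h : ℂ × Q → E} {ρ B : ℝ} (hd : DifferentiableOn ℂ h (ball 0 ρ))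
    (hb : ∀ z ∈ ball 0 ρ, ‖h z‖ ≤ B) :
    DifferentiableOn ℂ (fun w => ∫ s in (0:ℝ)..1, h (scl Q s w)) (ball 0 ρ) := by
  intro w hw
  have hw' := hw
  rw [mem_ball_zero_iff] at hw
  obtain ⟨d, hd0, hdz⟩ : ∃ d : ℝ, 0 < d ∧ ‖w‖ + 2 * d ≤ ρ := ⟨(ρ - ‖w‖) / 2, by linarith, by linarith⟩
  have hcd := contfd hd hb
  have hlt : ∀ u ∈ ball w d, ‖u‖ + d < ρ := by
    intro u hu
    rw [mem_ball, dist_eq_norm] at hu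
    have := norm_le_norm_add_norm_sub' u w
    linarith
  have hI : ∀ s ∈ uIoc (0:ℝ) 1, s ∈ Icc (0:ℝ) 1 := by
    intro s hs
    rw [uIoc_of_le zero_le_one] at hs
    exact ⟨hs.1.le, hs.2⟩
  have hInt1 : ∀ u ∈ ball w d, IntervalIntegrable (fun s => h (scl Q s u)) MeasureTheory.volume 0 1 := by
    intro u hu
    apply ContinuousOn.intervalIntegrable
    rw [uIcc_of_le zero_le_one]
    exact scl_contOn hd.continuousOn (by rw [mem_ball_zero_iff]; linarith [hlt u hu])
  have := intervalIntegral.hasFDerivAt_integral_of_dominated_of_fderiv_le (𝕜 := ℂ) (a := 0) (b := 1)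
    (μ := MeasureTheory.volume) (s := ball w d) (x₀ := w) (bound := fun _ => 2 * B / d)
    (F := fun w s => h (scl Q s w)) (F' := fun w s => (fderiv ℂ h (scl Q s w)).comp (scl Q s))
    (ball_mem_nhds w hd0) ?_ ?_ ?_ ?_ ?_ ?_
  · exact this.differentiableAt.differentiableWithinAt
  · filter_upwards [ball_mem_nhds w hd0] with u hu
    exact (intervalIntegrable_iff.1 (hInt1 u hu)).aestronglyMeasurable
  · exact hInt1 w (mem_ball_self hd0)
  · rw [uIoc_of_le zero_le_one]
    refine (ContinuousOn.aestronglyMeasurable ?_ measurableSet_Icc).mono_measure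
      (MeasureTheory.Measure.restrict_mono Ioc_subset_Icc_self le_rfl)
    exact (scl_contOn hcd hw').clm_comp scl_cont.continuousOn
  · refine Eventually.of_forall fun s hs u hu => ?_
    have h1 : ball (scl Q s u) d ⊆ ball 0 ρ := by
      apply sub_ball0
      linarith [hlt u hu, scl_norm (hI s hs) u]
    have h2 := cauchy1 hd0 (hd.mono h1) (fun z hz => hb z (h1 hz))
    refine (ContinuousLinearMap.opNorm_comp_le _ _).trans ?_
    calc _ ≤ ‖fderiv ℂ h (scl Q s u)‖ * 1 := by gcongr; exact scl_opnorm (hI s hs)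
      _ ≤ _ := by simpa using h2
  · exact intervalIntegrable_const
  · refine Eventually.of_forall fun s hs u hu => ?_
    have h1 : scl Q s u ∈ ball 0 ρ := by
      rw [mem_ball_zero_iff]
      linarith [hlt u hu, scl_norm (hI s hs) u]
    exact ((hd.differentiableAt (isOpen_ball.mem_nhds h1)).hasFDerivAt).comp u (scl Q s).hasFDerivAt

end PBB2

section PBB3
variable {E Q : Type*} [NormedAddCommGroup E] [NormedSpace ℂ E] [CompleteSpace E]
  [NormedAddCommGroup Q] [NormedSpace ℂ Q]

lemma pbb {F : E × (ℂ × Q) → E} (hF : AnalyticAt ℂ F 0) (F0 : F 0 = 0)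
    (hDv : (fderiv ℂ F 0).comp (ContinuousLinearMap.inl ℂ E (ℂ × Q)) = 0) :
    ∃ v : ℂ × Q → E, ∃ ρ : ℝ, 0 < ρ ∧ DifferentiableOn ℂ v (ball 0 ρ) ∧ v 0 = 0 ∧
      ∀ t q, (t, q) ∈ ball (0 : ℂ × Q) ρ →
        HasDerivAt (fun t => t • v (t, q)) (F (v (t, q), (t, q))) t := by
  -- choice of radii
  have hcont : ContinuousAt (fun z => (fderiv ℂ F z).comp (ContinuousLinearMap.inl ℂ E (ℂ × Q))) 0 := by
    exact (hF.fderiv.continuousAt).clm_comp continuousAt_const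
  have hev : ∀ᶠ z in 𝓝 (0 : E × (ℂ × Q)), DifferentiableAt ℂ F z ∧
      ‖(fderiv ℂ F z).comp (ContinuousLinearMap.inl ℂ E (ℂ × Q))‖ < 1 / 2 := by
    have h1 : ∀ᶠ z in 𝓝 (0 : E × (ℂ × Q)), DifferentiableAt ℂ F z :=
      hF.eventually_analyticAt.mono fun z hz => hz.differentiableAt
    have h2 := hcont.norm.tendsto.eventually_lt_const (u := (1 / 2 : ℝ)) (by rw [hDv]; simp)
    exact h1.and h2
  obtain ⟨r, hr, hball⟩ := Metric.eventually_nhds_iff_ball.1 hev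
  have hc0 : ContinuousAt (fun w : ℂ × Q => F (0, w)) 0 := by
    have : ContinuousAt F ((fun w : ℂ × Q => ((0 : E), w)) 0) := hF.continuousAt
    exact ContinuousAt.comp (f := fun w : ℂ × Q => ((0 : E), w)) this (by fun_prop)
  have hev2 : ∀ᶠ w in 𝓝 (0 : ℂ × Q), ‖F (0, w)‖ < r / 4 := by
    apply hc0.norm.tendsto.eventually_lt_const
    have : F (0, 0) = 0 := F0
    simp [this]; exact hr
  obtain ⟨ρ', hρ', hball2⟩ := Metric.eventually_nhds_iff_ball.1 hev2
  set ρ := min ρ' r with hρdef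
  have hρ : 0 < ρ := lt_min hρ' hr
  have hmem : ∀ (a : E) (w : ℂ × Q), ‖a‖ < r → w ∈ ball 0 ρ → (a, w) ∈ ball (0 : E × (ℂ × Q)) r := by
    intro a w ha hw
    rw [mem_ball_zero_iff] at hw ⊢
    rw [Prod.norm_def]
    exact max_lt ha (hw.trans_le (min_le_right _ _))
  have hFd : ∀ (a : E) (w : ℂ × Q), ‖a‖ < r → w ∈ ball 0 ρ → DifferentiableAt ℂ F (a, w) :=
    fun a w ha hw => (hball _ (hmem a w ha hw)).1
  have hLip : ∀ (a b : E) (w : ℂ × Q), ‖a‖ < r → ‖b‖ < r → w ∈ ball 0 ρ →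
      ‖F (a, w) - F (b, w)‖ ≤ 1 / 2 * ‖a - b‖ := by
    intro a b w ha hb hw
    refine (convex_ball (0 : E) r).norm_image_sub_le_of_norm_hasFDerivWithin_le (𝕜 := ℂ)
      (f := fun a => F (a, w))
      (f' := fun a => (fderiv ℂ F (a, w)).comp (ContinuousLinearMap.inl ℂ E (ℂ × Q))) ?_ ?_
      (mem_ball_zero_iff.2 hb) (mem_ball_zero_iff.2 ha)
    · intro x hx
      have h1 := (hFd x w (mem_ball_zero_iff.1 hx) hw).hasFDerivAt
      exact (h1.comp x (hasFDerivAt_prodMk_left x w)).hasFDerivWithinAt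
    · intro x hx
      exact (hball _ (hmem x w (mem_ball_zero_iff.1 hx) hw)).2.le
  have hFb : ∀ (a : E) (w : ℂ × Q), ‖a‖ ≤ r / 2 → w ∈ ball 0 ρ → ‖F (a, w)‖ ≤ r / 2 := by
    intro a w ha hw
    have h1 := hLip a 0 w (by linarith) (by simpa using hr) hw
    have h2 := hball2 w (ball_subset_ball (min_le_left _ _) hw)
    have h3 := norm_le_norm_add_norm_sub' (F (a, w)) (F (0, w))
    rw [sub_zero] at h1
    linarith
  have hsclmem : ∀ (s : ℝ) (w : ℂ × Q), s ∈ Icc (0:ℝ) 1 → w ∈ ball 0 ρ → scl Q s w ∈ ball 0 ρ := by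
    intro s w hs hw
    rw [mem_ball_zero_iff] at hw ⊢
    exact (scl_norm hs w).trans_lt hw
  have hI : ∀ s ∈ uIoc (0:ℝ) 1, s ∈ Icc (0:ℝ) 1 := by
    intro s hs
    rw [uIoc_of_le zero_le_one] at hs
    exact ⟨hs.1.le, hs.2⟩
  let T : (ℂ × Q → E) → (ℂ × Q → E) := fun v w =>
    ∫ s in (0:ℝ)..1, F (v (scl Q s w), scl Q s w)
  have hgd : ∀ v : ℂ × Q → E, DifferentiableOn ℂ v (ball 0 ρ) → (∀ w ∈ ball 0 ρ, ‖v w‖ ≤ r / 2) →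
      DifferentiableOn ℂ (fun w => F (v w, w)) (ball 0 ρ) := by
    intro v hv hb w hw
    have h1 := hFd (v w) w (by linarith [hb w hw]) hw
    have h2 := hv.differentiableAt (isOpen_ball.mem_nhds hw)
    exact (DifferentiableAt.comp (f := fun w => (v w, w)) w h1
      (h2.prodMk differentiableAt_id)).differentiableWithinAt
  have hTb : ∀ v : ℂ × Q → E, (∀ w ∈ ball 0 ρ, ‖v w‖ ≤ r / 2) → ∀ w ∈ ball 0 ρ, ‖T v w‖ ≤ r / 2 := by
    intro v hb w hw
    have := intervalIntegral.norm_integral_le_of_norm_le_const (a := 0) (b := 1) (C := r / 2)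
      (f := fun s : ℝ => F (v (scl Q s w), scl Q s w)) (fun s hs =>
        hFb _ _ (hb _ (hsclmem s w (hI s hs) hw)) (hsclmem s w (hI s hs) hw))
    simpa using this
  have hTd : ∀ v : ℂ × Q → E, DifferentiableOn ℂ v (ball 0 ρ) → (∀ w ∈ ball 0 ρ, ‖v w‖ ≤ r / 2) →
      DifferentiableOn ℂ (T v) (ball 0 ρ) := by
    intro v hv hb
    exact param_diff (hgd v hv hb) (fun w hw => hFb _ _ (hb w hw) hw)
  have hTint : ∀ v : ℂ × Q → E, DifferentiableOn ℂ v (ball 0 ρ) → (∀ w ∈ ball 0 ρ, ‖v w‖ ≤ r / 2) →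
      ∀ w ∈ ball 0 ρ, IntervalIntegrable (fun s : ℝ => F (v (scl Q s w), scl Q s w))
        MeasureTheory.volume 0 1 := by
    intro v hv hb w hw
    apply ContinuousOn.intervalIntegrable
    rw [uIcc_of_le zero_le_one]
    exact scl_contOn (hgd v hv hb).continuousOn hw
  have hTl : ∀ u v : ℂ × Q → E, DifferentiableOn ℂ u (ball 0 ρ) → (∀ w ∈ ball 0 ρ, ‖u w‖ ≤ r / 2) →
      DifferentiableOn ℂ v (ball 0 ρ) → (∀ w ∈ ball 0 ρ, ‖v w‖ ≤ r / 2) → ∀ δ : ℝ,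
      (∀ w ∈ ball 0 ρ, ‖u w - v w‖ ≤ δ) → ∀ w ∈ ball 0 ρ, ‖T u w - T v w‖ ≤ δ / 2 := by
    intro u v hu hub hv hvb δ hδ w hw
    simp only [T]
    rw [← intervalIntegral.integral_sub (hTint u hu hub w hw) (hTint v hv hvb w hw)]
    have := intervalIntegral.norm_integral_le_of_norm_le_const (a := 0) (b := 1) (C := δ / 2)
      (f := fun s : ℝ => F (u (scl Q s w), scl Q s w) - F (v (scl Q s w), scl Q s w)) (fun s hs => by
        have hm := hsclmem s w (hI s hs) hw
        have h1 := hLip (u (scl Q s w)) (v (scl Q s w)) (scl Q s w) (by linarith [hub _ hm])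
          (by linarith [hvb _ hm]) hm
        linarith [hδ _ hm])
    simpa using this
  let V : ℕ → ℂ × Q → E := fun m => T^[m] 0
  have hVs : ∀ m, V (m + 1) = T (V m) := fun m => Function.iterate_succ_apply' T m 0
  have hV : ∀ m, DifferentiableOn ℂ (V m) (ball 0 ρ) ∧ ∀ w ∈ ball 0 ρ, ‖V m w‖ ≤ r / 2 := by
    intro m
    induction m with
    | zero =>
      refine ⟨differentiableOn_const (0 : E), fun w _ => ?_⟩
      simp only [V, Function.iterate_zero, id]
      simp; linarith
    | succ m ih => rw [hVs]; exact ⟨hTd _ ih.1 ih.2, hTb _ ih.2⟩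
  have hVdiff : ∀ m, ∀ w ∈ ball 0 ρ, ‖V (m + 1) w - V m w‖ ≤ r * (1 / 2) ^ m := by
    intro m
    induction m with
    | zero =>
      intro w hw
      have h1 := (hV 1).2 w hw
      have h2 := (hV 0).2 w hw
      have := norm_sub_le (V 1 w) (V 0 w)
      simp only [zero_add, pow_zero]; linarith
    | succ m ih =>
      intro w hw
      have := hTl (V (m + 1)) (V m) (hV _).1 (hV _).2 (hV _).1 (hV _).2 _ ih w hw
      rw [← hVs, ← hVs] at this
      refine this.trans (le_of_eq ?_)
      rw [pow_succ]; ring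
  have hcs : ∀ w ∈ ball (0 : ℂ × Q) ρ, ∃ L, Tendsto (fun m => V m w) atTop (𝓝 L) := by
    intro w hw
    apply cauchySeq_tendsto_of_complete
    apply cauchySeq_of_le_geometric (1 / 2) r (by norm_num)
    intro m
    rw [dist_comm, dist_eq_norm]; exact hVdiff m w hw
  choose! v hv using hcs
  have hvV : ∀ m, ∀ w ∈ ball 0 ρ, ‖V m w - v w‖ ≤ r * (1 / 2) ^ m / (1 - 1 / 2) := by
    intro m w hw
    rw [← dist_eq_norm]
    apply dist_le_of_le_geometric_of_tendsto (1 / 2) r (by norm_num) _ (hv w hw)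
    intro m
    rw [dist_comm, dist_eq_norm]; exact hVdiff m w hw
  have hlim0 : Tendsto (fun m : ℕ => r * (1 / 2 : ℝ) ^ m / (1 - 1 / 2)) atTop (𝓝 0) := by
    have := (tendsto_pow_atTop_nhds_zero_of_lt_one (r := (1 / 2 : ℝ)) (by norm_num) (by norm_num))
    have := (this.const_mul r).div_const (1 - 1 / 2)
    simpa using this
  have hunif : TendstoUniformlyOn V v atTop (ball 0 ρ) := by
    rw [Metric.tendstoUniformlyOn_iff]
    intro ε hε
    filter_upwards [hlim0.eventually_lt_const hε] with m hm w hw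
    rw [dist_comm, dist_eq_norm]
    exact (hvV m w hw).trans_lt hm
  have hvd : DifferentiableOn ℂ v (ball 0 ρ) := unif_lim_diff (fun m => (hV m).1) hunif
  have hvb : ∀ w ∈ ball 0 ρ, ‖v w‖ ≤ r / 2 := fun w hw =>
    le_of_tendsto (hv w hw).norm (Eventually.of_forall fun m => (hV m).2 w hw)
  have hfix : ∀ w ∈ ball 0 ρ, v w = T v w := by
    intro w hw
    have h1 : Tendsto (fun m => V (m + 1) w) atTop (𝓝 (v w)) := (hv w hw).comp (tendsto_add_atTop_nat 1)
    refine tendsto_nhds_unique h1 ?_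
    rw [tendsto_iff_norm_sub_tendsto_zero]
    have hl2 := hlim0.div_const 2
    rw [zero_div] at hl2
    refine squeeze_zero (fun _ => norm_nonneg _) (fun m => ?_) hl2
    rw [hVs]
    exact hTl (V m) v (hV m).1 (hV m).2 hvd hvb _ (hvV m) w hw
  refine ⟨v, ρ, hρ, hvd, ?_, ?_⟩
  · have h0 : (0 : ℂ × Q) ∈ ball 0 ρ := mem_ball_self hρ
    have h1 := hfix 0 h0
    simp only [T, map_zero] at h1
    simp only [intervalIntegral.integral_const, sub_zero, one_smul] at h1
    have h2 := hLip (v 0) 0 0 (by linarith [hvb 0 h0]) (by simpa using hr) h0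
    rw [← h1, show F ((0 : E), (0 : ℂ × Q)) = 0 from F0, sub_zero] at h2
    have := norm_nonneg (v 0)
    exact norm_eq_zero.1 (by linarith)
  · intro t q htq
    rw [mem_ball_zero_iff, Prod.norm_def, max_lt_iff] at htq
    obtain ⟨ht, hq⟩ := htq
    have hm : ∀ τ ∈ ball (0 : ℂ) ρ, (τ, q) ∈ ball (0 : ℂ × Q) ρ := by
      intro τ hτ
      rw [mem_ball_zero_iff, Prod.norm_def]
      exact max_lt (mem_ball_zero_iff.1 hτ) hq
    let g : ℂ → E := fun τ => F (v (τ, q), (τ, q))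
    have hg : DifferentiableOn ℂ g (ball 0 ρ) :=
      (hgd v hvd hvb).comp (f := fun τ : ℂ => (τ, q)) (by fun_prop) hm
    obtain ⟨G, hG⟩ := hg.isExactOn_ball
    have key : ∀ τ ∈ ball (0 : ℂ) ρ, τ • v (τ, q) = G τ - G 0 := by
      intro τ hτ
      rw [hfix _ (hm τ hτ)]
      have hh : ∀ s ∈ Icc (0:ℝ) 1, (s : ℂ) * τ ∈ ball (0 : ℂ) ρ := by
        intro s hs
        have := hsclmem s (τ, q) hs (hm τ hτ)
        rw [scl_apply, mem_ball_zero_iff, Prod.norm_def] at this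
        rw [mem_ball_zero_iff]
        exact (le_max_left _ _).trans_lt this
      have hder : ∀ s ∈ uIcc (0:ℝ) 1, HasDerivAt (fun s : ℝ => G ((s : ℂ) * τ)) (τ • g ((s : ℂ) * τ)) s := by
        intro s hs
        rw [uIcc_of_le zero_le_one] at hs
        have h1 := hG _ (hh s hs)
        have h2 : HasDerivAt (fun s : ℝ => (s : ℂ) * τ) τ s := by
          simpa using (Complex.ofRealCLM.hasDerivAt (x := s)).mul_const τ
        exact HasDerivAt.scomp s h1 h2
      have h3 := intervalIntegral.integral_eq_sub_of_hasDerivAt hder ?_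
      · simp only [ofReal_one, one_mul, ofReal_zero, zero_mul] at h3
        rw [← h3, intervalIntegral.integral_smul]
        rfl
      · have := (hTint v hvd hvb _ (hm τ hτ)).smul τ
        exact this
    have ht' : t ∈ ball (0 : ℂ) ρ := mem_ball_zero_iff.2 ht
    have h4 := (hG t ht').sub_const (G 0)
    refine h4.congr_of_eventuallyEq ?_
    filter_upwards [isOpen_ball.mem_nhds ht'] with τ hτ using key τ hτ

end PBB3

lemma flow_exists {V : ℂ × ℂ → ℂ × ℂ} (hV : AnalyticAt ℂ V 0) (V0 : V 0 = 0) :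
    ∃ φ : ℂ × (ℂ × ℂ) → ℂ × ℂ, ∃ ρ : ℝ, 0 < ρ ∧ DifferentiableOn ℂ φ (ball 0 ρ) ∧
      (∀ p, φ (0, p) = p) ∧
      ∀ t p, (t, p) ∈ ball (0 : ℂ × (ℂ × ℂ)) ρ → HasDerivAt (fun t => φ (t, p)) (V (φ (t, p))) t := by
  let F : (ℂ × ℂ) × (ℂ × (ℂ × ℂ)) → ℂ × ℂ := fun z => V (z.2.2 + z.2.1 • z.1)
  have hF : AnalyticAt ℂ F 0 := by
    have h1 : AnalyticAt ℂ (fun z : (ℂ × ℂ) × (ℂ × (ℂ × ℂ)) => z.2.2 + z.2.1 • z.1) 0 := by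
      have e1 : AnalyticAt ℂ (fun z : (ℂ × ℂ) × (ℂ × (ℂ × ℂ)) => z.2.2) 0 :=
        ((ContinuousLinearMap.snd ℂ ℂ (ℂ × ℂ)).comp (ContinuousLinearMap.snd ℂ (ℂ × ℂ) (ℂ × (ℂ × ℂ)))).analyticAt 0
      have e2 : AnalyticAt ℂ (fun z : (ℂ × ℂ) × (ℂ × (ℂ × ℂ)) => z.2.1) 0 :=
        ((ContinuousLinearMap.fst ℂ ℂ (ℂ × ℂ)).comp (ContinuousLinearMap.snd ℂ (ℂ × ℂ) (ℂ × (ℂ × ℂ)))).analyticAt 0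
      exact e1.add (e2.smul analyticAt_fst)
    refine AnalyticAt.comp (f := fun z : (ℂ × ℂ) × (ℂ × (ℂ × ℂ)) => z.2.2 + z.2.1 • z.1) ?_ h1
    simpa using hV
  have F0 : F 0 = 0 := by simp [F, V0]
  have hDv : (fderiv ℂ F 0).comp (ContinuousLinearMap.inl ℂ (ℂ × ℂ) (ℂ × (ℂ × ℂ))) = 0 := by
    have h1 : HasFDerivAt (fun a : ℂ × ℂ => F (a, 0))
        ((fderiv ℂ F 0).comp (ContinuousLinearMap.inl ℂ (ℂ × ℂ) (ℂ × (ℂ × ℂ)))) 0 :=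
      HasFDerivAt.comp (g := F) (f := fun a : ℂ × ℂ => (a, (0 : ℂ × (ℂ × ℂ)))) 0
        (hF.differentiableAt.hasFDerivAt) (hasFDerivAt_prodMk_left 0 0)
    have h2 : HasFDerivAt (fun a : ℂ × ℂ => F (a, 0)) (0 : ℂ × ℂ →L[ℂ] ℂ × ℂ) 0 := by
      have : (fun a : ℂ × ℂ => F (a, 0)) = fun _ => V 0 := by
        funext a; simp [F]
      rw [this]; exact hasFDerivAt_const _ _
    exact h1.unique h2
  obtain ⟨v, ρ, hρ, hvd, -, hder⟩ := pbb hF F0 hDv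
  refine ⟨fun w => w.2 + w.1 • v w, ρ, hρ, ?_, by simp, ?_⟩
  · exact differentiableOn_snd.add (differentiableOn_fst.smul hvd)
  · intro t p htp
    exact (hder t p htp).const_add p

lemma flow_exists' {V : ℂ × ℂ → ℂ × ℂ} (hV : AnalyticAt ℂ V 0) (V0 : V 0 = 0) :
    ∃ φ : ℂ × (ℂ × ℂ) → ℂ × ℂ, ∃ ρ : ℝ, 0 < ρ ∧ DifferentiableOn ℂ φ (ball 0 ρ) ∧
      (∀ p, φ (0, p) = p) ∧
      ∀ t p, (t, p) ∈ ball (0 : ℂ × (ℂ × ℂ)) ρ → HasDerivAt (fun t => φ (t, p)) (V (φ (t, p))) t ∧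
        fderiv ℂ φ (t, p) (0, V p) = V (φ (t, p)) := by
  obtain ⟨φ, ρ, hρ, hφd, hφ0, hφ⟩ := flow_exists hV V0
  -- Lipschitz
  obtain ⟨K, S, hS, hLip⟩ : ∃ K, ∃ S ∈ 𝓝 (0 : ℂ × ℂ), LipschitzOnWith K V S :=
    (hV.contDiffAt (n := 1)).exists_lipschitzOnWith
  have hφc : ContinuousAt φ 0 := (hφd.differentiableAt (ball_mem_nhds 0 hρ)).continuousAt
  have hφ00 : φ 0 = 0 := hφ0 0
  have hev : ∀ᶠ w in 𝓝 (0 : ℂ × (ℂ × ℂ)), φ w ∈ S := by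
    apply hφc.eventually; rw [hφ00]; exact hS
  obtain ⟨ρ1, hρ1, hS1⟩ := Metric.eventually_nhds_iff_ball.1 hev
  obtain ⟨ρ2, hρ2, hρ21, hρ2ρ⟩ : ∃ ρ2 : ℝ, 0 < ρ2 ∧ ρ2 ≤ ρ1 ∧ ρ2 ≤ ρ :=
    ⟨min ρ1 ρ, lt_min hρ1 hρ, min_le_left _ _, min_le_right _ _⟩
  have hmem : ∀ {t : ℂ} {p : ℂ × ℂ} {r : ℝ}, ‖t‖ < r → ‖p‖ < r → (t, p) ∈ ball (0 : ℂ × (ℂ × ℂ)) r := by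
    intro t p r ht hp
    rw [mem_ball_zero_iff, Prod.norm_def]; exact max_lt ht hp
  have hgroup : ∀ t s p, ‖t‖ < ρ2 / 2 → ‖s‖ < ρ2 / 2 → ‖p‖ < ρ2 / 2 → ‖φ (s, p)‖ < ρ2 →
      φ (t, φ (s, p)) = φ (t + s, p) := by
    intro t s p ht hs hp hsp
    let α : ℝ → ℂ × ℂ := fun θ => φ ((θ : ℂ) * t, φ (s, p))
    let β : ℝ → ℂ × ℂ := fun θ => φ ((θ : ℂ) * t + s, p)
    have hθ : ∀ θ ∈ Icc (0:ℝ) 1, ‖(θ : ℂ) * t‖ < ρ2 / 2 := by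
      intro θ hθ
      rw [norm_mul, norm_real, Real.norm_eq_abs, abs_of_nonneg hθ.1]
      exact (mul_le_of_le_one_left (norm_nonneg _) hθ.2).trans_lt ht
    have ha : ∀ θ ∈ Icc (0:ℝ) 1, ((θ : ℂ) * t, φ (s, p)) ∈ ball (0 : ℂ × (ℂ × ℂ)) ρ2 := fun θ h =>
      hmem (by linarith [hθ θ h]) hsp
    have hb : ∀ θ ∈ Icc (0:ℝ) 1, ((θ : ℂ) * t + s, p) ∈ ball (0 : ℂ × (ℂ × ℂ)) ρ2 := fun θ h =>
      hmem (by linarith [hθ θ h, norm_add_le ((θ : ℂ) * t) s]) (by linarith)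
    have hαd : ∀ θ ∈ Icc (0:ℝ) 1, HasDerivAt α (t • V (α θ)) θ := by
      intro θ h
      have h1 := hφ _ _ (ball_subset_ball hρ2ρ (ha θ h))
      have h2 : HasDerivAt (fun s : ℝ => (s : ℂ) * t) t θ := by
        simpa using (Complex.ofRealCLM.hasDerivAt (x := θ)).mul_const t
      exact HasDerivAt.scomp (h := fun s : ℝ => (s : ℂ) * t) θ h1 h2
    have hβd : ∀ θ ∈ Icc (0:ℝ) 1, HasDerivAt β (t • V (β θ)) θ := by
      intro θ h
      have h1 := hφ _ _ (ball_subset_ball hρ2ρ (hb θ h))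
      have h2 : HasDerivAt (fun θ : ℝ => (θ : ℂ) * t + s) t θ := by
        simpa using ((Complex.ofRealCLM.hasDerivAt (x := θ)).mul_const t).add_const s
      exact HasDerivAt.scomp (h := fun θ : ℝ => (θ : ℂ) * t + s) θ h1 h2
    have hL : ∀ θ : ℝ, θ ∈ Ico (0:ℝ) 1 → LipschitzOnWith (‖t‖₊ * K) (fun z => t • V z) S := by
      intro θ _
      apply LipschitzOnWith.of_dist_le_mul
      intro x hx y hy
      rw [dist_smul₀, NNReal.coe_mul, mul_assoc]
      have := hLip.dist_le_mul x hx y hy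
      exact mul_le_mul_of_nonneg_left this (norm_nonneg t)
    have := ODE_solution_unique_of_mem_Icc_right (v := fun _ z => t • V z) (s := fun _ => S)
      (f := α) (g := β) (a := 0) (b := 1) hL
      (fun θ h => (hαd θ h).continuousAt.continuousWithinAt)
      (fun θ h => (hαd θ (Ico_subset_Icc_self h)).hasDerivWithinAt)
      (fun θ h => hS1 _ (ball_subset_ball hρ21 (ha θ (Ico_subset_Icc_self h))))
      (fun θ h => (hβd θ h).continuousAt.continuousWithinAt)
      (fun θ h => (hβd θ (Ico_subset_Icc_self h)).hasDerivWithinAt)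
      (fun θ h => hS1 _ (ball_subset_ball hρ21 (hb θ (Ico_subset_Icc_self h))))
      (by simp [α, β, hφ0])
    have := this (right_mem_Icc.2 zero_le_one)
    simpa [α, β] using this
  refine ⟨φ, ρ2 / 2, by positivity, hφd.mono (ball_subset_ball (by linarith)), hφ0, ?_⟩
  intro t p htp
  have htp0 : (t, p) ∈ ball (0 : ℂ × (ℂ × ℂ)) ρ := ball_subset_ball (by linarith) htp
  refine ⟨hφ t p htp0, ?_⟩
  rw [mem_ball_zero_iff, Prod.norm_def, max_lt_iff] at htp
  obtain ⟨ht, hp⟩ := htp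
  simp only at ht hp
  have h0p : HasDerivAt (fun s => φ (s, p)) (V p) 0 := by
    have := hφ 0 p (hmem (by simpa using hρ) (by linarith))
    rwa [hφ0] at this
  have hL : HasDerivAt (fun s => φ (t, φ (s, p))) (fderiv ℂ φ (t, p) (0, V p)) 0 := by
    have h1 : HasFDerivAt φ (fderiv ℂ φ (t, p)) (t, φ (0, p)) := by
      rw [hφ0]; exact (hφd.differentiableAt (isOpen_ball.mem_nhds htp0)).hasFDerivAt
    exact h1.comp_hasDerivAt (f := fun s => (t, φ (s, p))) 0 ((hasDerivAt_const 0 t).prodMk h0p)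
  have hR : HasDerivAt (fun s => φ (t + s, p)) (V (φ (t, p))) 0 := by
    have := hφ t p htp0
    rw [← add_zero t] at this
    have := this.comp_const_add t 0
    simpa using this
  refine hL.unique (hR.congr_of_eventuallyEq ?_)
  have h1 : ∀ᶠ s in 𝓝 (0 : ℂ), ‖φ (s, p)‖ < ρ2 := by
    apply h0p.continuousAt.norm.eventually_lt_const
    show ‖φ (0, p)‖ < ρ2
    rw [hφ0]; linarith
  filter_upwards [h1, ball_mem_nhds (0 : ℂ) (show 0 < ρ2 / 2 by positivity)] with s hs1 hs2
  exact hgroup t s p ht (mem_ball_zero_iff.1 hs2) hp hs1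

lemma time_lemma {U1 U2 T : ℂ × ℂ → ℂ} {X : ℂ × ℂ → ℂ × ℂ} (hU1 : AnalyticAt ℂ U1 0)
    (hX : AnalyticAt ℂ X 0) (hX0 : X 0 = 0) (hU10 : U1 0 ≠ 0)
    (hU2 : ∀ᶠ p in 𝓝 (0 : ℂ × ℂ), U2 p ≠ 0) (hT : AnalyticAt ℂ T 0) (hT0 : T 0 = 0)
    (h : ∀ᶠ p in 𝓝 (0 : ℂ × ℂ), fderiv ℂ T p (X p) = 1 / U2 p - 1 / U1 p) :
    Conj (fun p => U1 p • X p) (fun p => U2 p • X p) := by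
  obtain ⟨φ, ρ, hρ, hφd, hφ0, hφ⟩ := flow_exists' (V := fun p => U1 p • X p) (hU1.smul hX) (by simp [hX0])
  let Φ : ℂ × ℂ → ℂ × (ℂ × ℂ) := fun p => (T p, p)
  have hΦ : AnalyticAt ℂ Φ 0 := hT.prod analyticAt_id
  have hΦ0 : Φ 0 = 0 := by simp [Φ, hT0]
  have hev : ∀ᶠ p in 𝓝 (0 : ℂ × ℂ), Φ p ∈ ball 0 ρ := by
    apply hΦ.continuousAt.eventually; rw [hΦ0]; exact ball_mem_nhds _ hρ
  have hΘ : ∀ᶠ p in 𝓝 (0 : ℂ × ℂ), HasFDerivAt (φ ∘ Φ)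
      ((fderiv ℂ φ (T p, p)).comp ((fderiv ℂ T p).prod (ContinuousLinearMap.id ℂ _))) p := by
    filter_upwards [hev, hT.eventually_analyticAt] with p hp hTp
    have h1 := (hφd.differentiableAt (isOpen_ball.mem_nhds hp)).hasFDerivAt
    exact h1.comp p (hTp.differentiableAt.hasFDerivAt.prodMk (hasFDerivAt_id p))
  have hsplit : ∀ p, (T p, p) ∈ ball (0 : ℂ × (ℂ × ℂ)) ρ → ∀ a : ℂ, 
      fderiv ℂ φ (T p, p) (a, 0) = a • (U1 (φ (T p, p)) • X (φ (T p, p))) := by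
    intro p hp a
    have h1 := (hφd.differentiableAt (isOpen_ball.mem_nhds hp)).hasFDerivAt
    have h2 := (hφ _ _ hp).1
    have h3 : HasDerivAt (fun t => φ (t, p)) (fderiv ℂ φ (T p, p) (1, 0)) (T p) :=
      h1.comp_hasDerivAt (f := fun t => (t, p)) (T p) ((hasDerivAt_id _).prodMk (hasDerivAt_const _ p))
    rw [h2.unique h3, ← map_smul]
    simp
  refine ⟨φ ∘ Φ, analyticAt_of_diff2 (hΘ.mono fun p hp => hp.differentiableAt), ?_, ?_, ?_⟩
  · simp [hΦ0]; exact hφ0 0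
  · refine ⟨ContinuousLinearEquiv.refl ℂ _, ?_⟩
    rw [hΘ.self_of_nhds.fderiv]
    have hm : (T 0, (0 : ℂ × ℂ)) ∈ ball (0 : ℂ × (ℂ × ℂ)) ρ := hev.self_of_nhds
    have h1 : (fderiv ℂ φ (T 0, 0)).comp (ContinuousLinearMap.inr ℂ ℂ (ℂ × ℂ)) =
        ContinuousLinearMap.id ℂ (ℂ × ℂ) := by
      have h2 := (hφd.differentiableAt (isOpen_ball.mem_nhds hm)).hasFDerivAt
      have h3 : HasFDerivAt (fun q => φ (T 0, q)) _ 0 := h2.comp (0 : ℂ × ℂ) (hasFDerivAt_prodMk_right (T 0) (0 : ℂ × ℂ))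
      have h4 : (fun q => φ (T 0, q)) = id := by funext q; rw [hT0, hφ0]; rfl
      rw [h4] at h3
      exact h3.unique (hasFDerivAt_id 0)
    apply ContinuousLinearMap.ext
    intro q
    have h5 : ((fderiv ℂ T 0 q, q) : ℂ × (ℂ × ℂ)) = (fderiv ℂ T 0 q, 0) + (0, q) := by simp
    have h6 := DFunLike.congr_fun h1 q
    simp only [ContinuousLinearMap.comp_apply, ContinuousLinearMap.inr_apply,
      ContinuousLinearMap.id_apply] at h6
    simp only [ContinuousLinearMap.comp_apply, ContinuousLinearMap.prod_apply,
      ContinuousLinearMap.id_apply]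
    rw [h5, map_add, h6, hsplit 0 hm]
    simp [hT0, hφ0, hX0]
  · have hU1' : ∀ᶠ p in 𝓝 (0 : ℂ × ℂ), U1 p ≠ 0 := hU1.continuousAt.eventually_ne hU10
    filter_upwards [hΘ, hev, h, hU1', hU2] with p h1 hm h2 h3 h4
    rw [h1.fderiv]
    simp only [ContinuousLinearMap.comp_apply, ContinuousLinearMap.prod_apply,
      ContinuousLinearMap.id_apply, map_smul, Function.comp, Φ]
    have h5 : ((fderiv ℂ T p (X p), X p) : ℂ × (ℂ × ℂ)) =
      (fderiv ℂ T p (X p), 0) + (U1 p)⁻¹ • (0, U1 p • X p) := by simp [h3]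
    have h6 := (hφ _ _ hm).2
    rw [h5, map_add, map_smul, h6, hsplit p hm, h2, ← add_smul, smul_smul]
    have h8 : U2 p * (1 / U2 p - 1 / U1 p + (U1 p)⁻¹) = 1 := by field_simp; ring
    rw [h8, one_smul]

open scoped ENNReal NNReal PowerSeries

lemma enn_cauchy (f g : ℕ → ℝ≥0∞) :
    ∑' n, ∑ p ∈ Finset.HasAntidiagonal.antidiagonal n, f p.1 * g p.2 = (∑' i, f i) * ∑' j, g j := by
  have h1 : (∑' i, f i) * ∑' j, g j = ∑' p : ℕ × ℕ, f p.1 * g p.2 := by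
    rw [ENNReal.tsum_prod', ← ENNReal.tsum_mul_right]
    congr 1; funext i; exact ENNReal.tsum_mul_left.symm
  rw [h1, ← (Finset.HasAntidiagonal.sigmaAntidiagonalEquivProd).tsum_eq, ENNReal.tsum_sigma']
  congr 1; funext n
  rw [← Finset.tsum_subtype (Finset.HasAntidiagonal.antidiagonal n) (fun p : ℕ × ℕ => f p.1 * g p.2)]
  rfl

/-- weighted ℓ¹ norm of a power series in x (level n) -/
def nn (W : ℕ → ℕ → ℝ≥0) (n : ℕ) (a : ℂ⟦X⟧) : ℝ≥0∞ := ∑' j, ‖PowerSeries.coeff j a‖ₑ * (W n j : ℝ≥0∞)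

/-- weighted ℓ¹ norm of a double power series -/
def NN (W : ℕ → ℕ → ℝ≥0) (c : ℂ⟦X⟧⟦X⟧) : ℝ≥0∞ := ∑' n, nn W n (PowerSeries.coeff n c)

def SubM (W : ℕ → ℕ → ℝ≥0) : Prop := ∀ n m i j, W (n + m) (i + j) ≤ W n i * W m j

lemma nn_add (W : ℕ → ℕ → ℝ≥0) (n : ℕ) (a b : ℂ⟦X⟧) : nn W n (a + b) ≤ nn W n a + nn W n b := by
  unfold nn
  rw [← ENNReal.tsum_add]
  refine ENNReal.tsum_le_tsum fun j => ?_
  rw [map_add, ← add_mul]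
  gcongr
  exact enorm_add_le _ _

lemma nn_neg (W : ℕ → ℕ → ℝ≥0) (n : ℕ) (a : ℂ⟦X⟧) : nn W n (-a) = nn W n a := by
  unfold nn; simp

lemma nn_zero (W : ℕ → ℕ → ℝ≥0) (n : ℕ) : nn W n 0 = 0 := by
  unfold nn; simp

lemma nn_sum (W : ℕ → ℕ → ℝ≥0) (n : ℕ) {ι : Type*} (s : Finset ι) (a : ι → ℂ⟦X⟧) :
    nn W n (∑ i ∈ s, a i) ≤ ∑ i ∈ s, nn W n (a i) := by
  classical
  induction s using Finset.induction_on with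
  | empty => simp [nn_zero]
  | insert i s hi ih =>
    rw [Finset.sum_insert hi, Finset.sum_insert hi]
    exact (nn_add _ _ _ _).trans (by gcongr)

lemma nn_mul {W : ℕ → ℕ → ℝ≥0} (hW : SubM W) (n m : ℕ) (a b : ℂ⟦X⟧) :
    nn W (n + m) (a * b) ≤ nn W n a * nn W m b := by
  unfold nn
  rw [← enn_cauchy]
  refine ENNReal.tsum_le_tsum fun j => ?_
  rw [PowerSeries.coeff_mul]
  calc _ ≤ (∑ p ∈ Finset.HasAntidiagonal.antidiagonal j, ‖PowerSeries.coeff p.1 a‖ₑ * ‖PowerSeries.coeff p.2 b‖ₑ) * (W (n + m) j : ℝ≥0∞) := by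
        gcongr
        refine (enorm_sum_le _ _).trans (Finset.sum_le_sum fun p _ => ?_)
        rw [enorm_mul]
    _ ≤ _ := by
        rw [Finset.sum_mul]
        refine Finset.sum_le_sum fun p hp => ?_
        rw [Finset.HasAntidiagonal.mem_antidiagonal] at hp
        rw [← hp]
        have : (W (n + m) (p.1 + p.2) : ℝ≥0∞) ≤ W n p.1 * W m p.2 := by
          exact_mod_cast hW n m p.1 p.2
        calc _ ≤ ‖PowerSeries.coeff p.1 a‖ₑ * ‖PowerSeries.coeff p.2 b‖ₑ * (W n p.1 * W m p.2) := by gcongr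
          _ = _ := by ring

lemma NN_add (W : ℕ → ℕ → ℝ≥0) (a b : ℂ⟦X⟧⟦X⟧) : NN W (a + b) ≤ NN W a + NN W b := by
  unfold NN
  rw [← ENNReal.tsum_add]
  exact ENNReal.tsum_le_tsum fun j => by rw [map_add]; exact nn_add _ _ _ _

lemma NN_neg (W : ℕ → ℕ → ℝ≥0) (a : ℂ⟦X⟧⟦X⟧) : NN W (-a) = NN W a := by
  unfold NN; simp [nn_neg]

lemma NN_zero (W : ℕ → ℕ → ℝ≥0) : NN W 0 = 0 := by
  unfold NN; simp [nn_zero]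

lemma NN_sub (W : ℕ → ℕ → ℝ≥0) (a b : ℂ⟦X⟧⟦X⟧) : NN W (a - b) ≤ NN W a + NN W b := by
  rw [sub_eq_add_neg]; exact (NN_add _ _ _).trans (by rw [NN_neg])

lemma NN_mul {W : ℕ → ℕ → ℝ≥0} (hW : SubM W) (a b : ℂ⟦X⟧⟦X⟧) : NN W (a * b) ≤ NN W a * NN W b := by
  unfold NN
  rw [← enn_cauchy]
  refine ENNReal.tsum_le_tsum fun n => ?_
  rw [PowerSeries.coeff_mul]
  refine (nn_sum _ _ _ _).trans (Finset.sum_le_sum fun p hp => ?_)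
  rw [Finset.HasAntidiagonal.mem_antidiagonal] at hp
  rw [← hp]
  exact nn_mul hW _ _ _ _

lemma nn_one {W : ℕ → ℕ → ℝ≥0} (hW : W 0 0 = 1) : nn W 0 1 = 1 := by
  unfold nn
  rw [tsum_eq_single 0]
  · simp [hW]
  · intro j hj; simp [PowerSeries.coeff_one, hj]

lemma NN_one {W : ℕ → ℕ → ℝ≥0} (hW : W 0 0 = 1) : NN W 1 = 1 := by
  unfold NN
  rw [tsum_eq_single 0]
  · simp [nn_one hW]
  · intro j hj; simp [PowerSeries.coeff_one, hj, nn_zero]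

lemma NN_pow {W : ℕ → ℕ → ℝ≥0} (hW : SubM W) (hW0 : W 0 0 = 1) (a : ℂ⟦X⟧⟦X⟧) (l : ℕ) :
    NN W (a ^ l) ≤ NN W a ^ l := by
  induction l with
  | zero => simp [NN_one hW0]
  | succ l ih => rw [pow_succ, pow_succ]; exact (NN_mul hW _ _).trans (by gcongr)

/-- substitution y ↦ y g in a double series -/
def ccmp (f g : ℂ⟦X⟧⟦X⟧) : ℂ⟦X⟧⟦X⟧ := PowerSeries.mk fun n =>
  ∑ p ∈ Finset.HasAntidiagonal.antidiagonal n, PowerSeries.coeff p.1 f * PowerSeries.coeff p.2 (g ^ p.1)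

lemma NN_ccmp {W : ℕ → ℕ → ℝ≥0} (hW : SubM W) (hW0 : W 0 0 = 1) (f g : ℂ⟦X⟧⟦X⟧) :
    NN W (ccmp f g) ≤ ∑' l, nn W l (PowerSeries.coeff l f) * NN W g ^ l := by
  calc NN W (ccmp f g) ≤ ∑' n, ∑ p ∈ Finset.HasAntidiagonal.antidiagonal n,
        nn W p.1 (PowerSeries.coeff p.1 f) * nn W p.2 (PowerSeries.coeff p.2 (g ^ p.1)) := by
        unfold NN ccmp
        refine ENNReal.tsum_le_tsum fun n => ?_
        rw [PowerSeries.coeff_mk]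
        refine (nn_sum _ _ _ _).trans (Finset.sum_le_sum fun p hp => ?_)
        rw [Finset.HasAntidiagonal.mem_antidiagonal] at hp
        rw [← hp]
        exact nn_mul hW _ _ _ _
    _ = ∑' p : ℕ × ℕ, nn W p.1 (PowerSeries.coeff p.1 f) * nn W p.2 (PowerSeries.coeff p.2 (g ^ p.1)) := by
        rw [← (Finset.HasAntidiagonal.sigmaAntidiagonalEquivProd).tsum_eq, ENNReal.tsum_sigma']
        congr 1; funext n
        rw [← Finset.tsum_subtype (Finset.HasAntidiagonal.antidiagonal n) (fun p : ℕ × ℕ =>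
          nn W p.1 (PowerSeries.coeff p.1 f) * nn W p.2 (PowerSeries.coeff p.2 (g ^ p.1)))]
        rfl
    _ = ∑' l, nn W l (PowerSeries.coeff l f) * NN W (g ^ l) := by
        rw [ENNReal.tsum_prod']
        congr 1; funext l; unfold NN; rw [← ENNReal.tsum_mul_left]
    _ ≤ _ := ENNReal.tsum_le_tsum fun l => by gcongr; exact NN_pow hW hW0 _ _


def Wt (σ : ℕ) (ρ κ r : ℝ≥0) (n j : ℕ) : ℝ≥0 := ρ ^ j * κ ^ (j - σ * n) * r ^ n

lemma Wt_sub (σ : ℕ) (ρ κ r : ℝ≥0) (hκ : 1 ≤ κ) : SubM (Wt σ ρ κ r) := by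
  intro n m i j
  unfold Wt
  have h : κ ^ (i + j - σ * (n + m)) ≤ κ ^ (i - σ * n) * κ ^ (j - σ * m) := by
    rw [← pow_add]
    apply pow_le_pow_right₀ hκ
    rw [mul_add]; omega
  calc _ ≤ ρ ^ (i + j) * (κ ^ (i - σ * n) * κ ^ (j - σ * m)) * r ^ (n + m) := by gcongr
    _ = _ := by ring

lemma Wt_zero (σ : ℕ) (ρ κ r : ℝ≥0) : Wt σ ρ κ r 0 0 = 1 := by simp [Wt]

def lowN (n k : ℕ) (μ : ℂ) (a : ℕ → ℂ) : ℕ → ℂ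
  | i => (a i - if h : k ≤ i ∧ 0 < k then (((i - k : ℕ) : ℂ) + n * μ) * lowN n k μ a (i - k) else 0) / n
termination_by i => i
decreasing_by omega

lemma sum_shift_le (g : ℕ → ℝ) (hg : ∀ i, 0 ≤ g i) (k L : ℕ) :
    ∑ i ∈ Finset.range L, (if k ≤ i then g (i - k) else 0) ≤ ∑ i ∈ Finset.range L, g i := by
  rcases le_or_gt k L with h | h
  · obtain ⟨m, rfl⟩ := Nat.exists_eq_add_of_le h
    rw [Finset.sum_range_add, Finset.sum_eq_zero (s := Finset.range k)]
    · simp only [Nat.le_add_right, if_true, Nat.add_sub_cancel_left, zero_add]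
      exact Finset.sum_le_sum_of_subset_of_nonneg (by intro x; simp; omega) (fun i _ _ => hg i)
    · intro i hi; rw [Finset.mem_range] at hi; rw [if_neg (by omega)]
  · rw [Finset.sum_eq_zero]
    · exact Finset.sum_nonneg fun i _ => hg i
    · intro i hi; rw [Finset.mem_range] at hi; rw [if_neg (by omega)]

lemma lowN_bound {n k : ℕ} (hn : 1 ≤ n) (hk : 1 ≤ k) (σ : ℕ) (μ : ℂ) (ρ : ℝ) (hρ : 0 ≤ ρ)
    (h1 : (σ + ‖μ‖) * ρ ^ k ≤ 1 / 2) (a : ℕ → ℂ) :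
    n * ∑ i ∈ Finset.range (σ * n + 1), ‖lowN n k μ a i‖ * ρ ^ i ≤
      2 * ∑ i ∈ Finset.range (σ * n + 1), ‖a i‖ * ρ ^ i := by
  have hn' : (0 : ℝ) < n := by exact_mod_cast hn
  have key : ∀ i ∈ Finset.range (σ * n + 1), n * (‖lowN n k μ a i‖ * ρ ^ i) ≤
      ‖a i‖ * ρ ^ i + n / 2 * (if k ≤ i then ‖lowN n k μ a (i - k)‖ * ρ ^ (i - k) else 0) := by
    intro i hi
    rw [Finset.mem_range] at hi
    have e : (n : ℂ) * lowN n k μ a i = a i - if k ≤ i then (((i - k : ℕ) : ℂ) + n * μ) * lowN n k μ a (i - k) else 0 := by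
      conv_lhs => rw [lowN]
      have : (n : ℂ) ≠ 0 := by exact_mod_cast hn'.ne'
      by_cases hki : k ≤ i
      · simp [hki, show 0 < k from hk]; field_simp
      · simp [hki]; field_simp
    have e2 : n * ‖lowN n k μ a i‖ = ‖(n : ℂ) * lowN n k μ a i‖ := by simp
    by_cases hki : k ≤ i
    · rw [if_pos hki] at e ⊢
      have e3 : ‖((i - k : ℕ) : ℂ) + n * μ‖ ≤ n * (σ + ‖μ‖) := by
        refine (norm_add_le _ _).trans ?_
        rw [norm_mul, Complex.norm_natCast, Complex.norm_natCast]
        have : ((i - k : ℕ) : ℝ) ≤ σ * n := by exact_mod_cast (by omega : i - k ≤ σ * n)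
        linarith
      have e4 : ρ ^ i = ρ ^ k * ρ ^ (i - k) := by rw [← pow_add]; congr 1; omega
      have e5 : n * ‖lowN n k μ a i‖ ≤ ‖a i‖ + n * (σ + ‖μ‖) * ‖lowN n k μ a (i - k)‖ := by
        rw [e2, e]
        refine (norm_sub_le _ _).trans ?_
        rw [norm_mul]
        gcongr
      have e6 : n * (σ + ‖μ‖) * ‖lowN n k μ a (i - k)‖ * ρ ^ i ≤ n / 2 * (‖lowN n k μ a (i - k)‖ * ρ ^ (i - k)) := by
        rw [e4]
        calc _ = n * (‖lowN n k μ a (i - k)‖ * ρ ^ (i - k)) * ((σ + ‖μ‖) * ρ ^ k) := by ring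
          _ ≤ n * (‖lowN n k μ a (i - k)‖ * ρ ^ (i - k)) * (1 / 2) := by gcongr
          _ = _ := by ring
      have e7 := mul_le_mul_of_nonneg_right e5 (pow_nonneg hρ i)
      rw [add_mul] at e7
      linarith
    · rw [if_neg hki] at e ⊢
      rw [← mul_assoc, e2, e]; simp
  have h2 := Finset.sum_le_sum key
  rw [Finset.sum_add_distrib, ← Finset.mul_sum, ← Finset.mul_sum] at h2
  have h3 := sum_shift_le (fun i => ‖lowN n k μ a i‖ * ρ ^ i) (fun i => by positivity) k (σ * n + 1)
  have h4 := mul_le_mul_of_nonneg_left h3 (by positivity : (0:ℝ) ≤ n / 2)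
  linarith

def hiT (n k : ℕ) (μ : ℂ) (a : ℕ → ℂ) (i l : ℕ) : ℂ :=
  (-(n : ℂ)) ^ l * a (i + (l + 1) * k) / ∏ s ∈ Finset.range (l + 1), (((i + s * k : ℕ) : ℂ) + n * μ)

def hiN (n k : ℕ) (μ : ℂ) (a : ℕ → ℂ) (i : ℕ) : ℂ := ∑' l, hiT n k μ a i l

lemma hiT_bound {n k : ℕ} (hn : 1 ≤ n) (σ : ℕ) (μ : ℂ) (ρ κ r : ℝ≥0)
    {δ : ℝ} (hδ : 0 < δ) (hδμ : ∀ i : ℕ, σ * n < i → δ * n ≤ ‖(i : ℂ) + n * μ‖)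
    (h2 : 2 ≤ δ * (ρ * κ) ^ k) (a : ℕ → ℂ) (i l : ℕ) (hi : σ * n < i) :
    n * (‖hiT n k μ a i l‖ * Wt σ ρ κ r n i) ≤
      (1 / 2) ^ (l + 1) * (‖a (i + (l + 1) * k)‖ * Wt σ ρ κ r n (i + (l + 1) * k)) := by
  have hn' : (0 : ℝ) < n := by exact_mod_cast hn
  have hW : (Wt σ ρ κ r n (i + (l + 1) * k) : ℝ) = Wt σ ρ κ r n i * ((ρ * κ) ^ k) ^ (l + 1) := by
    unfold Wt
    have : i + (l + 1) * k - σ * n = (i - σ * n) + (l + 1) * k := by omega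
    rw [this]; push_cast; ring
  have hP : (δ * n) ^ (l + 1) ≤ ‖∏ s ∈ Finset.range (l + 1), (((i + s * k : ℕ) : ℂ) + n * μ)‖ := by
    rw [norm_prod]
    calc (δ * n) ^ (l + 1) = ∏ s ∈ Finset.range (l + 1), (δ * n) := by simp
      _ ≤ _ := by
        apply Finset.prod_le_prod
        · intros; positivity
        · intro s _; exact hδμ _ (by nlinarith [Nat.zero_le (s * k)])
  have hP0 : 0 < (δ * n) ^ (l + 1) := by positivity
  unfold hiT
  rw [norm_div, norm_mul, norm_pow, norm_neg, Complex.norm_natCast, hW]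
  have h3 : (n : ℝ) ^ l * ‖a (i + (l + 1) * k)‖ / ‖∏ s ∈ Finset.range (l + 1), (((i + s * k : ℕ) : ℂ) + n * μ)‖
      ≤ (n : ℝ) ^ l * ‖a (i + (l + 1) * k)‖ / (δ * n) ^ (l + 1) := by
    gcongr
  have h4 : (1 : ℝ) ≤ (1 / 2) ^ (l + 1) * δ ^ (l + 1) * ((ρ * κ) ^ k) ^ (l + 1) := by
    rw [← mul_pow, ← mul_pow]
    apply one_le_pow₀; linarith
  calc _ ≤ n * ((n : ℝ) ^ l * ‖a (i + (l + 1) * k)‖ / (δ * n) ^ (l + 1) * Wt σ ρ κ r n i) := by gcongr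
    _ = (1 / δ ^ (l + 1)) * (‖a (i + (l + 1) * k)‖ * Wt σ ρ κ r n i) := by
      rw [mul_pow, pow_succ (n : ℝ) l]; field_simp
    _ ≤ (1 / δ ^ (l + 1)) * (‖a (i + (l + 1) * k)‖ * Wt σ ρ κ r n i) * ((1 / 2) ^ (l + 1) * δ ^ (l + 1) * ((ρ * κ) ^ k) ^ (l + 1)) := by
      exact le_mul_of_one_le_right (by positivity) h4
    _ = _ := by field_simp


lemma cnn_nat (n : ℕ) : ‖(n : ℂ)‖₊ = n := by
  apply NNReal.eq; simp

lemma summable_of_enorm {f : ℕ → ℂ} (h : ∑' i, ‖f i‖ₑ ≠ ∞) : Summable f := by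
  have : Summable fun i => ‖f i‖₊ := by
    rw [← ENNReal.tsum_coe_ne_top_iff_summable]; exact h
  exact Summable.of_nnnorm this

lemma enn_half_sum : ∑' l : ℕ, (2⁻¹ : ℝ≥0∞) ^ (l + 1) = 1 := by
  rw [ENNReal.tsum_geometric_add_one, ENNReal.one_sub_inv_two, inv_inv]
  exact ENNReal.inv_mul_cancel (by simp) (by simp)

lemma hiT_ebound {n k : ℕ} (hn : 1 ≤ n) (σ : ℕ) (μ : ℂ) (ρ κ r : ℝ≥0)
    {δ : ℝ} (hδ : 0 < δ) (hδμ : ∀ i : ℕ, σ * n < i → δ * n ≤ ‖(i : ℂ) + n * μ‖)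
    (h2 : 2 ≤ δ * (ρ * κ) ^ k) (a : ℕ → ℂ) (i l : ℕ) (hi : σ * n < i) :
    (n : ℝ≥0∞) * (‖hiT n k μ a i l‖ₑ * Wt σ ρ κ r n i) ≤
      2⁻¹ ^ (l + 1) * (‖a (i + (l + 1) * k)‖ₑ * Wt σ ρ κ r n (i + (l + 1) * k)) := by
  have h := hiT_bound hn σ μ ρ κ r hδ hδμ h2 a i l hi
  have h' : (n : ℝ≥0) * (‖hiT n k μ a i l‖₊ * Wt σ ρ κ r n i) ≤
      2⁻¹ ^ (l + 1) * (‖a (i + (l + 1) * k)‖₊ * Wt σ ρ κ r n (i + (l + 1) * k)) := by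
    rw [← NNReal.coe_le_coe]; push_cast; simpa using h
  have h3 := ENNReal.coe_le_coe.2 h'
  push_cast at h3
  exact h3

lemma hiN_ebound {n k : ℕ} (hn : 1 ≤ n) (σ : ℕ) (μ : ℂ) (ρ κ r : ℝ≥0)
    {δ : ℝ} (hδ : 0 < δ) (hδμ : ∀ i : ℕ, σ * n < i → δ * n ≤ ‖(i : ℂ) + n * μ‖)
    (h2 : 2 ≤ δ * (ρ * κ) ^ k) (a : ℕ → ℂ) (i : ℕ) (hi : σ * n < i) :
    (n : ℝ≥0∞) * (‖hiN n k μ a i‖ₑ * Wt σ ρ κ r n i) ≤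
      ∑' l, 2⁻¹ ^ (l + 1) * (‖a (i + (l + 1) * k)‖ₑ * Wt σ ρ κ r n (i + (l + 1) * k)) := by
  calc _ ≤ (n : ℝ≥0∞) * ((∑' l, ‖hiT n k μ a i l‖ₑ) * Wt σ ρ κ r n i) := by
        gcongr; exact enorm_tsum_le_tsum_enorm
    _ = ∑' l, (n : ℝ≥0∞) * (‖hiT n k μ a i l‖ₑ * Wt σ ρ κ r n i) := by
        rw [← ENNReal.tsum_mul_right, ← ENNReal.tsum_mul_left]
    _ ≤ _ := ENNReal.tsum_le_tsum fun l => hiT_ebound hn σ μ ρ κ r hδ hδμ h2 a i l hi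

lemma Wt_pos (σ : ℕ) {ρ κ r : ℝ≥0} (hρ : 0 < ρ) (hκ : 1 ≤ κ) (hr : 0 < r) (n j : ℕ) : 0 < Wt σ ρ κ r n j := by
  unfold Wt
  have : 0 < κ := lt_of_lt_of_le one_pos hκ
  positivity

lemma hi_sum_le {α : ℕ → ℝ≥0∞} (k : ℕ) :
    ∑' i, ∑' l, 2⁻¹ ^ (l + 1) * α (i + (l + 1) * k) ≤ ∑' i, α i := by
  rw [ENNReal.tsum_comm]
  calc _ = ∑' l : ℕ, 2⁻¹ ^ (l + 1) * ∑' i, α (i + (l + 1) * k) := by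
        congr 1; funext l; rw [ENNReal.tsum_mul_left]
    _ ≤ ∑' l : ℕ, 2⁻¹ ^ (l + 1) * ∑' i, α i := by
        refine ENNReal.tsum_le_tsum fun l => ?_
        apply mul_le_mul_right
        exact ENNReal.tsum_comp_le_tsum_of_injective (f := fun i => i + (l + 1) * k)
          (add_left_injective ((l + 1) * k)) α
    _ = _ := by rw [ENNReal.tsum_mul_right, enn_half_sum, one_mul]

lemma hiN_rec {n k : ℕ} (hn : 1 ≤ n) (σ : ℕ) (μ : ℂ) {ρ κ r : ℝ≥0} (hρ : 0 < ρ) (hκ : 1 ≤ κ) (hr : 0 < r)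
    {δ : ℝ} (hδ : 0 < δ) (hδμ : ∀ i : ℕ, σ * n < i → δ * n ≤ ‖(i : ℂ) + n * μ‖)
    (h2 : 2 ≤ δ * (ρ * κ) ^ k) (a : ℕ → ℂ) (ha : ∑' j, ‖a j‖ₑ * (Wt σ ρ κ r n j : ℝ≥0∞) ≠ ∞)
    (i : ℕ) (hi : σ * n < i) :
    n * hiN n k μ a (i + k) + ((i : ℂ) + n * μ) * hiN n k μ a i = a (i + k) := by
  have hn' : (0 : ℝ) < n := by exact_mod_cast hn
  have hne : ∀ j, σ * n < j → (j : ℂ) + n * μ ≠ 0 := by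
    intro j hj
    rw [← norm_pos_iff]
    exact lt_of_lt_of_le (by positivity) (hδμ j hj)
  have hs : Summable (hiT n k μ a i) := by
    apply summable_of_enorm
    have h1 : ∑' l, (n : ℝ≥0∞) * (‖hiT n k μ a i l‖ₑ * Wt σ ρ κ r n i) ≠ ∞ := by
      apply ne_top_of_le_ne_top ha
      calc _ ≤ ∑' l, 2⁻¹ ^ (l + 1) * (‖a (i + (l + 1) * k)‖ₑ * Wt σ ρ κ r n (i + (l + 1) * k)) :=
            ENNReal.tsum_le_tsum fun l => hiT_ebound hn σ μ ρ κ r hδ hδμ h2 a i l hi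
        _ ≤ _ := ENNReal.le_tsum (f := fun i => ∑' l : ℕ, 2⁻¹ ^ (l + 1) * (‖a (i + (l + 1) * k)‖ₑ * (Wt σ ρ κ r n (i + (l + 1) * k) : ℝ≥0∞))) i
        _ ≤ _ := hi_sum_le (α := fun j => ‖a j‖ₑ * Wt σ ρ κ r n j) k
    rw [ENNReal.tsum_mul_left, ENNReal.tsum_mul_right] at h1
    intro h
    rw [h] at h1
    apply h1
    have := (Wt_pos σ hρ hκ hr n i).ne'
    rw [ENNReal.top_mul (by simpa using this), ENNReal.mul_top (by simp; omega)]
  have h0 : hiN n k μ a i = hiT n k μ a i 0 + ∑' l, hiT n k μ a i (l + 1) := hs.tsum_eq_zero_add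
  have h3 : ∀ l, hiT n k μ a i (l + 1) = -(n : ℂ) / ((i : ℂ) + n * μ) * hiT n k μ a (i + k) l := by
    intro l
    unfold hiT
    rw [Finset.prod_range_succ']
    have : ∀ s : ℕ, i + (s + 1) * k = i + k + s * k := fun s => by ring
    simp only [this, zero_mul, add_zero]
    rw [pow_succ]
    have e1 := hne i hi
    have e2 : ∏ x ∈ Finset.range (l + 1), (((i + k + x * k : ℕ) : ℂ) + n * μ) ≠ 0 :=
      Finset.prod_ne_zero_iff.2 fun s _ => hne _ (by nlinarith [Nat.zero_le (s * k)])
    field_simp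
  rw [h0]
  simp only [h3]
  rw [tsum_mul_left]
  have e1 := hne i hi
  change n * hiN n k μ a (i + k) + ((i : ℂ) + n * μ) * (hiT n k μ a i 0 + -(n : ℂ) / ((i : ℂ) + n * μ) * hiN n k μ a (i + k)) = _
  have h5 : hiT n k μ a i 0 = a (i + k) / ((i : ℂ) + n * μ) := by simp [hiT]
  rw [h5]
  field_simp
  ring

lemma enn_shift (k : ℕ) (g : ℕ → ℝ≥0∞) : ∑' i, (if k ≤ i then g (i - k) else 0) = ∑' i, g i := by
  rw [← (add_left_injective k).tsum_eq (f := fun i => if k ≤ i then g (i - k) else 0)]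
  · simp
  · intro i hi
    simp only [Function.mem_support, ne_eq, ite_eq_right_iff, not_forall] at hi
    exact ⟨i - k, by have := hi.1; simp; omega⟩

set_option maxHeartbeats 1600000 in
lemma lin_exists {n k : ℕ} (hn : 1 ≤ n) (hk : 1 ≤ k) (σ : ℕ) (μ : ℂ) {ρ κ r : ℝ≥0} (hρ : 0 < ρ)
    (hκ : 1 ≤ κ) (hr : 0 < r) (h1 : (σ + ‖μ‖) * ρ ^ k ≤ 1 / 2)
    {δ : ℝ} (hδ : 0 < δ) (hδμ : ∀ i : ℕ, σ * n < i → δ * n ≤ ‖(i : ℂ) + n * μ‖)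
    (h2 : 2 ≤ δ * (ρ * κ) ^ k) (a : ℂ⟦X⟧) (ha : nn (Wt σ ρ κ r) n a ≠ ∞) :
    ∃ N Q : ℂ⟦X⟧, (∀ j, (j ≤ σ * n ∨ σ * n + k < j) → PowerSeries.coeff j Q = 0) ∧
      (∀ i, n * PowerSeries.coeff i N + (if k ≤ i then (((i - k : ℕ) : ℂ) + n * μ) * PowerSeries.coeff (i - k) N else 0)
        + PowerSeries.coeff i Q = PowerSeries.coeff i a) ∧
      n * nn (Wt σ ρ κ r) n N ≤ 3 * nn (Wt σ ρ κ r) n a ∧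
      nn (Wt σ ρ κ r) n Q ≤ (4 + 3 * ((σ + ‖μ‖₊) * (ρ * κ) ^ k) : ℝ≥0) * nn (Wt σ ρ κ r) n a := by
  have hn' : (n : ℂ) ≠ 0 := by exact_mod_cast (by omega : n ≠ 0)
  set b : ℕ → ℂ := fun i => PowerSeries.coeff i a with hb
  let Nf : ℕ → ℂ := fun i => if i ≤ σ * n then lowN n k μ b i else hiN n k μ b i
  let Qf : ℕ → ℂ := fun i => if σ * n < i ∧ i ≤ σ * n + k then
    b i - n * Nf i - (if k ≤ i then (((i - k : ℕ) : ℂ) + n * μ) * Nf (i - k) else 0) else 0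
  have hNb : n * nn (Wt σ ρ κ r) n (PowerSeries.mk Nf) ≤ 3 * nn (Wt σ ρ κ r) n a := by
    have e1 : ∀ i, (n : ℝ≥0∞) * (‖Nf i‖ₑ * (Wt σ ρ κ r n i : ℝ≥0∞)) ≤
        (if i ∈ Finset.range (σ * n + 1) then (n : ℝ≥0∞) * (‖lowN n k μ b i‖ₑ * Wt σ ρ κ r n i) else 0) +
        ∑' l, 2⁻¹ ^ (l + 1) * (‖b (i + (l + 1) * k)‖ₑ * Wt σ ρ κ r n (i + (l + 1) * k)) := by
      intro i
      by_cases hi : i ≤ σ * n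
      · rw [if_pos (Finset.mem_range.2 (by omega))]
        simp only [Nf, if_pos hi]
        exact le_self_add
      · rw [if_neg (fun h => hi (by rw [Finset.mem_range] at h; omega))]
        simp only [Nf, if_neg hi]
        rw [zero_add]
        exact hiN_ebound hn σ μ ρ κ r hδ hδμ h2 b i (by omega)
    have e2 : ∑' i, (if i ∈ Finset.range (σ * n + 1) then (n : ℝ≥0∞) * (‖lowN n k μ b i‖ₑ * Wt σ ρ κ r n i) else 0)
        ≤ 2 * nn (Wt σ ρ κ r) n a := by
      have e3 := lowN_bound hn hk σ μ ρ ρ.2 h1 b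
      have hw : ∀ i ∈ Finset.range (σ * n + 1), Wt σ ρ κ r n i = ρ ^ i * r ^ n := by
        intro i hi
        rw [Finset.mem_range] at hi
        simp [Wt, show i - σ * n = 0 by omega]
      rw [tsum_eq_sum (s := Finset.range (σ * n + 1)) (fun i hi => by simp only [if_neg hi])]
      calc _ = ((n * (∑ i ∈ Finset.range (σ * n + 1), ‖lowN n k μ b i‖₊ * ρ ^ i) * r ^ n : ℝ≥0) : ℝ≥0∞) := by
            push_cast
            rw [Finset.mul_sum, Finset.sum_mul]
            refine Finset.sum_congr rfl fun i hi => ?_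
            rw [if_pos hi, hw i hi]; push_cast; rw [enorm_eq_nnnorm]; ring
        _ ≤ ((2 * (∑ i ∈ Finset.range (σ * n + 1), ‖b i‖₊ * ρ ^ i) * r ^ n : ℝ≥0) : ℝ≥0∞) := by
            rw [ENNReal.coe_le_coe]
            gcongr ?_ * _
            rw [← NNReal.coe_le_coe]; push_cast; exact e3
        _ = 2 * ∑ i ∈ Finset.range (σ * n + 1), ‖b i‖ₑ * Wt σ ρ κ r n i := by
            push_cast
            rw [mul_assoc, Finset.sum_mul]
            congr 1
            refine Finset.sum_congr rfl fun i hi => ?_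
            rw [hw i hi]; push_cast; rw [enorm_eq_nnnorm]; ring
        _ ≤ _ := by gcongr; exact ENNReal.sum_le_tsum _
    have e4 := hi_sum_le (α := fun j => ‖b j‖ₑ * (Wt σ ρ κ r n j : ℝ≥0∞)) k
    calc _ = ∑' i, (n : ℝ≥0∞) * (‖Nf i‖ₑ * (Wt σ ρ κ r n i : ℝ≥0∞)) := by
          unfold nn; rw [← ENNReal.tsum_mul_left]; simp only [PowerSeries.coeff_mk]
      _ ≤ _ := ENNReal.tsum_le_tsum e1
      _ ≤ 2 * nn (Wt σ ρ κ r) n a + 1 * nn (Wt σ ρ κ r) n a := by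
          rw [ENNReal.tsum_add, one_mul]
          exact add_le_add e2 e4
      _ = _ := by rw [← add_mul]; norm_num
  refine ⟨PowerSeries.mk Nf, PowerSeries.mk Qf, ?_, ?_, hNb, ?_⟩
  · intro j hj
    rw [PowerSeries.coeff_mk]
    simp only [Qf]
    rw [if_neg (by omega)]
  · intro i
    simp only [PowerSeries.coeff_mk]
    by_cases hi : σ * n < i ∧ i ≤ σ * n + k
    · simp only [Qf, if_pos hi]; ring
    · simp only [Qf, if_neg hi, add_zero]
      rcases le_or_gt i (σ * n) with h | h
      · have e0 : Nf i = lowN n k μ b i := by simp only [Nf, if_pos h]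
        rw [e0, lowN]
        by_cases hki : k ≤ i
        · rw [if_pos hki, dif_pos ⟨hki, by omega⟩]
          have e5 : Nf (i - k) = lowN n k μ b (i - k) := by simp only [Nf]; rw [if_pos (by omega)]
          rw [e5]; field_simp; ring
        · rw [if_neg hki, dif_neg (by omega)]
          field_simp; ring
      · obtain ⟨j, rfl⟩ : ∃ j, i = j + k := ⟨i - k, by omega⟩
        have e0 : Nf (j + k) = hiN n k μ b (j + k) := by simp only [Nf]; rw [if_neg (by omega)]
        have e1 : Nf j = hiN n k μ b j := by simp only [Nf]; rw [if_neg (by omega)]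
        rw [if_pos (by omega), Nat.add_sub_cancel, e0, e1]
        exact hiN_rec hn σ μ hρ hκ hr hδ hδμ h2 b ha j (by omega)
  · set K : ℝ≥0 := (σ + ‖μ‖₊) * (ρ * κ) ^ k with hK
    have e1 : ∀ i, ‖Qf i‖ₑ * (Wt σ ρ κ r n i : ℝ≥0∞) ≤ ‖b i‖ₑ * Wt σ ρ κ r n i + n * (‖Nf i‖ₑ * Wt σ ρ κ r n i)
        + K * (if k ≤ i then n * (‖Nf (i - k)‖ₑ * Wt σ ρ κ r n (i - k)) else 0) := by
      intro i
      by_cases hi : σ * n < i ∧ i ≤ σ * n + k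
      · simp only [Qf, if_pos hi]
        by_cases hki : k ≤ i
        · rw [if_pos hki, if_pos hki]
          have f1 : ‖((i - k : ℕ) : ℂ) + n * μ‖₊ ≤ n * (σ + ‖μ‖₊) := by
            refine (nnnorm_add_le _ _).trans ?_
            rw [nnnorm_mul, cnn_nat, cnn_nat]
            have : ((i - k : ℕ) : ℝ≥0) ≤ σ * n := by exact_mod_cast (by omega : i - k ≤ σ * n)
            calc _ ≤ σ * n + n * ‖μ‖₊ := by gcongr
              _ = _ := by ring
          have f2 : Wt σ ρ κ r n i ≤ (ρ * κ) ^ k * Wt σ ρ κ r n (i - k) := by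
            unfold Wt
            have g1 : ρ ^ i = ρ ^ k * ρ ^ (i - k) := by rw [← pow_add]; congr 1; omega
            have g2 : κ ^ (i - σ * n) ≤ κ ^ k * κ ^ (i - k - σ * n) := by
              rw [← pow_add]; exact pow_le_pow_right₀ hκ (by omega)
            calc _ ≤ (ρ ^ k * ρ ^ (i - k)) * (κ ^ k * κ ^ (i - k - σ * n)) * r ^ n := by rw [g1]; gcongr
              _ = _ := by ring
          have f3 : ‖b i - n * Nf i - (((i - k : ℕ) : ℂ) + n * μ) * Nf (i - k)‖₊ * Wt σ ρ κ r n i ≤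
            ‖b i‖₊ * Wt σ ρ κ r n i + n * (‖Nf i‖₊ * Wt σ ρ κ r n i) + K * (n * (‖Nf (i - k)‖₊ * Wt σ ρ κ r n (i - k))) := by
            calc _ ≤ (‖b i‖₊ + n * ‖Nf i‖₊ + n * (σ + ‖μ‖₊) * ‖Nf (i - k)‖₊) * Wt σ ρ κ r n i := by
                  gcongr
                  refine (nnnorm_sub_le _ _).trans ?_
                  refine (add_le_add_left (nnnorm_sub_le _ _) _).trans ?_
                  rw [nnnorm_mul, nnnorm_mul, cnn_nat]
                  gcongr
              _ = ‖b i‖₊ * Wt σ ρ κ r n i + n * (‖Nf i‖₊ * Wt σ ρ κ r n i) + n * (σ + ‖μ‖₊) * ‖Nf (i - k)‖₊ * Wt σ ρ κ r n i := by ring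
              _ ≤ ‖b i‖₊ * Wt σ ρ κ r n i + n * (‖Nf i‖₊ * Wt σ ρ κ r n i) + n * (σ + ‖μ‖₊) * ‖Nf (i - k)‖₊ * ((ρ * κ) ^ k * Wt σ ρ κ r n (i - k)) := by gcongr
              _ = _ := by rw [hK]; ring
          have f4 := ENNReal.coe_le_coe.2 f3
          push_cast at f4
          exact f4
        · rw [if_neg hki, if_neg hki]
          have f3 : ‖b i - n * Nf i - 0‖₊ * Wt σ ρ κ r n i ≤
            ‖b i‖₊ * Wt σ ρ κ r n i + n * (‖Nf i‖₊ * Wt σ ρ κ r n i) + K * 0 := by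
            rw [sub_zero, mul_zero, add_zero, ← mul_assoc, ← add_mul]
            gcongr
            refine (nnnorm_sub_le _ _).trans ?_
            rw [nnnorm_mul, cnn_nat]
          have f4 := ENNReal.coe_le_coe.2 f3
          push_cast at f4
          exact f4
      · simp only [Qf, if_neg hi]; simp
    have e2 : ∑' i, (if k ≤ i then (n : ℝ≥0∞) * (‖Nf (i - k)‖ₑ * (Wt σ ρ κ r n (i - k) : ℝ≥0∞)) else 0) ≤
        n * nn (Wt σ ρ κ r) n (PowerSeries.mk Nf) := by
      rw [enn_shift k (fun i => (n : ℝ≥0∞) * (‖Nf i‖ₑ * (Wt σ ρ κ r n i : ℝ≥0∞))), ENNReal.tsum_mul_left]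
      unfold nn
      simp only [PowerSeries.coeff_mk]
      exact le_rfl
    calc nn (Wt σ ρ κ r) n (PowerSeries.mk Qf) = ∑' i, ‖Qf i‖ₑ * (Wt σ ρ κ r n i : ℝ≥0∞) := by
          unfold nn; simp only [PowerSeries.coeff_mk]
      _ ≤ _ := ENNReal.tsum_le_tsum e1
      _ ≤ nn (Wt σ ρ κ r) n a + 3 * nn (Wt σ ρ κ r) n a + K * (3 * nn (Wt σ ρ κ r) n a) := by
          rw [ENNReal.tsum_add, ENNReal.tsum_add]
          refine add_le_add (add_le_add le_rfl ?_) ?_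
          · rw [ENNReal.tsum_mul_left]
            unfold nn at hNb ⊢
            simpa only [PowerSeries.coeff_mk] using hNb
          · rw [ENNReal.tsum_mul_left]
            exact mul_le_mul_right (e2.trans hNb) _
      _ = _ := by push_cast; ring


/-- y ∂/∂y -/
def Dy (c : ℂ⟦X⟧⟦X⟧) : ℂ⟦X⟧⟦X⟧ := PowerSeries.mk fun n => (n : ℂ) • PowerSeries.coeff n c

/-- x ∂/∂x -/
def Dx (c : ℂ⟦X⟧⟦X⟧) : ℂ⟦X⟧⟦X⟧ := PowerSeries.mk fun n => PowerSeries.mk fun j =>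
  (j : ℂ) * PowerSeries.coeff j (PowerSeries.coeff n c)

lemma nn_smul (W : ℕ → ℕ → ℝ≥0) (n : ℕ) (z : ℂ) (a : ℂ⟦X⟧) : nn W n (z • a) = ‖z‖ₑ * nn W n a := by
  unfold nn
  rw [← ENNReal.tsum_mul_left]
  congr 1; funext j
  rw [PowerSeries.coeff_smul, smul_eq_mul, enorm_mul, mul_assoc]

lemma cen_nat (n : ℕ) : ‖(n : ℂ)‖ₑ = n := by
  rw [enorm_eq_nnnorm, cnn_nat]; simp

lemma NN_Dy (W : ℕ → ℕ → ℝ≥0) (c : ℂ⟦X⟧⟦X⟧) :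
    NN W (Dy c) = ∑' n : ℕ, (n : ℝ≥0∞) * nn W n (PowerSeries.coeff n c) := by
  unfold NN Dy
  congr 1; funext n
  rw [PowerSeries.coeff_mk, nn_smul, cen_nat]

lemma NN_le_Dy (W : ℕ → ℕ → ℝ≥0) {c : ℂ⟦X⟧⟦X⟧} (hc : PowerSeries.coeff 0 c = 0) : NN W c ≤ NN W (Dy c) := by
  rw [NN_Dy]
  unfold NN
  refine ENNReal.tsum_le_tsum fun n => ?_
  rcases Nat.eq_zero_or_pos n with rfl | h
  · rw [hc, nn_zero]; simp
  · exact le_mul_of_one_le_left (zero_le) (by exact_mod_cast h)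

lemma rec_lemma (W : ℕ → ℕ → ℝ≥0) (C B : ℝ≥0∞) (Rel : ℕ → ℂ⟦X⟧ → ℂ⟦X⟧ → ℂ⟦X⟧ → Prop)
    (hlin : ∀ n, 1 ≤ n → ∀ a, nn W n a ≠ ∞ → ∃ N Q, Rel n a N Q ∧ n * nn W n N ≤ C * nn W n a ∧
      nn W n Q ≤ C * nn W n a) (hB : B ≠ ∞)
    (F : ℂ⟦X⟧⟦X⟧ → ℂ⟦X⟧⟦X⟧ → ℂ⟦X⟧⟦X⟧)
    (hdep : ∀ n M M' Q Q', PowerSeries.coeff 0 M = 0 → PowerSeries.coeff 0 M' = 0 →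
      PowerSeries.coeff 0 Q = 0 → PowerSeries.coeff 0 Q' = 0 → 
      (∀ i < n, PowerSeries.coeff i M = PowerSeries.coeff i M' ∧ PowerSeries.coeff i Q = PowerSeries.coeff i Q') →
      PowerSeries.coeff n (F M Q) = PowerSeries.coeff n (F M' Q'))
    (hbd : ∀ M Q, PowerSeries.coeff 0 M = 0 → PowerSeries.coeff 0 Q = 0 → NN W (Dy M) ≤ C * B →
      NN W Q ≤ C * B → NN W (F M Q) ≤ B) :
    ∃ M Q, PowerSeries.coeff 0 M = 0 ∧ PowerSeries.coeff 0 Q = 0 ∧ NN W (Dy M) ≤ C * B ∧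
      NN W Q ≤ C * B ∧ ∀ n, 1 ≤ n → Rel n (PowerSeries.coeff n (F M Q)) (PowerSeries.coeff n M) (PowerSeries.coeff n Q) := by
  have hST : ∀ n a, ∃ p : ℂ⟦X⟧ × ℂ⟦X⟧, (n = 0 → p = 0) ∧ (1 ≤ n → nn W n a ≠ ∞ → 
      Rel n a p.1 p.2 ∧ n * nn W n p.1 ≤ C * nn W n a ∧ nn W n p.2 ≤ C * nn W n a) := by
    intro n a
    by_cases h : 1 ≤ n ∧ nn W n a ≠ ∞
    · obtain ⟨N, Q, h1⟩ := hlin n h.1 a h.2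
      exact ⟨(N, Q), fun h0 => by omega, fun _ _ => h1⟩
    · exact ⟨0, fun _ => rfl, fun h1 h2 => absurd ⟨h1, h2⟩ h⟩
  choose S hS0 hS using hST
  let st : ℕ → ℂ⟦X⟧⟦X⟧ × ℂ⟦X⟧⟦X⟧ := fun t => Nat.rec (0, 0) (fun _ p =>
    (PowerSeries.mk fun n => (S n (PowerSeries.coeff n (F p.1 p.2))).1,
      PowerSeries.mk fun n => (S n (PowerSeries.coeff n (F p.1 p.2))).2)) t
  have st1 : ∀ t n, PowerSeries.coeff n (st (t + 1)).1 = (S n (PowerSeries.coeff n (F (st t).1 (st t).2))).1 := by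
    intro t n; simp only [st, PowerSeries.coeff_mk]
  have st2 : ∀ t n, PowerSeries.coeff n (st (t + 1)).2 = (S n (PowerSeries.coeff n (F (st t).1 (st t).2))).2 := by
    intro t n; simp only [st, PowerSeries.coeff_mk]
  have st00 : ∀ t, PowerSeries.coeff 0 (st t).1 = 0 ∧ PowerSeries.coeff 0 (st t).2 = 0 := by
    intro t
    cases t with
    | zero => exact ⟨map_zero _, map_zero _⟩
    | succ t => rw [st1, st2, hS0 0 _ rfl]; exact ⟨rfl, rfl⟩
  have hle : ∀ {c : ℂ⟦X⟧⟦X⟧}, NN W c ≤ B → ∀ n, nn W n (PowerSeries.coeff n c) ≠ ∞ := by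
    intro c hc n
    exact ne_top_of_le_ne_top hB ((ENNReal.le_tsum (f := fun n => nn W n (PowerSeries.coeff n c)) n).trans hc)
  have bd : ∀ t, NN W (Dy (st t).1) ≤ C * B ∧ NN W (st t).2 ≤ C * B := by
    intro t
    induction t with
    | zero =>
      have h1 : NN W (Dy (st 0).1) = 0 := by
        rw [NN_Dy]; simp [st, nn_zero]
      have h2 : NN W (st 0).2 = 0 := NN_zero W
      rw [h1, h2]; exact ⟨zero_le, zero_le⟩
    | succ t ih =>
      have hF := hbd _ _ (st00 t).1 (st00 t).2 ih.1 ih.2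
      constructor
      · rw [NN_Dy]
        calc _ ≤ ∑' n, C * nn W n (PowerSeries.coeff n (F (st t).1 (st t).2)) := by
              refine ENNReal.tsum_le_tsum fun n => ?_
              rcases Nat.eq_zero_or_pos n with rfl | h
              · simp
              · rw [st1]; exact (hS n _ h (hle hF n)).2.1
          _ = C * NN W (F (st t).1 (st t).2) := by rw [ENNReal.tsum_mul_left]; rfl
          _ ≤ _ := by gcongr
      · calc _ ≤ ∑' n, C * nn W n (PowerSeries.coeff n (F (st t).1 (st t).2)) := by
              refine ENNReal.tsum_le_tsum fun n => ?_
              rcases Nat.eq_zero_or_pos n with rfl | h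
              · rw [(st00 (t + 1)).2, nn_zero]; exact zero_le
              · rw [st2]; exact (hS n _ h (hle hF n)).2.2
          _ = C * NN W (F (st t).1 (st t).2) := by rw [ENNReal.tsum_mul_left]; rfl
          _ ≤ _ := by gcongr
  have stab : ∀ t n, n < t → PowerSeries.coeff n (st (t + 1)).1 = PowerSeries.coeff n (st t).1 ∧
      PowerSeries.coeff n (st (t + 1)).2 = PowerSeries.coeff n (st t).2 := by
    intro t
    induction t with
    | zero => intro n h; omega
    | succ t ih =>
      intro n h
      have : PowerSeries.coeff n (F (st (t + 1)).1 (st (t + 1)).2) = PowerSeries.coeff n (F (st t).1 (st t).2) :=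
        hdep n _ _ _ _ (st00 (t + 1)).1 (st00 t).1 (st00 (t + 1)).2 (st00 t).2 fun i hi => ih i (by omega)
      exact ⟨by rw [st1 (t + 1) n, st1 t n, this], by rw [st2 (t + 1) n, st2 t n, this]⟩
  have stab' : ∀ n d, PowerSeries.coeff n (st (n + 1 + d)).1 = PowerSeries.coeff n (st (n + 1)).1 ∧
      PowerSeries.coeff n (st (n + 1 + d)).2 = PowerSeries.coeff n (st (n + 1)).2 := by
    intro n d
    induction d with
    | zero => exact ⟨rfl, rfl⟩
    | succ d ih =>
      have := stab (n + 1 + d) n (by omega)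
      exact ⟨this.1.trans ih.1, this.2.trans ih.2⟩
  let M : ℂ⟦X⟧⟦X⟧ := PowerSeries.mk fun n => PowerSeries.coeff n (st (n + 1)).1
  let Q : ℂ⟦X⟧⟦X⟧ := PowerSeries.mk fun n => PowerSeries.coeff n (st (n + 1)).2
  have hM : ∀ n t, n < t → PowerSeries.coeff n M = PowerSeries.coeff n (st t).1 := by
    intro n t h
    obtain ⟨d, rfl⟩ := Nat.exists_eq_add_of_le (show n + 1 ≤ t from h)
    simp only [M, PowerSeries.coeff_mk]; exact (stab' n d).1.symm
  have hQ : ∀ n t, n < t → PowerSeries.coeff n Q = PowerSeries.coeff n (st t).2 := by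
    intro n t h
    obtain ⟨d, rfl⟩ := Nat.exists_eq_add_of_le (show n + 1 ≤ t from h)
    simp only [Q, PowerSeries.coeff_mk]; exact (stab' n d).2.symm
  have hM0 : PowerSeries.coeff 0 M = 0 := by rw [hM 0 1 one_pos]; exact (st00 1).1
  have hQ0 : PowerSeries.coeff 0 Q = 0 := by rw [hQ 0 1 one_pos]; exact (st00 1).2
  have hMb : NN W (Dy M) ≤ C * B := by
    rw [NN_Dy]
    refine ENNReal.tsum_le_of_sum_range_le fun m => ?_
    refine le_trans ?_ (bd m).1
    rw [NN_Dy]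
    refine le_trans (le_of_eq ?_) (ENNReal.sum_le_tsum (Finset.range m))
    refine Finset.sum_congr rfl fun n hn => ?_
    rw [hM n m (Finset.mem_range.1 hn)]
  have hQb : NN W Q ≤ C * B := by
    unfold NN
    refine ENNReal.tsum_le_of_sum_range_le fun m => ?_
    refine le_trans ?_ (bd m).2
    unfold NN
    refine le_trans (le_of_eq ?_) (ENNReal.sum_le_tsum (Finset.range m))
    refine Finset.sum_congr rfl fun n hn => ?_
    rw [hQ n m (Finset.mem_range.1 hn)]
  refine ⟨M, Q, hM0, hQ0, hMb, hQb, ?_⟩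
  intro n hn
  have h1 : PowerSeries.coeff n (F M Q) = PowerSeries.coeff n (F (st n).1 (st n).2) :=
    hdep n _ _ _ _ hM0 (st00 n).1 hQ0 (st00 n).2 fun i hi => ⟨hM i n hi, hQ i n hi⟩
  have h2 := (hS n (PowerSeries.coeff n (F M Q)) hn (hle (hbd M Q hM0 hQ0 hMb hQb) n)).1
  rw [hM n (n + 1) (by omega), hQ n (n + 1) (by omega), st1, st2, ← h1]
  exact h2


local notation "cf" => PowerSeries.coeff

def LL (k : ℕ) (μ : ℂ) (M : ℂ⟦X⟧⟦X⟧) : ℂ⟦X⟧⟦X⟧ :=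
  Dy M + PowerSeries.C (PowerSeries.X ^ k : ℂ⟦X⟧) * (Dx M + μ • Dy M)

lemma coeff_LL (k : ℕ) (μ : ℂ) (M : ℂ⟦X⟧⟦X⟧) (n i : ℕ) :
    cf i (cf n (LL k μ M)) = n * cf i (cf n M) +
      (if k ≤ i then (((i - k : ℕ) : ℂ) + n * μ) * cf (i - k) (cf n M) else 0) := by
  unfold LL
  rw [map_add, map_add, PowerSeries.coeff_C_mul, PowerSeries.coeff_X_pow_mul', map_add, map_add]
  congr 1
  · simp [Dy]
  · split_ifs with h
    · rw [PowerSeries.coeff_smul, PowerSeries.coeff_smul]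
      simp [Dy, Dx]
      ring
    · rfl

/-- Support condition for the normal form. -/
def SuppC (k σ : ℕ) (Q : ℂ⟦X⟧⟦X⟧) : Prop :=
  ∀ n j, (n = 0 ∨ j ≤ σ * n ∨ σ * n + k < j) → cf j (cf n Q) = 0

/-- The data needed to solve the cohomological equations. -/
structure LinData (k σ : ℕ) (μ : ℂ) (ρ κ : ℝ≥0) (δ : ℝ) : Prop where
  hk : 1 ≤ k
  hρ : 0 < ρ
  hκ : 1 ≤ κ
  h1 : (σ + ‖μ‖) * ρ ^ k ≤ 1 / 2
  hδ : 0 < δ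
  hδμ : ∀ n : ℕ, 1 ≤ n → ∀ i : ℕ, σ * n < i → δ * n ≤ ‖(i : ℂ) + n * μ‖
  h2 : 2 ≤ δ * (ρ * κ) ^ k

def CC (k σ : ℕ) (μ : ℂ) (ρ κ : ℝ≥0) : ℝ≥0 := 4 + 3 * ((σ + ‖μ‖₊) * (ρ * κ) ^ k)

lemma formal_solve {k σ : ℕ} {μ : ℂ} {ρ κ : ℝ≥0} {δ : ℝ} (D : LinData k σ μ ρ κ δ) {r : ℝ≥0} (hr : 0 < r)
    (B : ℝ≥0) (F : ℂ⟦X⟧⟦X⟧ → ℂ⟦X⟧⟦X⟧ → ℂ⟦X⟧⟦X⟧)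
    (hdep : ∀ n M M' Q Q', cf 0 M = 0 → cf 0 M' = 0 → cf 0 Q = 0 → cf 0 Q' = 0 → 
      (∀ i < n, cf i M = cf i M' ∧ cf i Q = cf i Q') → cf n (F M Q) = cf n (F M' Q'))
    (hbd : ∀ M Q, cf 0 M = 0 → cf 0 Q = 0 → NN (Wt σ ρ κ r) (Dy M) ≤ CC k σ μ ρ κ * B →
      NN (Wt σ ρ κ r) Q ≤ CC k σ μ ρ κ * B → NN (Wt σ ρ κ r) (F M Q) ≤ B)
    (hF0 : ∀ M Q, cf 0 M = 0 → cf 0 Q = 0 → cf 0 (F M Q) = 0) :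
    ∃ M Q, cf 0 M = 0 ∧ SuppC k σ Q ∧ NN (Wt σ ρ κ r) (Dy M) ≤ CC k σ μ ρ κ * B ∧
      NN (Wt σ ρ κ r) Q ≤ CC k σ μ ρ κ * B ∧ LL k μ M + Q = F M Q := by
  obtain ⟨M, Q, h1, h2, h3, h4, h5⟩ := rec_lemma (Wt σ ρ κ r) (CC k σ μ ρ κ) B
    (fun n a N Q => (∀ j, (j ≤ σ * n ∨ σ * n + k < j) → cf j Q = 0) ∧
      (∀ i, n * cf i N + (if k ≤ i then (((i - k : ℕ) : ℂ) + n * μ) * cf (i - k) N else 0)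
        + cf i Q = cf i a)) (by
      intro n hn a ha
      obtain ⟨N, Q, g1, g2, g3, g4⟩ := lin_exists hn D.hk σ μ D.hρ D.hκ hr D.h1 D.hδ (D.hδμ n hn) D.h2 a ha
      refine ⟨N, Q, ⟨g1, g2⟩, g3.trans ?_, g4⟩
      gcongr
      unfold CC
      have : (3 : ℝ≥0) ≤ 4 + 3 * ((σ + ‖μ‖₊) * (ρ * κ) ^ k) := by
        refine le_add_right ?_; norm_num
      exact_mod_cast this) ENNReal.coe_ne_top F hdep hbd
  refine ⟨M, Q, h1, ?_, h3, h4, ?_⟩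
  · intro n j hnj
    rcases Nat.eq_zero_or_pos n with rfl | hn
    · rw [h2]; simp
    · exact (h5 n hn).1 j (hnj.resolve_left (by omega))
  · ext n i
    rcases Nat.eq_zero_or_pos n with rfl | hn
    · rw [hF0 M Q h1 h2, map_add, map_add, coeff_LL, h1, h2]; simp
    · rw [map_add, map_add, coeff_LL]; exact (h5 n hn).2 i

lemma dvd_of_agree {n : ℕ} {M M' : ℂ⟦X⟧⟦X⟧} (h : ∀ i < n, cf i M = cf i M') : PowerSeries.X ^ n ∣ M - M' := by
  rw [PowerSeries.X_pow_dvd_iff]; intro m hm; rw [map_sub, h m hm, sub_self]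

lemma agree_of_dvd {n : ℕ} {M M' : ℂ⟦X⟧⟦X⟧} (h : PowerSeries.X ^ (n + 1) ∣ M - M') : cf n M = cf n M' := by
  rw [PowerSeries.X_pow_dvd_iff] at h
  have := h n (by omega)
  rwa [map_sub, sub_eq_zero] at this

lemma X_dvd_of {M : ℂ⟦X⟧⟦X⟧} (h : cf 0 M = 0) : PowerSeries.X ∣ M := by
  rw [PowerSeries.X_dvd_iff]; simpa using h

lemma ccmp_zero {f g : ℂ⟦X⟧⟦X⟧} (hf : cf 0 f = 0) : cf 0 (ccmp f g) = 0 := by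
  unfold ccmp
  rw [PowerSeries.coeff_mk]
  apply Finset.sum_eq_zero
  intro p hp
  rw [Finset.HasAntidiagonal.mem_antidiagonal] at hp
  rw [show p.1 = 0 by omega, hf, zero_mul]

lemma ccmp_dvd {f g g' : ℂ⟦X⟧⟦X⟧} (hf : cf 0 f = 0) {n : ℕ} (h : PowerSeries.X ^ n ∣ g - g') :
    PowerSeries.X ^ (n + 1) ∣ ccmp f g - ccmp f g' := by
  apply dvd_of_agree
  intro m hm
  unfold ccmp
  rw [PowerSeries.coeff_mk, PowerSeries.coeff_mk]
  refine Finset.sum_congr rfl fun p hp => ?_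
  rw [Finset.HasAntidiagonal.mem_antidiagonal] at hp
  rcases Nat.eq_zero_or_pos p.1 with h0 | h0
  · rw [h0, hf, zero_mul, zero_mul]
  · congr 1
    have h2 : PowerSeries.X ^ n ∣ g ^ p.1 - g' ^ p.1 := h.trans (sub_dvd_pow_sub_pow _ _ _)
    exact agree_of_dvd ((pow_dvd_pow _ (by omega)).trans h2)

lemma Dy_dvd {M M' : ℂ⟦X⟧⟦X⟧} {n : ℕ} (h : PowerSeries.X ^ n ∣ M - M') : PowerSeries.X ^ n ∣ Dy M - Dy M' := by
  rw [PowerSeries.X_pow_dvd_iff] at h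
  apply dvd_of_agree
  intro i hi
  have := h i hi
  rw [map_sub, sub_eq_zero] at this
  simp [Dy, this]

lemma Dy_zero (M : ℂ⟦X⟧⟦X⟧) : cf 0 (Dy M) = 0 := by simp [Dy]

lemma prod_dvd {n : ℕ} {a a' b b' : ℂ⟦X⟧⟦X⟧} (h1 : PowerSeries.X ^ n ∣ a - a') (h2 : PowerSeries.X ^ n ∣ b - b')
    (ha : PowerSeries.X ∣ a) (hb : PowerSeries.X ∣ b') : PowerSeries.X ^ (n + 1) ∣ a * b - a' * b' := by
  have : a * b - a' * b' = (b - b') * a + (a - a') * b' := by ring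
  rw [this, pow_succ]
  exact dvd_add (mul_dvd_mul h2 ha) (mul_dvd_mul h1 hb)

lemma mul_zero_coeff {a b : ℂ⟦X⟧⟦X⟧} (ha : cf 0 a = 0) : cf 0 (a * b) = 0 := by
  rw [PowerSeries.coeff_zero_eq_constantCoeff_apply, map_mul, ← PowerSeries.coeff_zero_eq_constantCoeff_apply, ha, zero_mul]

/-- the size of `f` after substitution -/
def eps (W : ℕ → ℕ → ℝ≥0) (f : ℂ⟦X⟧⟦X⟧) : ℝ≥0∞ := ∑' l, nn W l (cf l f) * 2 ^ l

lemma NN_ccmp2 {W : ℕ → ℕ → ℝ≥0} (hW : SubM W) (hW0 : W 0 0 = 1) (f M : ℂ⟦X⟧⟦X⟧) (hM : NN W M ≤ 1) :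
    NN W (ccmp f (1 + M)) ≤ eps W f := by
  refine (NN_ccmp hW hW0 f _).trans ?_
  refine ENNReal.tsum_le_tsum fun l => ?_
  gcongr
  refine (NN_add _ _ _).trans ?_
  rw [NN_one hW0, ← one_add_one_eq_two]
  gcongr

lemma orb_formal {k σ : ℕ} {μ : ℂ} {ρ κ : ℝ≥0} {δ : ℝ} (D : LinData k σ μ ρ κ δ) {r : ℝ≥0} (hr : 0 < r)
    (f : ℂ⟦X⟧⟦X⟧) (hf0 : cf 0 f = 0) (B : ℝ≥0) (hB : 4 * CC k σ μ ρ κ ^ 2 * B ≤ 1)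
    (hf : eps (Wt σ ρ κ r) f ≤ (B / 4 : ℝ≥0)) :
    ∃ M Q, cf 0 M = 0 ∧ SuppC k σ Q ∧ NN (Wt σ ρ κ r) (Dy M) ≤ CC k σ μ ρ κ * B ∧
      NN (Wt σ ρ κ r) Q ≤ CC k σ μ ρ κ * B ∧ CC k σ μ ρ κ * B ≤ 1 ∧
      LL k μ M + Q = (1 + M) * ccmp f (1 + M) - Q * (M + Dy M) := by
  set W := Wt σ ρ κ r with hWdef
  have hW : SubM W := Wt_sub σ ρ κ r D.hκ
  have hW0 : W 0 0 = 1 := Wt_zero σ ρ κ r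
  set c := CC k σ μ ρ κ with hc
  have hc1 : 1 ≤ c := by
    rw [hc]; unfold CC; refine le_add_right ?_; norm_num
  have hcB : c * B ≤ 1 := by
    refine le_trans ?_ hB
    calc c * B = 1 * c ^ 1 * B := by ring
      _ ≤ 4 * c ^ 2 * B := by gcongr; norm_num; norm_num
  have hcB' : (c : ℝ≥0∞) * B ≤ 1 := by exact_mod_cast hcB
  obtain ⟨M, Q, h1, h2, h3, h4, h5⟩ := formal_solve D hr B
    (fun M Q => (1 + M) * ccmp f (1 + M) - Q * (M + Dy M)) (by
      intro n M M' Q Q' hM hM' hQ hQ' hag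
      have e1 : PowerSeries.X ^ n ∣ M - M' := dvd_of_agree fun i hi => (hag i hi).1
      have e2 : PowerSeries.X ^ n ∣ Q - Q' := dvd_of_agree fun i hi => (hag i hi).2
      apply agree_of_dvd
      have e3 : PowerSeries.X ^ (n + 1) ∣ Q * (M + Dy M) - Q' * (M' + Dy M') := by
        apply prod_dvd e2 _ (X_dvd_of hQ) (X_dvd_of (by rw [map_add, hM', Dy_zero, add_zero]))
        rw [add_sub_add_comm]; exact dvd_add e1 (Dy_dvd e1)
      have e4 : PowerSeries.X ^ n ∣ (1 + M) - (1 + M') := by rwa [add_sub_add_left_eq_sub]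
      have e5 : PowerSeries.X ^ (n + 1) ∣ (1 + M) * ccmp f (1 + M) - (1 + M') * ccmp f (1 + M') := by
        have : (1 + M) * ccmp f (1 + M) - (1 + M') * ccmp f (1 + M') =
          (1 + M) * (ccmp f (1 + M) - ccmp f (1 + M')) + ((1 + M) - (1 + M')) * ccmp f (1 + M') := by ring
        rw [this]
        refine dvd_add ((ccmp_dvd hf0 e4).mul_left _) ?_
        rw [pow_succ]
        exact mul_dvd_mul e4 (X_dvd_of (ccmp_zero hf0))
      rw [sub_sub_sub_comm]
      exact dvd_sub e5 e3) (by
      intro M Q hM hQ hMb hQb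
      have e1 : NN W M ≤ c * B := (NN_le_Dy W hM).trans hMb
      have e2 : NN W (1 + M) ≤ 2 := by
        refine (NN_add _ _ _).trans ?_
        rw [NN_one hW0, ← one_add_one_eq_two]; gcongr; exact e1.trans hcB'
      calc _ ≤ NN W (1 + M) * NN W (ccmp f (1 + M)) + NN W Q * (NN W M + NN W (Dy M)) := by
            refine (NN_sub _ _ _).trans (add_le_add (NN_mul hW _ _) ((NN_mul hW _ _).trans ?_))
            gcongr; exact NN_add _ _ _
        _ ≤ 2 * (B / 4 : ℝ≥0) + (c * B) * (c * B + c * B) := by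
            gcongr
            exact (NN_ccmp2 hW hW0 f M (e1.trans hcB')).trans hf
        _ ≤ B := by
            have : 2 * (B / 4 : ℝ≥0) + (c * B) * (c * B + c * B) ≤ B := by
              have h : 4 * (c : ℝ) ^ 2 * B ≤ 1 := by exact_mod_cast hB
              rw [← NNReal.coe_le_coe]; push_cast
              nlinarith [B.2, mul_le_mul_of_nonneg_right h B.2]
            exact_mod_cast this) (by
      intro M Q hM hQ
      rw [map_sub, mul_zero_coeff hQ, mul_comm, mul_zero_coeff (ccmp_zero hf0), sub_zero])
  exact ⟨M, Q, h1, h2, h3, h4, hcB, h5⟩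

lemma temp_formal {k σ : ℕ} {μ : ℂ} {ρ κ : ℝ≥0} {δ : ℝ} (D : LinData k σ μ ρ κ δ) {r : ℝ≥0} (hr : 0 < r)
    (a M Q : ℂ⟦X⟧⟦X⟧) (ha0 : cf 0 a = 0) (B : ℝ≥0) (hB : 4 * CC k σ μ ρ κ ^ 2 * B ≤ 1)
    (ha : eps (Wt σ ρ κ r) a ≠ ∞) (hM : NN (Wt σ ρ κ r) M ≤ 1) (hQ0 : cf 0 Q = 0)
    (hQ : NN (Wt σ ρ κ r) Q ≤ CC k σ μ ρ κ * B) :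
    ∃ T H, cf 0 T = 0 ∧ SuppC k σ H ∧ NN (Wt σ ρ κ r) (Dy T) ≠ ∞ ∧
      NN (Wt σ ρ κ r) H ≠ ∞ ∧ 
      LL k μ T + H = ccmp a (1 + M) - Q * Dy T := by
  set W := Wt σ ρ κ r with hWdef
  have hW : SubM W := Wt_sub σ ρ κ r D.hκ
  have hW0 : W 0 0 = 1 := Wt_zero σ ρ κ r
  set c := CC k σ μ ρ κ with hc
  set e : ℝ≥0 := (eps W a).toNNReal with he
  have hee : (e : ℝ≥0∞) = eps W a := ENNReal.coe_toNNReal ha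
  obtain ⟨M, Q, h1, h2, h3, h4, h5⟩ := formal_solve D hr (2 * e)
    (fun T H => ccmp a (1 + M) - Q * Dy T) (by
      intro n T T' H H' hT hT' hH hH' hag
      have e1 : PowerSeries.X ^ n ∣ T - T' := dvd_of_agree fun i hi => (hag i hi).1
      apply agree_of_dvd
      have : (ccmp a (1 + M) - Q * Dy T) - (ccmp a (1 + M) - Q * Dy T') = - ((Dy T - Dy T') * Q) := by ring
      rw [this, dvd_neg, pow_succ]
      exact mul_dvd_mul (Dy_dvd e1) (X_dvd_of hQ0)) (by
      intro T H hT hH hTb hHb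
      calc _ ≤ NN W (ccmp a (1 + M)) + NN W Q * NN W (Dy T) := 
            (NN_sub _ _ _).trans (add_le_add le_rfl (NN_mul hW _ _))
        _ ≤ e + (c * B) * (c * (2 * e : ℝ≥0)) := by
            gcongr
            rw [hee]; exact NN_ccmp2 hW hW0 a M hM
        _ ≤ _ := by
            have : e + (c * B) * (c * (2 * e : ℝ≥0)) ≤ 2 * e := by
              have h : 4 * (c : ℝ) ^ 2 * B ≤ 1 := by exact_mod_cast hB
              rw [← NNReal.coe_le_coe]; push_cast
              nlinarith [e.2, mul_le_mul_of_nonneg_right h e.2]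
            exact_mod_cast this) (by
      intro T H hT hH
      rw [map_sub, mul_zero_coeff hQ0, ccmp_zero ha0, sub_zero])
  refine ⟨M, Q, h1, h2, ne_top_of_le_ne_top ?_ h3, ne_top_of_le_ne_top ?_ h4, h5⟩ <;>
  exact ENNReal.mul_ne_top ENNReal.coe_ne_top ENNReal.coe_ne_top


lemma nn_mono {W W' : ℕ → ℕ → ℝ≥0} {n m : ℕ} {t : ℝ≥0∞} (a : ℂ⟦X⟧)
    (h : ∀ j, (W n j : ℝ≥0∞) ≤ t * W' m j) : nn W n a ≤ t * nn W' m a := by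
  unfold nn
  rw [← ENNReal.tsum_mul_left]
  refine ENNReal.tsum_le_tsum fun j => ?_
  calc _ ≤ ‖cf j a‖ₑ * (t * W' m j) := by gcongr; exact h j
    _ = _ := by ring

lemma eps_small (σ : ℕ) {ρ κ r0 s : ℝ≥0} (hκ : 1 ≤ κ) (hs : s ≤ 1) (f : ℂ⟦X⟧⟦X⟧)
    (hf0 : cf 0 f = 0) : eps (Wt σ ρ κ (r0 * s / 2)) f ≤ s * NN (Wt 0 (ρ * κ) 1 r0) f := by
  unfold eps NN
  rw [← ENNReal.tsum_mul_left]
  refine ENNReal.tsum_le_tsum fun l => ?_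
  rcases Nat.eq_zero_or_pos l with rfl | hl
  · rw [hf0, nn_zero]; simp
  · have key : ∀ j, (Wt σ ρ κ (r0 * s / 2) l j : ℝ≥0∞) ≤ ((s / 2 ^ l : ℝ≥0) : ℝ≥0∞) * Wt 0 (ρ * κ) 1 r0 l j := by
      intro j
      rw [← ENNReal.coe_mul, ENNReal.coe_le_coe]
      unfold Wt
      have e1 : κ ^ (j - σ * l) ≤ κ ^ j := pow_le_pow_right₀ hκ (by omega)
      have e2 : s ^ l ≤ s := pow_le_of_le_one (by simp) hs (by omega)
      calc _ ≤ ρ ^ j * κ ^ j * (r0 ^ l * s / 2 ^ l) := by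
            rw [div_pow, mul_pow]; gcongr
        _ = _ := by rw [mul_pow]; simp; ring
    calc _ ≤ (((s / 2 ^ l : ℝ≥0) : ℝ≥0∞) * nn (Wt 0 (ρ * κ) 1 r0) l (cf l f)) * ((2 ^ l : ℝ≥0) : ℝ≥0∞) := by
          push_cast
          gcongr
          have := nn_mono (cf l f) key
          push_cast at this
          exact this
      _ = ((s / 2 ^ l * 2 ^ l : ℝ≥0) : ℝ≥0∞) * nn (Wt 0 (ρ * κ) 1 r0) l (cf l f) := by push_cast; ring
      _ = _ := by rw [div_mul_cancel₀ _ (by positivity)]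

lemma choose_r (σ : ℕ) {ρ κ r0 ε : ℝ≥0} (hκ : 1 ≤ κ) (hr0 : 0 < r0) (hε : 0 < ε) (f a : ℂ⟦X⟧⟦X⟧)
    (hf0 : cf 0 f = 0) (ha0 : cf 0 a = 0) (hf : NN (Wt 0 (ρ * κ) 1 r0) f ≠ ∞)
    (ha : NN (Wt 0 (ρ * κ) 1 r0) a ≠ ∞) :
    ∃ r : ℝ≥0, 0 < r ∧ eps (Wt σ ρ κ r) f ≤ ε ∧ eps (Wt σ ρ κ r) a ≠ ∞ := by
  lift NN (Wt 0 (ρ * κ) 1 r0) f to ℝ≥0 using hf with N hN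
  have hs : min 1 (ε / (N + 1)) ≤ 1 := min_le_left _ _
  refine ⟨r0 * min 1 (ε / (N + 1)) / 2, by positivity, ?_, ?_⟩
  · refine (eps_small σ hκ hs f hf0).trans ?_
    rw [← hN, ← ENNReal.coe_mul, ENNReal.coe_le_coe]
    calc _ ≤ ε / (N + 1) * (N + 1) := by gcongr; exact min_le_right _ _; simp
      _ = ε := div_mul_cancel₀ _ (by positivity)
  · exact ne_top_of_le_ne_top (ENNReal.mul_ne_top ENNReal.coe_ne_top ha) (eps_small σ hκ hs a ha0)


/-- evaluation of a power series in `x` -/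
def Ex (x : ℂ) (a : ℂ⟦X⟧) : ℂ := ∑' j, cf j a * x ^ j

/-- evaluation of a double power series -/
def ev (c : ℂ⟦X⟧⟦X⟧) (p : ℂ × ℂ) : ℂ := ∑' n, Ex p.1 (cf n c) * p.2 ^ n

/-- the plain polydisc weight -/
def Vt (s t : ℝ≥0) : ℕ → ℕ → ℝ≥0 := Wt 0 s 1 t

lemma Vt_eq (s t : ℝ≥0) (n j : ℕ) : Vt s t n j = s ^ j * t ^ n := by simp [Vt, Wt]

lemma Vt_sub (s t : ℝ≥0) : SubM (Vt s t) := Wt_sub 0 s 1 t le_rfl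

lemma Vt_zero (s t : ℝ≥0) : Vt s t 0 0 = 1 := Wt_zero 0 s 1 t

lemma summable_norm_of_enorm {ι : Type*} {f : ι → ℂ} (h : ∑' i, ‖f i‖ₑ ≠ ∞) : Summable fun i => ‖f i‖ := by
  have : Summable fun i => ‖f i‖₊ := by
    rw [← ENNReal.tsum_coe_ne_top_iff_summable]; exact h
  exact NNReal.summable_coe.2 this

lemma enorm_tsum_le' {ι : Type*} (f : ι → ℂ) : ‖∑' i, f i‖ₑ ≤ ∑' i, ‖f i‖ₑ := by
  by_cases h : ∑' i, ‖f i‖ₑ = ∞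
  · rw [h]; exact le_top
  · have hs : Summable fun i => ‖f i‖₊ := by
      rw [← ENNReal.tsum_coe_ne_top_iff_summable]; exact h
    have h2 := nnnorm_tsum_le hs
    calc ‖∑' i, f i‖ₑ ≤ ((∑' i, ‖f i‖₊ : ℝ≥0) : ℝ≥0∞) := by
          rw [enorm_eq_nnnorm, ENNReal.coe_le_coe]; exact h2
      _ = _ := by rw [ENNReal.coe_tsum hs]; rfl

lemma enorm_le_cc {x : ℂ} {s : ℝ≥0} (h : ‖x‖ ≤ s) : ‖x‖ₑ ≤ s := by
  rw [enorm_eq_nnnorm, ENNReal.coe_le_coe]; exact_mod_cast h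

section
variable {s t : ℝ≥0} {x y : ℂ}

lemma Ex_en (hx : ‖x‖ ≤ s) (n : ℕ) (a : ℂ⟦X⟧) :
    (∑' j, ‖cf j a * x ^ j‖ₑ) * (t : ℝ≥0∞) ^ n ≤ nn (Vt s t) n a := by
  unfold nn
  rw [← ENNReal.tsum_mul_right]
  refine ENNReal.tsum_le_tsum fun j => ?_
  rw [enorm_mul, enorm_pow, Vt_eq, mul_assoc]
  push_cast
  gcongr
  exact enorm_le_cc hx

lemma Ex_summ (ht : 0 < t) (hx : ‖x‖ ≤ s) {n : ℕ} {a : ℂ⟦X⟧} (h : nn (Vt s t) n a ≠ ∞) :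
    Summable fun j => ‖cf j a * x ^ j‖ := by
  apply summable_norm_of_enorm
  intro h2
  have := Ex_en (t := t) hx n a
  rw [h2, ENNReal.top_mul (by positivity)] at this
  exact h (top_le_iff.1 this)

lemma Ex_bound (hx : ‖x‖ ≤ s) (n : ℕ) (a : ℂ⟦X⟧) : ‖Ex x a‖ₑ * (t : ℝ≥0∞) ^ n ≤ nn (Vt s t) n a := by
  refine le_trans ?_ (Ex_en hx n a)
  gcongr
  exact enorm_tsum_le' _

lemma Ex_bound' (hx : ‖x‖ ≤ s) (hy : ‖y‖ ≤ t) (n : ℕ) (a : ℂ⟦X⟧) : ‖Ex x a * y ^ n‖ₑ ≤ nn (Vt s t) n a := by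
  refine le_trans ?_ (Ex_bound (t := t) hx n a)
  rw [enorm_mul, enorm_pow]
  gcongr
  exact enorm_le_cc hy

lemma Ex_mul (ht : 0 < t) (hx : ‖x‖ ≤ s) {n m : ℕ} {a b : ℂ⟦X⟧} (ha : nn (Vt s t) n a ≠ ∞)
    (hb : nn (Vt s t) m b ≠ ∞) : Ex x (a * b) = Ex x a * Ex x b := by
  unfold Ex
  rw [tsum_mul_tsum_eq_tsum_sum_antidiagonal_of_summable_norm (Ex_summ ht hx ha) (Ex_summ ht hx hb)]
  congr 1; funext j
  rw [PowerSeries.coeff_mul, Finset.sum_mul]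
  refine Finset.sum_congr rfl fun p hp => ?_
  rw [Finset.HasAntidiagonal.mem_antidiagonal] at hp
  rw [← hp, pow_add]; ring

lemma Ex_add (ht : 0 < t) (hx : ‖x‖ ≤ s) {n m : ℕ} {a b : ℂ⟦X⟧} (ha : nn (Vt s t) n a ≠ ∞)
    (hb : nn (Vt s t) m b ≠ ∞) : Ex x (a + b) = Ex x a + Ex x b := by
  unfold Ex
  rw [← ((Ex_summ ht hx ha).of_norm).tsum_add ((Ex_summ ht hx hb).of_norm)]
  congr 1; funext j
  rw [map_add, add_mul]

lemma Ex_zero (x : ℂ) : Ex x 0 = 0 := by simp [Ex]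

lemma Ex_sum (ht : 0 < t) (hx : ‖x‖ ≤ s) {ι : Type*} (S : Finset ι) (n : ℕ) (a : ι → ℂ⟦X⟧)
    (ha : ∀ i ∈ S, nn (Vt s t) n (a i) ≠ ∞) : Ex x (∑ i ∈ S, a i) = ∑ i ∈ S, Ex x (a i) := by
  unfold Ex
  rw [← Summable.tsum_finsetSum fun i hi => (Ex_summ ht hx (ha i hi)).of_norm]
  congr 1; funext j
  rw [map_sum, Finset.sum_mul]

lemma nn_ne {W : ℕ → ℕ → ℝ≥0} {c : ℂ⟦X⟧⟦X⟧} (h : NN W c ≠ ∞) (n : ℕ) : nn W n (cf n c) ≠ ∞ :=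
  ne_top_of_le_ne_top h (ENNReal.le_tsum n)

lemma ev_summ (hx : ‖x‖ ≤ s) (hy : ‖y‖ ≤ t) {c : ℂ⟦X⟧⟦X⟧} (h : NN (Vt s t) c ≠ ∞) :
    Summable fun n => ‖Ex x (cf n c) * y ^ n‖ :=
  summable_norm_of_enorm (ne_top_of_le_ne_top h (ENNReal.tsum_le_tsum fun n => Ex_bound' hx hy n _))

lemma ev_add (ht : 0 < t) (hx : ‖x‖ ≤ s) (hy : ‖y‖ ≤ t) {c d : ℂ⟦X⟧⟦X⟧} (hc : NN (Vt s t) c ≠ ∞)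
    (hd : NN (Vt s t) d ≠ ∞) : ev (c + d) (x, y) = ev c (x, y) + ev d (x, y) := by
  unfold ev
  rw [← ((ev_summ hx hy hc).of_norm).tsum_add ((ev_summ hx hy hd).of_norm)]
  congr 1; funext n
  rw [map_add, Ex_add ht hx (nn_ne hc n) (nn_ne hd n), add_mul]

lemma ev_mul (ht : 0 < t) (hx : ‖x‖ ≤ s) (hy : ‖y‖ ≤ t) {c d : ℂ⟦X⟧⟦X⟧} (hc : NN (Vt s t) c ≠ ∞)
    (hd : NN (Vt s t) d ≠ ∞) : ev (c * d) (x, y) = ev c (x, y) * ev d (x, y) := by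
  unfold ev
  rw [tsum_mul_tsum_eq_tsum_sum_antidiagonal_of_summable_norm (ev_summ hx hy hc) (ev_summ hx hy hd)]
  congr 1; funext n
  rw [PowerSeries.coeff_mul, Ex_sum ht hx _ n, Finset.sum_mul]
  · refine Finset.sum_congr rfl fun p hp => ?_
    rw [Finset.HasAntidiagonal.mem_antidiagonal] at hp
    rw [Ex_mul ht hx (nn_ne hc p.1) (nn_ne hd p.2), ← hp, pow_add]; ring
  · intro p hp
    rw [Finset.HasAntidiagonal.mem_antidiagonal] at hp
    rw [← hp]
    exact ne_top_of_le_ne_top (ENNReal.mul_ne_top (nn_ne hc p.1) (nn_ne hd p.2)) (nn_mul (Vt_sub s t) _ _ _ _)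

lemma ev_C (a : ℂ⟦X⟧) (x y : ℂ) : ev (PowerSeries.C a) (x, y) = Ex x a := by
  unfold ev
  rw [tsum_eq_single 0]
  · simp
  · intro n hn; simp [PowerSeries.coeff_C, hn, Ex_zero]

lemma Ex_X_pow (x : ℂ) (k : ℕ) : Ex x (PowerSeries.X ^ k) = x ^ k := by
  unfold Ex
  rw [tsum_eq_single k]
  · simp
  · intro n hn; simp [PowerSeries.coeff_X_pow, hn]

lemma ev_one (x y : ℂ) : ev 1 (x, y) = 1 := by
  have : (1 : ℂ⟦X⟧⟦X⟧) = PowerSeries.C (PowerSeries.X ^ 0) := by simp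
  rw [this, ev_C, Ex_X_pow, pow_zero]

lemma ev_smul (μ : ℂ) (c : ℂ⟦X⟧⟦X⟧) (p : ℂ × ℂ) : ev (μ • c) p = μ * ev c p := by
  unfold ev Ex
  rw [← tsum_mul_left]
  congr 1; funext n
  rw [← mul_assoc, ← tsum_mul_left]
  congr 2; funext j
  rw [PowerSeries.coeff_smul, PowerSeries.coeff_smul, smul_eq_mul, mul_assoc]

lemma ev_neg (c : ℂ⟦X⟧⟦X⟧) (p : ℂ × ℂ) : ev (-c) p = - ev c p := by
  have : -c = (-1 : ℂ) • c := by simp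
  rw [this, ev_smul]; ring

lemma ev_sub (ht : 0 < t) (hx : ‖x‖ ≤ s) (hy : ‖y‖ ≤ t) {c d : ℂ⟦X⟧⟦X⟧} (hc : NN (Vt s t) c ≠ ∞)
    (hd : NN (Vt s t) d ≠ ∞) : ev (c - d) (x, y) = ev c (x, y) - ev d (x, y) := by
  rw [sub_eq_add_neg, ev_add ht hx hy hc (by rwa [NN_neg]), ev_neg]; ring

lemma ev_pow (ht : 0 < t) (hx : ‖x‖ ≤ s) (hy : ‖y‖ ≤ t) {c : ℂ⟦X⟧⟦X⟧} (hc : NN (Vt s t) c ≠ ∞) (l : ℕ) :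
    ev (c ^ l) (x, y) = ev c (x, y) ^ l := by
  induction l with
  | zero => rw [pow_zero, pow_zero, ev_one]
  | succ l ih =>
    rw [pow_succ, pow_succ, ev_mul ht hx hy _ hc, ih]
    exact ne_top_of_le_ne_top (ENNReal.pow_ne_top hc) (NN_pow (Vt_sub s t) (Vt_zero s t) c l)

lemma ev_ccmp (ht : 0 < t) (hx : ‖x‖ ≤ s) (hy : ‖y‖ ≤ t) {f g : ℂ⟦X⟧⟦X⟧} (hg : NN (Vt s t) g ≠ ∞)
    (h : ∑' l, nn (Vt s t) l (cf l f) * NN (Vt s t) g ^ l ≠ ∞) (hf : ∀ l, nn (Vt s t) l (cf l f) ≠ ∞) :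
    ev (ccmp f g) (x, y) = ev f (x, y * ev g (x, y)) := by
  have hgl : ∀ l, NN (Vt s t) (g ^ l) ≠ ∞ := fun l =>
    ne_top_of_le_ne_top (ENNReal.pow_ne_top hg) (NN_pow (Vt_sub s t) (Vt_zero s t) g l)
  set S : ℕ × ℕ → ℂ := fun q => Ex x (cf q.1 f) * y ^ q.1 * (Ex x (cf q.2 (g ^ q.1)) * y ^ q.2) with hS
  have hSs : Summable S := by
    apply Summable.of_norm
    apply summable_norm_of_enorm
    refine ne_top_of_le_ne_top h ?_
    rw [ENNReal.tsum_prod']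
    refine ENNReal.tsum_le_tsum fun l => ?_
    calc _ ≤ ∑' m, nn (Vt s t) l (cf l f) * nn (Vt s t) m (cf m (g ^ l)) := by
          refine ENNReal.tsum_le_tsum fun m => ?_
          rw [hS, enorm_mul]
          gcongr
          · exact Ex_bound' hx hy l _
          · exact Ex_bound' hx hy m _
      _ = nn (Vt s t) l (cf l f) * NN (Vt s t) (g ^ l) := by rw [ENNReal.tsum_mul_left]; rfl
      _ ≤ _ := by gcongr; exact NN_pow (Vt_sub s t) (Vt_zero s t) g l
  have h1 : ∑' q, S q = ev f (x, y * ev g (x, y)) := by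
    rw [hSs.tsum_prod]
    conv_rhs => unfold ev
    congr 1; funext l
    simp only [hS]
    rw [tsum_mul_left]
    have := ev_pow ht hx hy hg l
    unfold ev at this
    simp only at this ⊢
    rw [this, mul_pow]; ring
  rw [← h1, ← (Finset.HasAntidiagonal.sigmaAntidiagonalEquivProd).tsum_eq, Summable.tsum_sigma]
  · unfold ev
    congr 1; funext n
    simp only [ccmp, PowerSeries.coeff_mk]
    rw [Ex_sum ht hx _ n, Finset.sum_mul, tsum_fintype, Finset.univ_eq_attach]
    · rw [← Finset.sum_attach]
      refine Finset.sum_congr rfl fun p _ => ?_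
      have hp := p.2
      rw [Finset.HasAntidiagonal.mem_antidiagonal] at hp
      rw [Ex_mul ht hx (hf p.1.1) (nn_ne (hgl p.1.1) p.1.2)]
      have hp2 : y ^ n = y ^ p.1.1 * y ^ p.1.2 := by rw [← pow_add, hp]
      rw [hp2]
      simp only [hS, Finset.HasAntidiagonal.sigmaAntidiagonalEquivProd, Equiv.coe_fn_mk]; ring
    · intro p hp
      rw [Finset.HasAntidiagonal.mem_antidiagonal] at hp
      rw [← hp]
      exact ne_top_of_le_ne_top (ENNReal.mul_ne_top (hf p.1) (nn_ne (hgl p.1) p.2)) (nn_mul (Vt_sub s t) _ _ _ _)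
  · exact (Equiv.summable_iff (Finset.HasAntidiagonal.sigmaAntidiagonalEquivProd (A := ℕ)) (f := S)).2 hSs

/-- pair sum -/
lemma ev_hasSum (hx : ‖x‖ ≤ s) (hy : ‖y‖ ≤ t) {c : ℂ⟦X⟧⟦X⟧} (h : NN (Vt s t) c ≠ ∞) :
    HasSum (fun q : ℕ × ℕ => cf q.2 (cf q.1 c) * x ^ q.2 * y ^ q.1) (ev c (x, y)) := by
  have hs : Summable (fun q : ℕ × ℕ => cf q.2 (cf q.1 c) * x ^ q.2 * y ^ q.1) := by
    apply Summable.of_norm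
    apply summable_norm_of_enorm
    refine ne_top_of_le_ne_top h ?_
    rw [ENNReal.tsum_prod']
    unfold NN
    refine ENNReal.tsum_le_tsum fun n => ?_
    refine le_trans ?_ (Ex_en (t := t) hx n _)
    rw [← ENNReal.tsum_mul_right]
    refine ENNReal.tsum_le_tsum fun j => ?_
    rw [enorm_mul _ (y ^ n), enorm_pow]
    gcongr
    exact enorm_le_cc hy
  have : ev c (x, y) = ∑' q : ℕ × ℕ, cf q.2 (cf q.1 c) * x ^ q.2 * y ^ q.1 := by
    rw [hs.tsum_prod]
    unfold ev Ex
    congr 1; funext n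
    simp only
    rw [tsum_mul_right]
  rw [this]
  exact hs.hasSum

end

lemma cf_bound {s t : ℝ≥0} (c : ℂ⟦X⟧⟦X⟧) (h : NN (Vt s t) c ≠ ∞) (n j : ℕ) :
    ‖cf j (cf n c)‖ * (s ^ j * t ^ n) ≤ (NN (Vt s t) c).toReal := by
  have h1 : ‖cf j (cf n c)‖ₑ * (Vt s t n j : ℝ≥0∞) ≤ NN (Vt s t) c :=
    (ENNReal.le_tsum (f := fun j => ‖cf j (cf n c)‖ₑ * (Vt s t n j : ℝ≥0∞)) j).trans
      (ENNReal.le_tsum (f := fun n => nn (Vt s t) n (cf n c)) n)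
  have h2 := ENNReal.toReal_mono h h1
  rw [Vt_eq] at h2
  simpa using h2

lemma NN_mono {W W' : ℕ → ℕ → ℝ≥0} (c : ℂ⟦X⟧⟦X⟧) (h : ∀ n j, W n j ≤ W' n j) : NN W c ≤ NN W' c := by
  unfold NN nn
  refine ENNReal.tsum_le_tsum fun n => ENNReal.tsum_le_tsum fun j => ?_
  gcongr
  exact_mod_cast h n j

lemma Vt_mono {s t s' t' : ℝ≥0} (hs : s ≤ s') (ht : t ≤ t') (n j : ℕ) : Vt s t n j ≤ Vt s' t' n j := by
  rw [Vt_eq, Vt_eq]; gcongr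

lemma ev_analyticAt {s t : ℝ≥0} (hs : 0 < s) (ht : 0 < t) {c : ℂ⟦X⟧⟦X⟧} (h : NN (Vt s t) c ≠ ∞) :
    AnalyticAt ℂ (ev c) 0 := by
  have hm : 0 < min s t := lt_min hs ht
  have h' : NN (Vt (min s t) (min s t)) c ≠ ∞ :=
    ne_top_of_le_ne_top h (NN_mono c (Vt_mono (min_le_left _ _) (min_le_right _ _)))
  set R := min s t
  refine ds_analyticAt (c := fun n j => cf j (cf n c)) (R := R) (C := (NN (Vt R R) c).toReal)
    (by exact_mod_cast hm) ?_ ?_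
  · intro n j
    rw [le_div_iff₀ (by positivity)]
    have := cf_bound c h' n j
    rwa [← pow_add, add_comm j n] at this
  · intro x y hx hy
    exact ev_hasSum hx.le hy.le h'

lemma two_pow_half (s : ℝ≥0) (j : ℕ) : (j : ℝ≥0) * (s / 2) ^ j ≤ s ^ j := by
  rw [div_pow, mul_div_assoc', mul_comm, ← mul_div_assoc']
  have : (j : ℝ≥0) / 2 ^ j ≤ 1 := by
    rw [div_le_one (by positivity)]
    exact_mod_cast (Nat.lt_two_pow_self (n := j)).le
  exact mul_le_of_le_one_right (by positivity) this

lemma NN_Dx {s t : ℝ≥0} {c : ℂ⟦X⟧⟦X⟧} : NN (Vt (s / 2) t) (Dx c) ≤ NN (Vt s t) c := by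
  unfold NN nn
  refine ENNReal.tsum_le_tsum fun n => ENNReal.tsum_le_tsum fun j => ?_
  simp only [Dx, PowerSeries.coeff_mk]
  rw [enorm_mul, cen_nat, Vt_eq, Vt_eq, mul_comm (j : ℝ≥0∞), mul_assoc]
  gcongr
  have := two_pow_half s j
  calc _ = ((j * (s / 2) ^ j * t ^ n : ℝ≥0) : ℝ≥0∞) := by push_cast; ring
    _ ≤ _ := by rw [ENNReal.coe_le_coe]; gcongr

lemma NN_Dy' {s t : ℝ≥0} {c : ℂ⟦X⟧⟦X⟧} : NN (Vt s (t / 2)) (Dy c) ≤ NN (Vt s t) c := by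
  unfold NN nn
  refine ENNReal.tsum_le_tsum fun n => ENNReal.tsum_le_tsum fun j => ?_
  simp only [Dy, PowerSeries.coeff_mk]
  rw [PowerSeries.coeff_smul, smul_eq_mul, enorm_mul, cen_nat, Vt_eq, Vt_eq, mul_comm (n : ℝ≥0∞), mul_assoc]
  gcongr
  have := two_pow_half t n
  calc _ = ((s ^ j * (n * (t / 2) ^ n) : ℝ≥0) : ℝ≥0∞) := by push_cast; ring
    _ ≤ _ := by rw [ENNReal.coe_le_coe]; gcongr

/-- derivative of the evaluation along the Euler fields -/
lemma ev_deriv {s t : ℝ≥0} (hs : 0 < s) (ht : 0 < t) {c : ℂ⟦X⟧⟦X⟧} (h : NN (Vt s t) c ≠ ∞) :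
    ∀ᶠ p in 𝓝 (0 : ℂ × ℂ), ∀ α β : ℂ,
      fderiv ℂ (ev c) p (p.1 * α, p.2 * β) = α * ev (Dx c) p + β * ev (Dy c) p := by
  have hA := (ev_analyticAt hs ht h).eventually_analyticAt
  have h1 : ∀ᶠ p in 𝓝 (0 : ℂ × ℂ), ‖p.1‖ < s / 2 ∧ ‖p.2‖ < t / 2 := by
    have c1 : Continuous fun p : ℂ × ℂ => ‖p.1‖ := by fun_prop
    have c2 : Continuous fun p : ℂ × ℂ => ‖p.2‖ := by fun_prop
    have hs' : (0 : ℝ) < s := hs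
    have ht' : (0 : ℝ) < t := ht
    exact (c1.continuousAt.eventually_lt continuousAt_const (by simp; positivity)).and
      (c2.continuousAt.eventually_lt continuousAt_const (by simp; positivity))
  filter_upwards [hA, h1] with p hA ⟨hx, hy⟩ α β
  obtain ⟨x, y⟩ := p
  simp only at hx hy ⊢
  have hD : HasFDerivAt (ev c) (fderiv ℂ (ev c) (x, y)) (x, y) := hA.differentiableAt.hasFDerivAt
  -- the scaled path
  set φ : ℂ → ℂ × ℂ := fun z => (x * (1 + α * z), y * (1 + β * z)) with hφ
  have hφd : HasDerivAt φ (x * α, y * β) 0 := by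
    apply HasDerivAt.prodMk
    · have := (((hasDerivAt_id (0 : ℂ)).const_mul α).const_add 1).const_mul x
      simpa using this
    · have := (((hasDerivAt_id (0 : ℂ)).const_mul β).const_add 1).const_mul y
      simpa using this
  have hφ0 : φ 0 = (x, y) := by simp [hφ]
  have hcomp : HasDerivAt (fun z => ev c (φ z)) (fderiv ℂ (ev c) (x, y) (x * α, y * β)) 0 := by
    rw [← hφ0] at hD
    have := hD.comp_hasDerivAt (0 : ℂ) hφd
    rw [hφ0] at this
    exact this
  have hφc : Continuous φ := by fun_prop
  set U : Set ℂ := {z | ‖(φ z).1‖ < s ∧ ‖(φ z).2‖ < t} with hU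
  have hUo : IsOpen U := by
    have o1 : IsOpen {z | ‖(φ z).1‖ < s} := isOpen_lt (by fun_prop) continuous_const
    have o2 : IsOpen {z | ‖(φ z).2‖ < t} := isOpen_lt (by fun_prop) continuous_const
    exact o1.inter o2
  have hs' : (0 : ℝ) < s := hs
  have ht' : (0 : ℝ) < t := ht
  have h0U : (0 : ℂ) ∈ U := by
    simp only [hU, Set.mem_ofPred_eq, hφ0]
    constructor <;> linarith
  set F : ℕ × ℕ → ℂ → ℂ := fun q z => cf q.2 (cf q.1 c) * (φ z).1 ^ q.2 * (φ z).2 ^ q.1 with hF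
  have hu : Summable fun q : ℕ × ℕ => ‖cf q.2 (cf q.1 c) * (s : ℂ) ^ q.2 * (t : ℂ) ^ q.1‖ := by
    have := (ev_hasSum (x := (s : ℂ)) (y := (t : ℂ)) (s := s) (t := t) (by simp) (by simp) h).summable
    exact this.norm
  have hsum := Complex.hasSum_deriv_of_summable_norm (F := F) hu (U := U) (z := 0) (by
      intro q; apply Differentiable.differentiableOn; simp only [hF, hφ]; fun_prop) hUo (by
      intro q z hz
      simp only [hF, norm_mul, norm_pow]
      simp only [Complex.norm_real, NNReal.norm_eq]
      gcongr
      · exact hz.1.le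
      · exact hz.2.le) h0U
  have e1 : (fun w => ∑' q, F q w) =ᶠ[𝓝 0] fun z => ev c (φ z) := by
    filter_upwards [hUo.mem_nhds h0U] with z hz
    exact (ev_hasSum (s := s) (t := t) hz.1.le hz.2.le h).tsum_eq
  rw [e1.deriv_eq, hcomp.deriv] at hsum
  refine hsum.unique ?_
  have hsx : ‖x‖ ≤ (s / 2 : ℝ≥0) := by push_cast; exact hx.le
  have hty : ‖y‖ ≤ (t / 2 : ℝ≥0) := by push_cast; exact hy.le
  have a1 := ev_hasSum (s := s / 2) (t := t) hsx (by linarith) (ne_top_of_le_ne_top h NN_Dx)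
  have a2 := ev_hasSum (s := s) (t := t / 2) (x := x) (by linarith) hty (ne_top_of_le_ne_top h NN_Dy')
  refine HasSum.congr_fun' ((a1.mul_left α).add (a2.mul_left β)) ?_
  intro q
  have hd1 : HasDerivAt (fun z => (φ z).1) (x * α) 0 := hφd.fst
  have hd2 : HasDerivAt (fun z => (φ z).2) (y * β) 0 := hφd.snd
  have := ((hd1.pow q.2).const_mul (cf q.2 (cf q.1 c))).mul (hd2.pow q.1)
  have e2 : deriv (F q) 0 = _ := this.deriv
  rw [e2]
  simp only [hφ0, Dx, Dy, PowerSeries.coeff_mk, PowerSeries.coeff_smul, smul_eq_mul]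
  simp only [Pi.pow_apply, hφ0]
  rcases q with ⟨n, j⟩
  rcases n with _ | n <;> rcases j with _ | j <;> simp <;> ring


lemma NN_CX (s t : ℝ≥0) (k : ℕ) : NN (Vt s t) (PowerSeries.C (PowerSeries.X ^ k : ℂ⟦X⟧)) ≠ ∞ := by
  unfold NN
  rw [tsum_eq_single 0]
  · unfold nn
    rw [tsum_eq_single k]
    · simp [Vt_eq]
    · intro j hj; simp [PowerSeries.coeff_X_pow, hj]
  · intro n hn; rw [PowerSeries.coeff_C, if_neg hn, nn_zero]

lemma NN_smul (W : ℕ → ℕ → ℝ≥0) (z : ℂ) (c : ℂ⟦X⟧⟦X⟧) : NN W (z • c) = ‖z‖ₑ * NN W c := by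
  unfold NN
  rw [← ENNReal.tsum_mul_left]
  congr 1; funext n
  rw [PowerSeries.coeff_smul, nn_smul]

lemma NN_add_ne {W : ℕ → ℕ → ℝ≥0} {a b : ℂ⟦X⟧⟦X⟧} (ha : NN W a ≠ ∞) (hb : NN W b ≠ ∞) : NN W (a + b) ≠ ∞ :=
  ne_top_of_le_ne_top (ENNReal.add_ne_top.2 ⟨ha, hb⟩) (NN_add _ _ _)

lemma NN_mul_ne {W : ℕ → ℕ → ℝ≥0} (hW : SubM W) {a b : ℂ⟦X⟧⟦X⟧} (ha : NN W a ≠ ∞) (hb : NN W b ≠ ∞) : NN W (a * b) ≠ ∞ :=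
  ne_top_of_le_ne_top (ENNReal.mul_ne_top ha hb) (NN_mul hW _ _)

lemma NN_smul_ne {W : ℕ → ℕ → ℝ≥0} {a : ℂ⟦X⟧⟦X⟧} (z : ℂ) (ha : NN W a ≠ ∞) : NN W (z • a) ≠ ∞ := by
  rw [NN_smul]; exact ENNReal.mul_ne_top (by simp) ha

lemma NN_LL_ne {s t : ℝ≥0} (k : ℕ) (μ : ℂ) {M : ℂ⟦X⟧⟦X⟧} (h1 : NN (Vt s t) (Dx M) ≠ ∞)
    (h2 : NN (Vt s t) (Dy M) ≠ ∞) : NN (Vt s t) (LL k μ M) ≠ ∞ :=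
  NN_add_ne h2 (NN_mul_ne (Vt_sub s t) (NN_CX s t k) (NN_add_ne h1 (NN_smul_ne μ h2)))

lemma ev_LL {s t : ℝ≥0} {x y : ℂ} (ht : 0 < t) (hx : ‖x‖ ≤ s) (hy : ‖y‖ ≤ t) (k : ℕ) (μ : ℂ) {M : ℂ⟦X⟧⟦X⟧}
    (h1 : NN (Vt s t) (Dx M) ≠ ∞) (h2 : NN (Vt s t) (Dy M) ≠ ∞) :
    ev (LL k μ M) (x, y) = ev (Dy M) (x, y) + x ^ k * (ev (Dx M) (x, y) + μ * ev (Dy M) (x, y)) := by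
  unfold LL
  rw [ev_add ht hx hy h2 (NN_mul_ne (Vt_sub s t) (NN_CX s t k) (NN_add_ne h1 (NN_smul_ne μ h2))),
    ev_mul ht hx hy (NN_CX s t k) (NN_add_ne h1 (NN_smul_ne μ h2)), ev_add ht hx hy h1 (NN_smul_ne μ h2),
    ev_C, Ex_X_pow, ev_smul]

lemma ev_zero_of {c : ℂ⟦X⟧⟦X⟧} (h : cf 0 c = 0) (x : ℂ) : ev c (x, 0) = 0 := by
  unfold ev
  rw [tsum_eq_single 0]
  · simp [h, Ex_zero]
  · intro n hn; simp [hn]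

lemma ev_zero_of' {c : ℂ⟦X⟧⟦X⟧} (h : cf 0 c = 0) : ev c 0 = 0 := ev_zero_of h 0

/-- orbital part -/
def XF (k : ℕ) (μ : ℂ) (f : ℂ⟦X⟧⟦X⟧) (p : ℂ × ℂ) : ℂ × ℂ :=
  ((p.1 ^ (k + 1) : ℂ), p.2 * (1 + μ * p.1 ^ k + ev f p))

/-- the vector field -/
def NF (k : ℕ) (μ : ℂ) (u : ℂ → ℂ) (f a : ℂ⟦X⟧⟦X⟧) (p : ℂ × ℂ) : ℂ × ℂ :=
  (1 / (u p.1 + ev a p)) • XF k μ f p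

lemma Vt_le_Wt (σ : ℕ) {ρ κ r : ℝ≥0} (hκ : 1 ≤ κ) (n j : ℕ) : Vt ρ r n j ≤ Wt σ ρ κ r n j := by
  rw [Vt_eq]; unfold Wt
  gcongr
  exact le_mul_of_one_le_right (by positivity) (one_le_pow₀ hκ)

lemma XF_analytic {k : ℕ} {μ : ℂ} {f : ℂ⟦X⟧⟦X⟧} (h : AnalyticAt ℂ (ev f) 0) : AnalyticAt ℂ (XF k μ f) 0 := by
  unfold XF
  have a1 : AnalyticAt ℂ (fun p : ℂ × ℂ => p.1) 0 := analyticAt_fst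
  have a2 : AnalyticAt ℂ (fun p : ℂ × ℂ => p.2) 0 := analyticAt_snd
  exact (a1.pow _).prod (a2.mul ((analyticAt_const.add (analyticAt_const.mul (a1.pow _))).add h))

lemma ev_near {s t : ℝ≥0} (hs : 0 < s) (ht : 0 < t) :
    ∀ᶠ p in 𝓝 (0 : ℂ × ℂ), ‖p.1‖ ≤ s ∧ ‖p.2‖ ≤ t := by
  have c1 : Continuous fun p : ℂ × ℂ => ‖p.1‖ := by fun_prop
  have c2 : Continuous fun p : ℂ × ℂ => ‖p.2‖ := by fun_prop
  have hs' : (0 : ℝ) < s := hs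
  have ht' : (0 : ℝ) < t := ht
  have e1 : ∀ᶠ p in 𝓝 (0 : ℂ × ℂ), ‖p.1‖ < s := c1.continuousAt.eventually_lt continuousAt_const (by simpa)
  have e2 : ∀ᶠ p in 𝓝 (0 : ℂ × ℂ), ‖p.2‖ < t := c2.continuousAt.eventually_lt continuousAt_const (by simpa)
  filter_upwards [e1, e2] with p h1 h2
  exact ⟨h1.le, h2.le⟩

/-- y(1+m), x -/
lemma shear_deriv {m : ℂ × ℂ → ℂ} {p : ℂ × ℂ} (hm : DifferentiableAt ℂ m p) (v : ℂ × ℂ) :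
    fderiv ℂ (fun p : ℂ × ℂ => (p.1, p.2 * (1 + m p))) p v =
      (v.1, v.2 * (1 + m p) + p.2 * fderiv ℂ m p v) := by
  have h1 : HasFDerivAt (fun p : ℂ × ℂ => p.1) (ContinuousLinearMap.fst ℂ ℂ ℂ) p := hasFDerivAt_fst
  have h2 : HasFDerivAt (fun p : ℂ × ℂ => p.2) (ContinuousLinearMap.snd ℂ ℂ ℂ) p := hasFDerivAt_snd
  have h3 : HasFDerivAt (fun p : ℂ × ℂ => (p.1, p.2 * (1 + m p))) ((ContinuousLinearMap.fst ℂ ℂ ℂ).prod (p.2 • fderiv ℂ m p + (1 + m p) • ContinuousLinearMap.snd ℂ ℂ ℂ)) p := h1.prodMk (h2.mul (hm.hasFDerivAt.const_add 1))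
  rw [h3.fderiv]
  simp
  ring

lemma stage {k σ : ℕ} {μ : ℂ} {ρ κ : ℝ≥0} {δ : ℝ} (D : LinData k σ μ ρ κ δ) {u : ℂ → ℂ}
    (hu : AnalyticAt ℂ u 0) (hu0 : u 0 ≠ 0) {f a : ℂ⟦X⟧⟦X⟧} (hf0 : cf 0 f = 0) (ha0 : cf 0 a = 0)
    {r0 : ℝ≥0} (hr0 : 0 < r0) (hf : NN (Vt (ρ * κ) r0) f ≠ ∞) (ha : NN (Vt (ρ * κ) r0) a ≠ ∞) :
    ∃ (Q H : ℂ⟦X⟧⟦X⟧) (r : ℝ≥0), 0 < r ∧ SuppC k σ Q ∧ SuppC k σ H ∧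
      NN (Wt σ ρ κ r) Q ≠ ∞ ∧ NN (Wt σ ρ κ r) H ≠ ∞ ∧ Conj (NF k μ u f a) (NF k μ u Q H) := by
  have hκ := D.hκ
  have hρ := D.hρ
  have hρκ : 0 < ρ * κ := mul_pos hρ (lt_of_lt_of_le one_pos hκ)
  have hC : 0 < CC k σ μ ρ κ := by unfold CC; positivity
  set B : ℝ≥0 := 1 / (4 * CC k σ μ ρ κ ^ 2) with hB
  have hB0 : 0 < B := by rw [hB]; positivity
  have hB1 : 4 * CC k σ μ ρ κ ^ 2 * B ≤ 1 := by
    rw [hB, mul_one_div, div_self (by positivity)]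
  obtain ⟨r, hr, ef, ea⟩ := choose_r σ (ρ := ρ) (κ := κ) hκ hr0 (show 0 < B / 4 by positivity) f a hf0 ha0 hf ha
  obtain ⟨M, Q, hM0, hQs, hMn, hQn, hCB, hMeq⟩ := orb_formal D hr f hf0 B hB1 ef
  have hM1 : NN (Wt σ ρ κ r) M ≤ 1 := by
    refine (NN_le_Dy _ hM0).trans (hMn.trans ?_)
    exact_mod_cast hCB
  have hQ0 : cf 0 Q = 0 := by
    ext j; rw [hQs 0 j (Or.inl rfl)]; simp
  obtain ⟨T, H, hT0, hHs, hTn, hHn, hTeq⟩ := temp_formal D hr a M Q ha0 B hB1 ea hM1 hQ0 hQn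
  have hH0 : cf 0 H = 0 := by
    ext j; rw [hHs 0 j (Or.inl rfl)]; simp
  have hQn' : NN (Wt σ ρ κ r) Q ≠ ∞ := ne_top_of_le_ne_top (by
    exact ENNReal.mul_ne_top ENNReal.coe_ne_top ENNReal.coe_ne_top) hQn
  refine ⟨Q, H, r, hr, hQs, hHs, hQn', hHn, ?_⟩
  -- weights
  have hle : ∀ c : ℂ⟦X⟧⟦X⟧, NN (Vt ρ r) c ≤ NN (Wt σ ρ κ r) c := fun c => NN_mono c (Vt_le_Wt σ hκ)
  have nM : NN (Vt ρ r) M ≠ ∞ := ne_top_of_le_ne_top (by simp) ((hle M).trans hM1)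
  have nQ : NN (Vt ρ r) Q ≠ ∞ := ne_top_of_le_ne_top hQn' (hle Q)
  have nH : NN (Vt ρ r) H ≠ ∞ := ne_top_of_le_ne_top hHn (hle H)
  have nT : NN (Vt ρ r) T ≠ ∞ := ne_top_of_le_ne_top hTn ((hle T).trans (NN_le_Dy _ hT0))
  -- half weights
  have hs : 0 < ρ / 2 := by positivity
  have ht : 0 < r / 2 := by positivity
  set s := ρ / 2 with hsdef
  set t := r / 2 with htdef
  have hst : ∀ c : ℂ⟦X⟧⟦X⟧, NN (Vt ρ r) c ≠ ∞ → NN (Vt s t) c ≠ ∞ := fun c hc =>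
    ne_top_of_le_ne_top hc (NN_mono c (Vt_mono (half_le_self (by positivity)) (half_le_self (by positivity))))
  have hdx : ∀ c : ℂ⟦X⟧⟦X⟧, NN (Vt ρ r) c ≠ ∞ → NN (Vt s t) (Dx c) ≠ ∞ := fun c hc =>
    ne_top_of_le_ne_top hc ((NN_Dx (s := ρ) (t := t)).trans
      (NN_mono c (Vt_mono le_rfl (half_le_self (by positivity)))))
  have hdy : ∀ c : ℂ⟦X⟧⟦X⟧, NN (Vt ρ r) c ≠ ∞ → NN (Vt s t) (Dy c) ≠ ∞ := fun c hc =>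
    ne_top_of_le_ne_top hc ((NN_Dy' (s := s) (t := r)).trans
      (NN_mono c (Vt_mono (half_le_self (by positivity)) le_rfl)))
  have n1 : NN (Vt s t) (1 : ℂ⟦X⟧⟦X⟧) ≠ ∞ := by rw [NN_one (Vt_zero s t)]; simp
  have n1M := NN_add_ne n1 (hst M nM)
  have heps : ∀ g : ℂ⟦X⟧⟦X⟧, eps (Wt σ ρ κ r) g ≠ ∞ →
      ∑' l, nn (Vt s t) l (cf l g) * NN (Vt s t) (1 + M) ^ l ≠ ∞ := by
    intro g hg
    refine ne_top_of_le_ne_top hg ?_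
    refine ENNReal.tsum_le_tsum fun l => ?_
    have hVW : ∀ n j, Vt s t n j ≤ Wt σ ρ κ r n j := fun n j =>
      (Vt_mono (half_le_self (by positivity)) (half_le_self (by positivity)) n j).trans (Vt_le_Wt σ hκ n j)
    gcongr
    · have := nn_mono (W := Vt s t) (W' := Wt σ ρ κ r) (n := l) (m := l) (t := 1) (cf l g) (by
        intro j; rw [one_mul]; exact_mod_cast hVW l j)
      rwa [one_mul] at this
    · refine (NN_add _ _ _).trans ?_
      rw [NN_one (Vt_zero s t), ← one_add_one_eq_two]
      gcongr
      exact (NN_mono M hVW).trans hM1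
  have hnl : ∀ g : ℂ⟦X⟧⟦X⟧, NN (Vt (ρ * κ) r0) g ≠ ∞ → ∀ l, nn (Vt s t) l (cf l g) ≠ ∞ := by
    intro g hg l
    have h1 := nn_ne hg l
    have := nn_mono (W := Vt s t) (W' := Vt (ρ * κ) r0) (n := l) (m := l) (t := (((t / r0) ^ l : ℝ≥0) : ℝ≥0∞)) (cf l g) (by
        intro j
        rw [← ENNReal.coe_mul, ENNReal.coe_le_coe, Vt_eq, Vt_eq, show (t / r0) ^ l = t ^ l / r0 ^ l from div_pow _ _ _]
        have e : s ≤ ρ * κ := (half_le_self (by positivity)).trans (le_mul_of_one_le_right (by positivity) hκ)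
        calc s ^ j * t ^ l ≤ (ρ * κ) ^ j * t ^ l := by gcongr
          _ = t ^ l / r0 ^ l * ((ρ * κ) ^ j * r0 ^ l) := by
            have : r0 ^ l ≠ 0 := by positivity
            calc _ = (ρ * κ) ^ j * (t ^ l / r0 ^ l * r0 ^ l) := by rw [div_mul_cancel₀ _ this]
              _ = _ := by ring)
    exact ne_top_of_le_ne_top (ENNReal.mul_ne_top ENNReal.coe_ne_top h1) this
  have hcc : ∀ g : ℂ⟦X⟧⟦X⟧, eps (Wt σ ρ κ r) g ≠ ∞ → NN (Vt s t) (ccmp g (1 + M)) ≠ ∞ := fun g hg =>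
    ne_top_of_le_ne_top (heps g hg) (NN_ccmp (Vt_sub s t) (Vt_zero s t) g _)
  have ef' : eps (Wt σ ρ κ r) f ≠ ∞ := ne_top_of_le_ne_top ENNReal.coe_ne_top ef
  -- analyticity
  have aM := ev_analyticAt hρ hr nM
  have aQ := ev_analyticAt hρ hr nQ
  have aH := ev_analyticAt hρ hr nH
  have aT := ev_analyticAt hρ hr nT
  have aa := ev_analyticAt hρκ hr0 ha
  have af := ev_analyticAt hρκ hr0 hf
  set Ψ : ℂ × ℂ → ℂ × ℂ := fun p => (p.1, p.2 * (1 + ev M p)) with hΨ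
  have aΨ : AnalyticAt ℂ Ψ 0 := by
    have a1 : AnalyticAt ℂ (fun p : ℂ × ℂ => p.1) 0 := analyticAt_fst
    have a2 : AnalyticAt ℂ (fun p : ℂ × ℂ => p.2) 0 := analyticAt_snd
    exact a1.prod (a2.mul (analyticAt_const.add aM))
  have Ψ0 : Ψ 0 = 0 := by simp [hΨ]
  have hM00 : ev M 0 = 0 := ev_zero_of' hM0
  have hΨe : ∃ e : (ℂ × ℂ) ≃L[ℂ] (ℂ × ℂ), (e : (ℂ × ℂ) →L[ℂ] (ℂ × ℂ)) = fderiv ℂ Ψ 0 := by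
    refine ⟨ContinuousLinearEquiv.refl ℂ _, ?_⟩
    ext v : 1
    · ext <;> simp [hΨ, shear_deriv aM.differentiableAt, hM00]
    · ext <;> simp [hΨ, shear_deriv aM.differentiableAt, hM00]
  -- step 1 : orbital
  have s1 : Conj (NF k μ u f a) (fun p => (1 / (u p.1 + ev a (Ψ p))) • XF k μ Q p) := by
    refine ⟨Ψ, aΨ, Ψ0, hΨe, ?_⟩
    filter_upwards [ev_near hs ht, ev_deriv hρ hr nM, aM.eventually_analyticAt] with p hp hder hMa
    obtain ⟨x, y⟩ := p
    obtain ⟨hx, hy⟩ := hp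
    simp only at hx hy
    rw [map_smul]
    unfold NF
    congr 1
    rw [hΨ, shear_deriv hMa.differentiableAt]
    unfold XF
    simp only
    have e1 : ((x ^ (k + 1) : ℂ), y * (1 + μ * x ^ k + ev Q (x, y))) = (x * x ^ k, y * (1 + μ * x ^ k + ev Q (x, y))) := by
      rw [pow_succ']
    rw [e1]
    have hder' := hder (x ^ k) (1 + μ * x ^ k + ev Q (x, y))
    simp only at hder'
    rw [hder']
    have E := congrArg (fun c => ev c (x, y)) hMeq
    rw [ev_add ht hx hy (NN_LL_ne k μ (hdx M nM) (hdy M nM)) (hst Q nQ),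
      ev_LL ht hx hy k μ (hdx M nM) (hdy M nM),
      ev_sub ht hx hy (NN_mul_ne (Vt_sub s t) n1M (hcc f ef'))
        (NN_mul_ne (Vt_sub s t) (hst Q nQ) (NN_add_ne (hst M nM) (hdy M nM))),
      ev_mul ht hx hy n1M (hcc f ef'), ev_mul ht hx hy (hst Q nQ) (NN_add_ne (hst M nM) (hdy M nM)),
      ev_add ht hx hy (hst M nM) (hdy M nM), ev_ccmp ht hx hy n1M (heps f ef') (hnl f hf),
      ev_add ht hx hy n1 (hst M nM), ev_one] at E
    congr 1
    linear_combination y * E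
  -- step 2 : time
  have hU : ∀ h : ℂ × ℂ → ℂ, AnalyticAt ℂ h 0 → h 0 = 0 →
      AnalyticAt ℂ (fun p => u p.1 + h p) 0 ∧ (∀ᶠ p in 𝓝 (0 : ℂ × ℂ), u p.1 + h p ≠ 0) := by
    intro h ah h0
    have hu' : AnalyticAt ℂ (fun p : ℂ × ℂ => u p.1) 0 := AnalyticAt.comp (g := u) (f := Prod.fst) (x := (0 : ℂ × ℂ)) hu analyticAt_fst
    refine ⟨hu'.add ah, ?_⟩
    exact ((hu'.add ah).continuousAt).eventually_ne (by simpa [h0] using hu0)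
  have aaΨ : AnalyticAt ℂ (fun p => ev a (Ψ p)) 0 := by
    have : AnalyticAt ℂ (ev a) (Ψ 0) := by rw [Ψ0]; exact aa
    exact this.comp aΨ
  have a00 : ev a (Ψ 0) = 0 := by rw [Ψ0]; exact ev_zero_of' ha0
  obtain ⟨b1, b2⟩ := hU _ aaΨ a00
  obtain ⟨c1, c2⟩ := hU _ aH (ev_zero_of' hH0)
  have s2 : Conj (fun p => (1 / (u p.1 + ev a (Ψ p))) • XF k μ Q p) (NF k μ u Q H) := by
    refine time_lemma (T := fun p => - ev T p) (U1 := fun p => 1 / (u p.1 + ev a (Ψ p)))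
      (U2 := fun p => 1 / (u p.1 + ev H p)) ?_ (XF_analytic aQ) (by simp [XF]) ?_ ?_ aT.neg ?_ ?_
    · exact analyticAt_const.div b1 b2.self_of_nhds
    · simp [a00, hu0]
    · filter_upwards [c2] with p hp
      exact one_div_ne_zero hp
    · simp [ev_zero_of' hT0]
    · filter_upwards [ev_near hs ht, ev_deriv hρ hr nT, aT.eventually_analyticAt] with p hp hder hTa
      obtain ⟨x, y⟩ := p
      obtain ⟨hx, hy⟩ := hp
      simp only at hx hy
      have hneg : fderiv ℂ (fun p => - ev T p) (x, y) = - fderiv ℂ (ev T) (x, y) := fderiv_fun_neg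
      rw [hneg]
      unfold XF
      simp only
      have e1 : ((x ^ (k + 1) : ℂ), y * (1 + μ * x ^ k + ev Q (x, y))) = (x * x ^ k, y * (1 + μ * x ^ k + ev Q (x, y))) := by
        rw [pow_succ']
      rw [e1]
      have hder' := hder (x ^ k) (1 + μ * x ^ k + ev Q (x, y))
      simp only at hder'
      rw [neg_apply, hder', one_div_one_div, one_div_one_div]
      have E := congrArg (fun c => ev c (x, y)) hTeq
      rw [ev_add ht hx hy (NN_LL_ne k μ (hdx T nT) (hdy T nT)) (hst H nH),
        ev_LL ht hx hy k μ (hdx T nT) (hdy T nT),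
        ev_sub ht hx hy (hcc a ea)
          (NN_mul_ne (Vt_sub s t) (hst Q nQ) (hdy T nT)),
        ev_mul ht hx hy (hst Q nQ) (hdy T nT),
        ev_ccmp ht hx hy n1M (heps a ea) (hnl a ha),
        ev_add ht hx hy n1 (hst M nM), ev_one] at E
      simp only [hΨ]
      linear_combination -E
  exact s1.trans s2


lemma mkLin {k σ : ℕ} {μ : ℂ} {δ : ℝ} (hk : 1 ≤ k) (hδ : 0 < δ)
    (hδμ : ∀ n : ℕ, 1 ≤ n → ∀ i : ℕ, σ * n < i → δ * n ≤ ‖(i : ℂ) + n * μ‖) {R : ℝ≥0} (hR : 0 < R)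
    (h2 : 2 ≤ δ * (R : ℝ) ^ k) : ∃ ρ κ : ℝ≥0, ρ * κ = R ∧ LinData k σ μ ρ κ δ := by
  set κ : ℝ≥0 := 1 + 2 * (σ + ‖μ‖₊) * R ^ k with hκ
  have hκ1 : 1 ≤ κ := by rw [hκ]; exact le_add_of_nonneg_right (by positivity)
  have hκ0 : 0 < κ := lt_of_lt_of_le one_pos hκ1
  have e : R / κ * κ = R := div_mul_cancel₀ _ hκ0.ne'
  refine ⟨R / κ, κ, e, hk, by positivity, hκ1, ?_, hδ, hδμ, ?_⟩
  · have h1 : κ ≤ κ ^ k := le_self_pow₀ hκ1 (by omega)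
    have h3 : (σ + ‖μ‖₊) * (R / κ) ^ k ≤ 1 / 2 := by
      rw [div_pow]
      calc _ ≤ (σ + ‖μ‖₊) * (R ^ k / κ) := by gcongr
        _ = ((σ + ‖μ‖₊) * R ^ k) / κ := by ring
        _ ≤ 1 / 2 := by
          rw [div_le_div_iff₀ hκ0 two_pos, hκ]
          calc _ = 2 * (σ + ‖μ‖₊) * R ^ k := by ring
            _ ≤ 1 + 2 * (σ + ‖μ‖₊) * R ^ k := le_add_of_nonneg_left (by positivity)
            _ = _ := by ring
    exact_mod_cast h3
  · have e' : ((R / κ : ℝ≥0) : ℝ) * κ = R := by exact_mod_cast e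
    rw [e']; exact h2

lemma supp_grow {k σ : ℕ} {ρ κ r : ℝ≥0} (hρ : 0 < ρ) (hκ : 1 ≤ κ) (hr : 0 < r) (R : ℝ≥0) :
    ∃ r2 : ℝ≥0, 0 < r2 ∧ ∀ Q : ℂ⟦X⟧⟦X⟧, SuppC k σ Q → NN (Wt σ ρ κ r) Q ≠ ∞ → NN (Vt R r2) Q ≠ ∞ := by
  set l : ℝ≥0 := max 1 (R / ρ) with hl
  have hl1 : 1 ≤ l := le_max_left _ _
  have hl0 : 0 < l := lt_of_lt_of_le one_pos hl1
  have hRl : R ≤ l * ρ := by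
    calc R = R / ρ * ρ := (div_mul_cancel₀ _ hρ.ne').symm
      _ ≤ _ := by gcongr; exact le_max_right _ _
  refine ⟨r / l ^ σ, by positivity, fun Q hQ hn => ?_⟩
  have hn2 : NN (Vt ρ r) Q ≠ ∞ := ne_top_of_le_ne_top hn (NN_mono Q (Vt_le_Wt σ hκ))
  refine ne_top_of_le_ne_top (ENNReal.mul_ne_top (ENNReal.coe_ne_top (r := l ^ k)) hn2) ?_
  unfold NN nn
  rw [← ENNReal.tsum_mul_left]
  refine ENNReal.tsum_le_tsum fun n => ?_
  rw [← ENNReal.tsum_mul_left]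
  refine ENNReal.tsum_le_tsum fun j => ?_
  by_cases hj : σ * n + k < j
  · rw [hQ n j (Or.inr (Or.inr hj))]; simp
  · rw [Vt_eq, Vt_eq, mul_left_comm, ← ENNReal.coe_mul]
    refine mul_le_mul_right (ENNReal.coe_le_coe.2 ?_) _
    have : l ^ σ ≠ 0 := by positivity
    calc R ^ j * (r / l ^ σ) ^ n ≤ (l * ρ) ^ j * (r / l ^ σ) ^ n := by gcongr
      _ = l ^ j * ρ ^ j * (r / l ^ σ) ^ n := by rw [mul_pow]
      _ ≤ l ^ (σ * n + k) * ρ ^ j * (r / l ^ σ) ^ n := by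
          gcongr ?_ * _ * _
          exact pow_le_pow_right₀ hl1 (by omega)
      _ = l ^ k * (ρ ^ j * (r / l ^ σ * l ^ σ) ^ n) := by
          rw [pow_add, pow_mul, mul_pow]; ring
      _ = _ := by rw [div_mul_cancel₀ _ this]

lemma suppC_zero {k σ : ℕ} {Q : ℂ⟦X⟧⟦X⟧} (h : SuppC k σ Q) : cf 0 Q = 0 := by
  ext j; rw [h 0 j (Or.inl rfl)]; simp

lemma two_stage {k σ : ℕ} {μ : ℂ} {δ : ℝ} (hk : 1 ≤ k) (hδ : 0 < δ)
    (hδμ : ∀ n : ℕ, 1 ≤ n → ∀ i : ℕ, σ * n < i → δ * n ≤ ‖(i : ℂ) + n * μ‖) {u : ℂ → ℂ}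
    (hu : AnalyticAt ℂ u 0) (hu0 : u 0 ≠ 0) {f a : ℂ⟦X⟧⟦X⟧} (hf0 : cf 0 f = 0) (ha0 : cf 0 a = 0)
    {R r0 : ℝ≥0} (hR : 0 < R) (hr0 : 0 < r0) (hf : NN (Vt R r0) f ≠ ∞) (ha : NN (Vt R r0) a ≠ ∞) :
    ∃ (Q H : ℂ⟦X⟧⟦X⟧) (s r : ℝ≥0), 0 < s ∧ 0 < r ∧ SuppC k σ Q ∧ SuppC k σ H ∧
      NN (Vt s r) Q ≠ ∞ ∧ NN (Vt s r) H ≠ ∞ ∧ Conj (NF k μ u f a) (NF k μ u Q H) := by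
  -- first stage
  obtain ⟨σ', hσ'⟩ := exists_nat_ge (‖μ‖ + 2 / (R : ℝ) ^ k)
  have hR' : (0 : ℝ) < R := hR
  have hδ' : 0 < (σ' : ℝ) - ‖μ‖ := by
    have : 0 < 2 / (R : ℝ) ^ k := by positivity
    linarith
  obtain ⟨ρ1, κ1, e1, D1⟩ := mkLin (σ := σ') (μ := μ) hk hδ' (by
    intro n hn i hi
    have h1 : ‖(i : ℂ)‖ ≤ ‖(i : ℂ) + n * μ‖ + ‖(n : ℂ) * μ‖ := by
      calc ‖(i : ℂ)‖ = ‖((i : ℂ) + n * μ) - n * μ‖ := by congr 1; ring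
        _ ≤ _ := norm_sub_le _ _
    rw [norm_mul, Complex.norm_natCast, Complex.norm_natCast] at h1
    have h2 : (σ' : ℝ) * n ≤ i := by exact_mod_cast hi.le
    linarith) hR (by
    have : 2 / (R : ℝ) ^ k ≤ σ' - ‖μ‖ := by linarith
    rwa [div_le_iff₀ (by positivity)] at this)
  subst e1
  obtain ⟨Q1, H1, r1, hr1, sQ, sH, nQ, nH, hc1⟩ := stage D1 hu hu0 hf0 ha0 hr0 hf ha
  -- second stage
  set R2 : ℝ≥0 := 1 + 2 / ⟨δ, hδ.le⟩ with hR2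
  have h2 : 2 ≤ δ * (R2 : ℝ) ^ k := by
    have e : (R2 : ℝ) = 1 + 2 / δ := by rw [hR2]; push_cast; rfl
    have h0 : 0 < 2 / δ := by positivity
    have h1 : (R2 : ℝ) ≤ (R2 : ℝ) ^ k := le_self_pow₀ (by rw [e]; linarith) (by omega)
    calc (2 : ℝ) = δ * (2 / δ) := by field_simp
      _ ≤ δ * R2 := by rw [e]; gcongr; linarith
      _ ≤ _ := by gcongr
  obtain ⟨ρ2, κ2, e2, D2⟩ := mkLin hk hδ hδμ (R := R2) (by positivity) h2
  obtain ⟨r2, hr2, hgr⟩ := supp_grow (k := k) (σ := σ') D1.hρ D1.hκ hr1 R2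
  rw [← e2] at hgr
  obtain ⟨Q, H, r, hr, sQ2, sH2, nQ2, nH2, hc2⟩ := stage D2 hu hu0 (suppC_zero sQ) (suppC_zero sH) hr2
    (hgr Q1 sQ nQ) (hgr H1 sH nH)
  exact ⟨Q, H, ρ2, r, D2.hρ, hr, sQ2, sH2, ne_top_of_le_ne_top nQ2 (NN_mono Q (Vt_le_Wt σ D2.hκ)),
    ne_top_of_le_ne_top nH2 (NN_mono H (Vt_le_Wt σ D2.hκ)), hc1.trans hc2⟩

lemma sigma_delta (μ : ℂ) : ∃ δ : ℝ, 0 < δ ∧ ∀ n : ℕ, 1 ≤ n → ∀ i : ℕ,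
    (if μ.im = 0 ∧ μ.re ≤ 0 then (⌊-μ.re⌋ + 1).toNat else 0) * n < i → δ * n ≤ ‖(i : ℂ) + n * μ‖ := by
  split_ifs with h
  · have hfl : (0 : ℤ) ≤ ⌊-μ.re⌋ + 1 := by
      have : (0 : ℤ) ≤ ⌊-μ.re⌋ := Int.floor_nonneg.2 (by linarith [h.2])
      omega
    set s := (⌊-μ.re⌋ + 1).toNat with hs
    have e : (s : ℝ) = (⌊-μ.re⌋ : ℝ) + 1 := by
      have : (s : ℤ) = ⌊-μ.re⌋ + 1 := Int.toNat_of_nonneg hfl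
      exact_mod_cast this
    refine ⟨s + μ.re, by have := Int.lt_floor_add_one (-μ.re); rw [e]; linarith, ?_⟩
    intro n hn i hi
    have h1 := Complex.re_le_norm ((i : ℂ) + n * μ)
    simp at h1
    have h2 : (s : ℝ) * n ≤ i := by exact_mod_cast hi.le
    nlinarith
  · by_cases him : μ.im = 0
    · have hre : 0 < μ.re := by
        by_contra hc; exact h ⟨him, not_lt.1 hc⟩
      refine ⟨μ.re, hre, ?_⟩
      intro n hn i hi
      have h1 := Complex.re_le_norm ((i : ℂ) + n * μ)
      simp at h1
      have : (0 : ℝ) ≤ i := Nat.cast_nonneg i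
      nlinarith
    · refine ⟨|μ.im|, abs_pos.2 him, ?_⟩
      intro n hn i hi
      have h1 := Complex.abs_im_le_norm ((i : ℂ) + n * μ)
      simp [abs_mul] at h1
      linarith


lemma ev_x0 (F : ℂ⟦X⟧⟦X⟧) (x : ℂ) : ev F (x, 0) = Ex x (cf 0 F) := by
  unfold ev
  rw [tsum_eq_single 0]
  · simp
  · intro n hn; simp [hn]

lemma to_series {f : ℂ × ℂ → ℂ} (hf : AnalyticAt ℂ f 0) (h0 : ∀ᶠ p in 𝓝 (0 : ℂ × ℂ), f (p.1, 0) = 0) :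
    ∃ (F : ℂ⟦X⟧⟦X⟧) (s : ℝ≥0), 0 < s ∧ cf 0 F = 0 ∧ NN (Vt s s) F ≠ ∞ ∧ f =ᶠ[𝓝 0] ev F := by
  obtain ⟨c, C, R, hR, hc, hs⟩ := ds_of_analyticAt hf
  set F : ℂ⟦X⟧⟦X⟧ := PowerSeries.mk fun n => PowerSeries.mk fun j => c n j with hF
  lift R to ℝ≥0 using hR.le
  have hR' : 0 < R := by exact_mod_cast hR
  have hC : 0 ≤ C := by
    have := (norm_nonneg _).trans (hc 0 0)
    simpa using this
  lift C to ℝ≥0 using hC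
  have hs0 : 0 < R / 2 := by positivity
  have nF : NN (Vt (R / 2) (R / 2)) F ≠ ∞ := by
    have hb : ∀ n, nn (Vt (R / 2) (R / 2)) n (cf n F) ≤ (C * 2⁻¹ ^ n : ℝ≥0∞) * ∑' j : ℕ, (2⁻¹ : ℝ≥0∞) ^ j := by
      intro n
      unfold nn
      rw [← ENNReal.tsum_mul_left]
      refine ENNReal.tsum_le_tsum fun j => ?_
      have h1 : ‖c n j‖₊ ≤ C / R ^ (n + j) := by exact_mod_cast hc n j
      have h2 : ‖c n j‖₊ * ((R / 2) ^ j * (R / 2) ^ n) ≤ C * (2⁻¹) ^ n * (2⁻¹) ^ j := by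
        calc _ ≤ C / R ^ (n + j) * ((R / 2) ^ j * (R / 2) ^ n) := by gcongr
          _ = _ := by rw [pow_add, div_pow, div_pow, inv_pow, inv_pow]; field_simp
      simp only [hF, PowerSeries.coeff_mk]
      rw [Vt_eq, enorm_eq_nnnorm, ← ENNReal.coe_mul]
      calc _ ≤ ((C * (2⁻¹) ^ n * (2⁻¹) ^ j : ℝ≥0) : ℝ≥0∞) := ENNReal.coe_le_coe.2 h2
        _ = _ := by push_cast; simp
    have hgeo : ∑' j : ℕ, (2⁻¹ : ℝ≥0∞) ^ j ≠ ∞ := by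
      rw [ENNReal.tsum_geometric]; simp
    refine ne_top_of_le_ne_top ?_ (ENNReal.tsum_le_tsum hb)
    rw [ENNReal.tsum_mul_right, ENNReal.tsum_mul_left]
    exact ENNReal.mul_ne_top (ENNReal.mul_ne_top ENNReal.coe_ne_top hgeo) hgeo
  have evF : ∀ x y : ℂ, ‖x‖ ≤ (R / 2 : ℝ≥0) → ‖y‖ ≤ (R / 2 : ℝ≥0) → f (x, y) = ev F (x, y) := by
    intro x y hx hy
    push_cast at hx hy
    have h1 := hs x y (by linarith) (by linarith)
    have h2 := ev_hasSum (s := R / 2) (t := R / 2) (by push_cast; exact hx) (by push_cast; exact hy) nF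
    refine h1.unique (HasSum.congr_fun' h2 ?_)
    intro q; simp [hF]
  have nC : NN (Vt (R / 2) (R / 2)) (PowerSeries.C (cf 0 F)) ≠ ∞ := by
    unfold NN
    rw [tsum_eq_single 0]
    · have := nn_ne nF 0
      rwa [PowerSeries.coeff_C, if_pos rfl]
    · intro n hn; rw [PowerSeries.coeff_C, if_neg hn, nn_zero]
  refine ⟨F - PowerSeries.C (cf 0 F), R / 2, hs0, ?_, ?_, ?_⟩
  · rw [map_sub, PowerSeries.coeff_C, if_pos rfl, sub_self]
  · exact ne_top_of_le_ne_top (ENNReal.add_ne_top.2 ⟨nF, nC⟩) (NN_sub _ _ _)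
  · filter_upwards [ev_near hs0 hs0, h0] with p hp h0
    obtain ⟨x, y⟩ := p
    obtain ⟨hx, hy⟩ := hp
    simp only at hx hy h0
    rw [ev_sub hs0 hx hy nF nC, ev_C, ← evF x y hx hy, ← ev_x0, ← evF x 0 hx (by rw [norm_zero]; positivity), h0, sub_zero]

/-- coefficient functions of a series with support in the normal-form range -/
def Rcf (σ : ℕ) (Q : ℂ⟦X⟧⟦X⟧) (m : ℕ) (w : ℂ) : ℂ := ∑' n, cf (σ * n + 1 + m) (cf n Q) * w ^ n

lemma Rcf_bound {σ : ℕ} {s r : ℝ≥0} (hs : 0 < s) (hr : 0 < r) {Q : ℂ⟦X⟧⟦X⟧} (hn : NN (Vt s r) Q ≠ ∞) (m n : ℕ)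
    {w : ℂ} (hw : w ∈ ball (0 : ℂ) (s ^ σ * r / 2)) :
    ‖cf (σ * n + 1 + m) (cf n Q) * w ^ n‖ ≤ (NN (Vt s r) Q).toReal / s ^ (1 + m) * (1 / 2) ^ n := by
  have hs' : (0 : ℝ) < s := hs
  have hr' : (0 : ℝ) < r := hr
  have h1 := cf_bound Q hn n (σ * n + 1 + m)
  rw [mem_ball_zero_iff] at hw
  rw [norm_mul, norm_pow, div_mul_eq_mul_div, le_div_iff₀ (by positivity)]
  calc _ ≤ ‖cf (σ * n + 1 + m) (cf n Q)‖ * (s ^ σ * r / 2) ^ n * s ^ (1 + m) := by gcongr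
    _ = ‖cf (σ * n + 1 + m) (cf n Q)‖ * (s ^ (σ * n + 1 + m) * r ^ n) * (1 / 2) ^ n := by
      rw [div_eq_mul_one_div, mul_pow, mul_pow, ← pow_mul, add_assoc, pow_add _ (σ * n)]; ring
    _ ≤ _ := by gcongr

lemma half_summ (K : ℝ) : Summable fun n : ℕ => K * (1 / 2 : ℝ) ^ n :=
  (summable_geometric_of_lt_one (by norm_num) (by norm_num)).mul_left K

lemma Rcf_diff {σ : ℕ} {s r : ℝ≥0} (hs : 0 < s) (hr : 0 < r) {Q : ℂ⟦X⟧⟦X⟧} (hn : NN (Vt s r) Q ≠ ∞) (m : ℕ) :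
    DifferentiableOn ℂ (Rcf σ Q m) (ball (0 : ℂ) (s ^ σ * r / 2)) := by
  unfold Rcf
  exact Complex.differentiableOn_tsum_of_summable_norm (half_summ _)
    (fun n => by fun_prop) isOpen_ball (fun n w hw => Rcf_bound hs hr hn m n hw)

lemma Rcf_zero {k σ : ℕ} {Q : ℂ⟦X⟧⟦X⟧} (h : SuppC k σ Q) (m : ℕ) : Rcf σ Q m 0 = 0 := by
  unfold Rcf
  rw [tsum_eq_single 0]
  · simp [suppC_zero h]
  · intro n hn; simp [hn]

lemma ev_supp {k σ : ℕ} {s r : ℝ≥0} (hs : 0 < s) (hr : 0 < r) {Q : ℂ⟦X⟧⟦X⟧} (h : SuppC k σ Q)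
    (hn : NN (Vt s r) Q ≠ ∞) {x y : ℂ} (hxy : x ^ σ * y ∈ ball (0 : ℂ) (s ^ σ * r / 2)) :
    ev Q (x, y) = x * ∑ i : Fin k, Rcf σ Q i (x ^ σ * y) * x ^ (i : ℕ) := by
  have hE : ∀ n, Ex x (cf n Q) * y ^ n =
      ∑ i ∈ Finset.range k, cf (σ * n + 1 + i) (cf n Q) * (x ^ σ * y) ^ n * x ^ (i + 1) := by
    intro n
    unfold Ex
    rw [tsum_eq_sum (s := Finset.Ico (σ * n + 1) (σ * n + 1 + k)), Finset.sum_Ico_eq_sum_range, Finset.sum_mul,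
      Nat.add_sub_cancel_left]
    · refine Finset.sum_congr rfl fun i _ => ?_
      rw [mul_pow, ← pow_mul, add_assoc, pow_add _ (σ * n)]; ring
    · intro j hj
      rw [h n j (by rw [Finset.mem_Ico] at hj; omega), zero_mul]
  have hsum : ∀ i, Summable fun n => cf (σ * n + 1 + i) (cf n Q) * (x ^ σ * y) ^ n := fun i =>
    Summable.of_norm_bounded (half_summ _) (fun n => Rcf_bound hs hr hn i n hxy)
  unfold ev
  simp only [hE]
  rw [Summable.tsum_finsetSum fun i _ => (hsum i).mul_right _, Finset.mul_sum, Finset.sum_range]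
  refine Finset.sum_congr rfl fun i _ => ?_
  rw [tsum_mul_right]
  unfold Rcf
  ring

/-- The prenormalised vector field -/
def PF (k : ℕ) (μ : ℂ) (P : Polynomial ℂ) (f a : ℂ × ℂ → ℂ) (p : ℂ × ℂ) : ℂ × ℂ :=
  (1 / (1 / P.eval p.1 + a p)) • ((p.1 ^ (k + 1) : ℂ), p.2 * (1 + μ * p.1 ^ k + f p))

lemma assembly {Z : ℂ × ℂ → ℂ × ℂ} {k : ℕ} (hk : 1 ≤ k) {μ : ℂ} {P : Polynomial ℂ} (hP0 : P.eval 0 ≠ 0)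
    {f a : ℂ × ℂ → ℂ} (hf : AnalyticAt ℂ f 0) (ha : AnalyticAt ℂ a 0)
    (hf0 : ∀ᶠ p in 𝓝 (0 : ℂ × ℂ), f (p.1, 0) = 0) (ha0 : ∀ᶠ p in 𝓝 (0 : ℂ × ℂ), a (p.1, 0) = 0)
    (hZ : Conj Z (PF k μ P f a)) :
    ∃ σ : ℕ,
      σ = (if μ.im = 0 ∧ μ.re ≤ 0 then (⌊-μ.re⌋ + 1).toNat else 0) ∧
    ∃ b : ℝ, 0 < b ∧
    ∃ Gc Rc : Fin k → ℂ → ℂ,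
      (∀ i : Fin k, DifferentiableOn ℂ (Gc i) (ball (0:ℂ) b) ∧
        DifferentiableOn ℂ (Rc i) (ball (0:ℂ) b) ∧ Gc i 0 = 0 ∧ Rc i 0 = 0) ∧
    ∃ Ψ : ℂ × ℂ → ℂ × ℂ,
      Ψ 0 = 0 ∧
      (∃ U ∈ 𝓝 (0 : ℂ × ℂ), DifferentiableOn ℂ Ψ U) ∧
      (∃ e : (ℂ × ℂ) ≃L[ℂ] (ℂ × ℂ), (e : (ℂ × ℂ) →L[ℂ] (ℂ × ℂ)) = fderiv ℂ Ψ 0) ∧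
      ∀ᶠ p in 𝓝 (0 : ℂ × ℂ),
        fderiv ℂ Ψ p
            ((Polynomial.eval p.1 P /
                (1 + p.1 * Polynomial.eval p.1 P *
                  (∑ i : Fin k, Gc i (p.1 ^ σ * p.2) * p.1 ^ (i : ℕ)))) •
              ((p.1 ^ (k+1) : ℂ),
                p.2 * (1 + μ * p.1 ^ k +
                  p.1 * (∑ i : Fin k, Rc i (p.1 ^ σ * p.2) * p.1 ^ (i : ℕ))))) =
          Z (Ψ p) := by
  obtain ⟨F, s1, hs1, F0, nF, eF⟩ := to_series hf hf0
  obtain ⟨A, s2, hs2, A0, nA, eA⟩ := to_series ha ha0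
  obtain ⟨δ, hδ, hδμ⟩ := sigma_delta μ
  set σ : ℕ := (if μ.im = 0 ∧ μ.re ≤ 0 then (⌊-μ.re⌋ + 1).toNat else 0) with hσ
  have hu : AnalyticAt ℂ (fun x : ℂ => 1 / P.eval x) 0 :=
    analyticAt_const.div (by
      have : AnalyticOnNhd ℂ (fun x => Polynomial.eval x P) univ := AnalyticOnNhd.eval_polynomial P
      exact this 0 (mem_univ _)) hP0
  have hm : 0 < min s1 s2 := lt_min hs1 hs2
  obtain ⟨Q, H, s, r, hs, hr, sQ, sH, nQ, nH, hconj⟩ := two_stage hk hδ hδμ hu (by simpa using hP0) F0 A0 hm hm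
    (ne_top_of_le_ne_top nF (NN_mono F (Vt_mono (min_le_left _ _) (min_le_left _ _))))
    (ne_top_of_le_ne_top nA (NN_mono A (Vt_mono (min_le_right _ _) (min_le_right _ _))))
  have hZ1 : Conj Z (NF k μ (fun x : ℂ => 1 / P.eval x) F A) := by
    refine hZ.congr_right ?_
    filter_upwards [eF, eA] with p h1 h2
    unfold NF PF XF
    rw [h1, h2]
  obtain ⟨Ψ, aΨ, Ψ0, he, hc⟩ := hZ1.trans hconj
  refine ⟨σ, rfl, s ^ σ * r / 2, by positivity, fun i => Rcf σ H i, fun i => Rcf σ Q i, ?_, Ψ, Ψ0, ?_, he, ?_⟩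
  · intro i
    exact ⟨Rcf_diff hs hr nH i, Rcf_diff hs hr nQ i, Rcf_zero sH i, Rcf_zero sQ i⟩
  · exact ⟨{p | AnalyticAt ℂ Ψ p}, aΨ.eventually_analyticAt, fun p hp =>
      AnalyticAt.differentiableWithinAt hp⟩
  · have c1 : ContinuousAt (fun p : ℂ × ℂ => P.eval p.1) 0 := by
      apply Continuous.continuousAt
      exact P.continuous.comp continuous_fst
    have e1 := c1.eventually_ne (y := 0) (by simpa using hP0)
    have c2 : ∀ᶠ p in 𝓝 (0 : ℂ × ℂ), ‖p.1‖ ≤ s ∧ ‖p.2‖ ≤ (r / 4 : ℝ≥0) := ev_near hs (by positivity)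
    filter_upwards [hc, e1, c2] with p hc hP hp
    rw [← hc]
    obtain ⟨x, y⟩ := p
    obtain ⟨hx, hy⟩ := hp
    simp only at hx hy hP ⊢
    have hs' : (0 : ℝ) < s := hs
    have hr' : (0 : ℝ) < r := hr
    have hin : x ^ σ * y ∈ ball (0 : ℂ) (s ^ σ * r / 2) := by
      rw [mem_ball_zero_iff, norm_mul, norm_pow]
      push_cast at hy
      have : ‖x‖ ^ σ * ‖y‖ ≤ s ^ σ * (r / 4) := by gcongr
      have h2 : 0 < (s : ℝ) ^ σ * r := by positivity
      linarith
    congr 1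
    unfold NF XF
    simp only
    rw [ev_supp hs hr sH nH hin, ev_supp hs hr sQ nQ hin]
    congr 1
    have : 1 / P.eval x + x * ∑ i : Fin k, Rcf σ H i (x ^ σ * y) * x ^ (i : ℕ) =
      (1 + x * P.eval x * ∑ i : Fin k, Rcf σ H i (x ^ σ * y) * x ^ (i : ℕ)) / P.eval x := by
      field_simp
    rw [this, one_div_div]

lemma div1 {s : ℂ → ℂ} (hs : AnalyticAt ℂ s 0) : ∃ s1, AnalyticAt ℂ s1 0 ∧ ∀ᶠ x in 𝓝 (0 : ℂ), s x = s 0 + x * s1 x := by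
  obtain ⟨p, hp⟩ := hs
  refine ⟨dslope s 0, ⟨_, hp.has_fpower_series_dslope_fslope⟩, Eventually.of_forall fun x => ?_⟩
  have := sub_smul_dslope s 0 x
  simp only [sub_zero, smul_eq_mul] at this
  rw [this]; ring

lemma taylor1 (n : ℕ) : ∀ {s : ℂ → ℂ}, AnalyticAt ℂ s 0 → ∃ (P : Polynomial ℂ) (r : ℂ → ℂ), P.natDegree ≤ n ∧ AnalyticAt ℂ r 0 ∧
    ∀ᶠ x in 𝓝 (0 : ℂ), s x = P.eval x + x ^ (n + 1) * r x := by
  induction n with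
  | zero =>
    intro s hs
    obtain ⟨s1, h1, h2⟩ := div1 hs
    refine ⟨Polynomial.C (s 0), s1, by simp, h1, ?_⟩
    filter_upwards [h2] with x hx
    rw [hx]; simp
  | succ n ih =>
    intro s hs
    obtain ⟨s1, h1, h2⟩ := div1 hs
    obtain ⟨P, r, hP, hr, h3⟩ := ih h1
    refine ⟨Polynomial.C (s 0) + Polynomial.X * P, r, ?_, hr, ?_⟩
    · refine Polynomial.natDegree_add_le_of_degree_le (by simp) ?_
      refine (Polynomial.natDegree_mul_le).trans ?_
      simp only [Polynomial.natDegree_X]; omega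
    · filter_upwards [h2, h3] with x h2 h3
      rw [h2, h3]; simp; ring

lemma prim1 {r : ℂ → ℂ} (hr : AnalyticAt ℂ r 0) : ∃ H : ℂ → ℂ, AnalyticAt ℂ H 0 ∧ H 0 = 0 ∧
    ∀ᶠ x in 𝓝 (0 : ℂ), HasDerivAt H (r x) x := by
  obtain ⟨ρ, hρ, h⟩ := Metric.eventually_nhds_iff_ball.1 hr.eventually_analyticAt
  have hd : DifferentiableOn ℂ r (ball 0 ρ) := fun x hx => (h x hx).differentiableAt.differentiableWithinAt
  obtain ⟨G, hG⟩ := hd.isExactOn_ball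
  have h0 : ∀ᶠ x in 𝓝 (0 : ℂ), HasDerivAt (fun x => G x - G 0) (r x) x := by
    filter_upwards [ball_mem_nhds 0 hρ] with x hx
    exact (hG x hx).sub_const _
  refine ⟨fun x => G x - G 0, ?_, by simp, h0⟩
  rw [Complex.analyticAt_iff_eventually_differentiableAt]
  exact h0.mono fun x hx => hx.differentiableAt

lemma N_exists {k : ℕ} (hk : 1 ≤ k) {v : ℂ → ℂ} (hv : AnalyticAt ℂ v 0) : ∃ (μ : ℂ) (N : ℂ → ℂ), AnalyticAt ℂ N 0 ∧ N 0 = v 0 ∧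
    ∀ᶠ x in 𝓝 (0 : ℂ), HasDerivAt N (deriv N x) x ∧ x * deriv N x = k * (N x - v x + μ * x ^ k) := by
  obtain ⟨P, r, hP, hr, h⟩ := taylor1 k hv
  obtain ⟨H, hH, H0, hH'⟩ := prim1 hr
  have kne : (k : ℂ) ≠ 0 := by exact_mod_cast (by omega : k ≠ 0)
  set N : ℂ → ℂ := fun x => ∑ j ∈ Finset.range k, P.coeff j * (k / (k - j)) * x ^ j - k * x ^ k * H x with hN
  have aN : AnalyticAt ℂ N 0 := by
    apply AnalyticAt.sub
    · exact (Differentiable.analyticAt (by fun_prop) 0)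
    · exact (Differentiable.analyticAt (by fun_prop) 0).mul hH
  refine ⟨P.coeff k, N, aN, ?_, ?_⟩
  · simp only [hN]
    have := h.self_of_nhds
    simp only [ne_eq, Nat.add_eq_zero_iff, one_ne_zero, and_false, not_false_eq_true, zero_pow, zero_mul, add_zero] at this
    rw [this, ← Polynomial.coeff_zero_eq_eval_zero]
    rw [Finset.sum_eq_single_of_mem 0 (by simp; omega)]
    · simp [H0, kne]
    · intro b _ hb; simp [hb]
  · filter_upwards [h, hH', aN.eventually_analyticAt] with x h hH' ax
    refine ⟨ax.differentiableAt.hasDerivAt, ?_⟩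
    have d1 : HasDerivAt N (∑ j ∈ Finset.range k, P.coeff j * (k / (k - j)) * (j * x ^ (j - 1)) -
        (k * (k * x ^ (k - 1)) * H x + k * x ^ k * r x)) x := by
      apply HasDerivAt.sub
      · exact HasDerivAt.fun_sum fun j _ => (hasDerivAt_pow j x).const_mul _
      · exact ((hasDerivAt_pow k x).const_mul (k : ℂ)).mul hH'
    rw [d1.deriv, h, Polynomial.eval_eq_sum_range' (n := k + 1) (by omega), Finset.sum_range_succ, hN]
    have e1 : ∀ j : ℕ, x * (j * x ^ (j - 1)) = j * x ^ j := by
      intro j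
      rcases j with _ | j
      · simp
      · simp [pow_succ]; ring
    have e2 : x * (∑ j ∈ Finset.range k, P.coeff j * (k / (k - j)) * (j * x ^ (j - 1))) =
      k * (∑ j ∈ Finset.range k, P.coeff j * (k / (k - j)) * x ^ j - ∑ j ∈ Finset.range k, P.coeff j * x ^ j) := by
      rw [← Finset.sum_sub_distrib, Finset.mul_sum, Finset.mul_sum]
      refine Finset.sum_congr rfl fun j hj => ?_
      have : (k : ℂ) - j ≠ 0 := by
        rw [sub_ne_zero]; exact_mod_cast (Finset.mem_range.1 hj).ne'
      rw [mul_left_comm, e1]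
      field_simp
      ring
    have e3 := e1 k
    rw [mul_sub, e2]
    linear_combination (- k * H x) * e3

lemma ift1 {Φ : ℂ × ℂ → ℂ} (hΦ : AnalyticAt ℂ Φ 0) (h0 : Φ 0 = 0) {d : ℂ} (hd : HasDerivAt (fun z => Φ (0, z)) d 0) (hd0 : d ≠ 0) :
    ∃ z : ℂ → ℂ, AnalyticAt ℂ z 0 ∧ z 0 = 0 ∧ ∀ᶠ x in 𝓝 (0 : ℂ), Φ (x, z x) = 0 := by
  have cd : ContDiffAt ℂ ⊤ Φ 0 := hΦ.contDiffAt
  have if2 : (fderiv ℂ Φ 0 ∘L .inr ℂ ℂ ℂ).IsInvertible := by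
    have h1 : HasDerivAt (fun z => Φ (0, z)) ((fderiv ℂ Φ 0 ∘L .inr ℂ ℂ ℂ) 1) 0 := by
      have h2 : HasFDerivAt (fun z : ℂ => ((0 : ℂ), z)) (ContinuousLinearMap.inr ℂ ℂ ℂ) 0 := hasFDerivAt_prodMk_right 0 0
      have h3 : HasFDerivAt Φ (fderiv ℂ Φ 0) ((0 : ℂ), (0 : ℂ)) := hΦ.differentiableAt.hasFDerivAt
      exact (h3.comp (0 : ℂ) h2).hasDerivAt
    have h2 := h1.unique hd
    refine ⟨ContinuousLinearEquiv.unitsEquivAut ℂ (Units.mk0 d hd0), ?_⟩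
    ext
    rw [h2]; simp
  have pn : (⊤ : WithTop ℕ∞) ≠ 0 := by simp
  refine ⟨cd.implicitFunction pn if2, ?_, cd.implicitFunction_apply_self pn if2, ?_⟩
  · have := cd.contDiffAt_implicitFunction pn if2
    exact this.analyticAt
  · have := cd.eventually_apply_implicitFunction pn if2
    rw [h0] at this
    exact this

lemma psi_exists {k : ℕ} (hk : 1 ≤ k) {v : ℂ → ℂ} (hv : AnalyticAt ℂ v 0) (v0 : v 0 ≠ 0) :
    ∃ (μ : ℂ) (ψ : ℂ → ℂ), AnalyticAt ℂ ψ 0 ∧ ψ 0 = 0 ∧ deriv ψ 0 ≠ 0 ∧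
    ∀ᶠ x in 𝓝 (0 : ℂ), x ^ (k + 1) * v (ψ x) * deriv ψ x = ψ x ^ (k + 1) * (1 + μ * x ^ k) := by
  obtain ⟨μ, N, aN, N0, hN⟩ := N_exists hk hv
  have kne : (k : ℂ) ≠ 0 := by exact_mod_cast (by omega : k ≠ 0)
  obtain ⟨w, hw⟩ := IsAlgClosed.exists_pow_nat_eq (v 0) (n := k) (by omega)
  have w0 : w ≠ 0 := by
    rintro rfl; rw [zero_pow (by omega)] at hw; exact v0 hw.symm
  set Φ : ℂ × ℂ → ℂ := fun p => N (p.1 * (w * exp p.2)) * (exp (-(k * p.2)) / v 0) - k * μ * p.1 ^ k * p.2 - 1 with hΦ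
  have aΦ : AnalyticAt ℂ Φ 0 := by
    have a1 : AnalyticAt ℂ (fun p : ℂ × ℂ => p.1 * (w * exp p.2)) 0 :=
      analyticAt_fst.mul (analyticAt_const.mul analyticAt_snd.cexp)
    have a2 : AnalyticAt ℂ (fun p : ℂ × ℂ => N (p.1 * (w * exp p.2))) 0 :=
      AnalyticAt.comp (g := N) (f := fun p : ℂ × ℂ => p.1 * (w * exp p.2)) (by simpa using aN) a1
    have a3 : AnalyticAt ℂ (fun p : ℂ × ℂ => exp (-(k * p.2)) / v 0) 0 :=
      ((analyticAt_const.mul analyticAt_snd).neg.cexp).div analyticAt_const v0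
    have a4 : AnalyticAt ℂ (fun p : ℂ × ℂ => k * μ * p.1 ^ k * p.2) 0 :=
      (analyticAt_const.mul (analyticAt_fst.pow k)).mul analyticAt_snd
    exact ((a2.mul a3).sub a4).sub analyticAt_const
  obtain ⟨z, az, z0, hz⟩ := ift1 (d := -k) aΦ (by simp [hΦ, N0, v0]) (by
    have : (fun z => Φ (0, z)) = fun z => exp (-(k * z)) - 1 := by
      ext z
      simp only [hΦ, zero_mul, N0, zero_pow (show k ≠ 0 by omega), mul_zero, sub_zero]
      field_simp
    rw [this]
    have h1 : HasDerivAt (fun z : ℂ => -(k * z)) (-(k * 1)) 0 := ((hasDerivAt_id (0 : ℂ)).const_mul (k : ℂ)).neg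
    simpa using (h1.cexp).sub_const 1) (neg_ne_zero.2 kne)
  set ψ : ℂ → ℂ := fun x => x * (w * exp (z x)) with hψ
  have dψ : ∀ x, DifferentiableAt ℂ z x → HasDerivAt ψ (1 * (w * exp (z x)) + x * (w * (exp (z x) * deriv z x))) x := by
    intro x hx
    exact (hasDerivAt_id x).mul ((hx.hasDerivAt.cexp).const_mul w)
  have aψ : AnalyticAt ℂ ψ 0 := analyticAt_id.mul (analyticAt_const.mul az.cexp)
  refine ⟨μ, ψ, aψ, by simp [hψ], ?_, ?_⟩
  · rw [(dψ 0 az.differentiableAt).deriv]; simp [z0, w0]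
  · have tψ : Tendsto ψ (𝓝 0) (𝓝 0) := by
      have := aψ.continuousAt.tendsto
      simpa [hψ] using this
    filter_upwards [az.eventually_analyticAt, hz.eventually_nhds, tψ.eventually hN] with x ax hz hN
    obtain ⟨hN1, hN2⟩ := hN
    have hz' := ax.differentiableAt.hasDerivAt
    have hd := dψ x ax.differentiableAt
    have hE : HasDerivAt (fun x => exp (-(k * z x)) / v 0) (exp (-(k * z x)) * (-(k * deriv z x)) / v 0) x :=
      ((hz'.const_mul (k : ℂ)).neg.cexp).div_const _
    have hA : HasDerivAt (fun x => N (ψ x) * (exp (-(k * z x)) / v 0) - k * μ * x ^ k * z x)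
      ((deriv N (ψ x) * (1 * (w * exp (z x)) + x * (w * (exp (z x) * deriv z x)))) * (exp (-(k * z x)) / v 0) +
        N (ψ x) * (exp (-(k * z x)) * (-(k * deriv z x)) / v 0) -
        (k * μ * (k * x ^ (k - 1)) * z x + k * μ * x ^ k * deriv z x)) x :=
      ((hN1.comp x hd).mul hE).sub (((hasDerivAt_pow k x).const_mul (k * μ)).mul hz')
    have hconst : (fun x => N (ψ x) * (exp (-(k * z x)) / v 0) - k * μ * x ^ k * z x) =ᶠ[𝓝 x] fun _ => 1 := by
      filter_upwards [hz] with t ht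
      simp only [hΦ] at ht
      simp only [hψ]
      linear_combination ht
    have e0 := (hA.congr_of_eventuallyEq hconst.symm).unique (hasDerivAt_const x (1 : ℂ))
    have e1 := hconst.self_of_nhds
    simp only at e1
    have e2 : x * (k * x ^ (k - 1)) = (k : ℂ) * x ^ k := by
      obtain ⟨m, rfl⟩ : ∃ m, k = m + 1 := ⟨k - 1, by omega⟩
      simp [pow_succ]; ring
    have hψx : ψ x = x * (w * exp (z x)) := rfl
    set E := exp (-(k * z x)) / v 0 with hEdef
    have hEE : E * (w * exp (z x)) ^ k = 1 := by
      rw [mul_pow, hw, hEdef, ← exp_nat_mul, exp_neg]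
      have := exp_ne_zero (k * z x)
      field_simp
    have e3 : E * ψ x ^ k = x ^ k := by
      rw [hψx, mul_pow, mul_left_comm, hEE, mul_one]
    have hdE : exp (-(k * z x)) * (-(k * deriv z x)) / v 0 = - k * deriv z x * E := by
      rw [hEdef]; ring
    rw [hdE] at e0
    have key : E * v (ψ x) * (1 + x * deriv z x) = 1 + μ * x ^ k := by
      apply mul_left_cancel₀ kne
      clear_value E ψ
      linear_combination (-x) * e0 + (1 + x * deriv z x) * E * hN2 + k * μ * (1 + x * deriv z x) * e3 + k * e1 -
        k * μ * z x * e2 - deriv N (ψ x) * (1 + x * deriv z x) * E * hψx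
    rw [hd.deriv]
    have : x ^ (k + 1) * v (ψ x) * (1 * (w * exp (z x)) + x * (w * (exp (z x) * deriv z x))) =
      ψ x * (x ^ k * (v (ψ x) * (1 + x * deriv z x))) := by
      rw [hψx]; ring
    rw [this]
    clear_value E ψ
    linear_combination ψ x ^ (k + 1) * key - ψ x * v (ψ x) * (1 + x * deriv z x) * e3

lemma equiv_of_inj {L : ℂ × ℂ →L[ℂ] ℂ × ℂ} (h : ∀ v, L v = 0 → v = 0) : ∃ e : (ℂ × ℂ) ≃L[ℂ] (ℂ × ℂ), (e : (ℂ × ℂ) →L[ℂ] (ℂ × ℂ)) = L := by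
  have hi : Function.Injective (L : ℂ × ℂ →ₗ[ℂ] ℂ × ℂ) := by
    rw [injective_iff_map_eq_zero]; exact h
  refine ⟨(LinearEquiv.ofInjectiveEndo _ hi).toContinuousLinearEquiv, ?_⟩
  ext <;> rfl

lemma an_line {f : ℂ × ℂ → ℂ} (hf : AnalyticAt ℂ f 0) : AnalyticAt ℂ (fun x : ℂ => f (x, 0)) 0 :=
  AnalyticAt.comp (g := f) (f := fun x : ℂ => (x, (0 : ℂ))) hf (analyticAt_id.prod analyticAt_const)

lemma an_fst {s : ℂ → ℂ} (hs : AnalyticAt ℂ s 0) : AnalyticAt ℂ (fun p : ℂ × ℂ => s p.1) 0 :=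
  AnalyticAt.comp (g := s) (f := fun p : ℂ × ℂ => p.1) hs analyticAt_fst

lemma ev_fst {q : ℂ → Prop} (h : ∀ᶠ x in 𝓝 (0 : ℂ), q x) : ∀ᶠ p in 𝓝 (0 : ℂ × ℂ), q p.1 :=
  (continuous_fst.tendsto (0 : ℂ × ℂ)).eventually h

lemma step_D {k : ℕ} {μ : ℂ} {U f : ℂ × ℂ → ℂ} (hU : AnalyticAt ℂ U 0) (U0 : U 0 ≠ 0) (hf : AnalyticAt ℂ f 0) :
    ∃ (P : Polynomial ℂ) (a : ℂ × ℂ → ℂ), P.natDegree ≤ k ∧ P.eval 0 ≠ 0 ∧ AnalyticAt ℂ a 0 ∧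
      (∀ᶠ p in 𝓝 (0 : ℂ × ℂ), a (p.1, 0) = 0) ∧
      Conj (fun p => U p • ((p.1 ^ (k + 1) : ℂ), p.2 * (1 + μ * p.1 ^ k + f p))) (PF k μ P f a) := by
  set s : ℂ → ℂ := fun x => U (x, 0) with hs
  have as : AnalyticAt ℂ s 0 := an_line hU
  obtain ⟨P, r, hP, hr, hsP⟩ := taylor1 k as
  have hP0 : P.eval 0 = U 0 := by
    have := hsP.self_of_nhds
    simp [hs] at this
    rw [← this]; rfl
  have P0 : P.eval 0 ≠ 0 := by rwa [hP0]
  have aP : AnalyticAt ℂ (fun x => P.eval x) 0 := by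
    have : AnalyticOnNhd ℂ (fun x => Polynomial.eval x P) univ := AnalyticOnNhd.eval_polynomial P
    exact this 0 (mem_univ _)
  obtain ⟨T, aT, T0, hT⟩ := prim1 (r := fun x => r x / (s x * P.eval x)) (hr.div (as.mul aP) (mul_ne_zero U0 P0))
  set a : ℂ × ℂ → ℂ := fun p => 1 / U p - 1 / s p.1 with ha
  have aa : AnalyticAt ℂ a 0 := by
    have h1 : AnalyticAt ℂ (fun p => 1 / U p) 0 := analyticAt_const.div hU U0
    have h2 : AnalyticAt ℂ (fun p : ℂ × ℂ => 1 / s p.1) 0 := analyticAt_const.div (an_fst as) U0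
    exact h1.sub h2
  refine ⟨P, a, hP, P0, aa, Eventually.of_forall fun p => by simp [ha, hs], ?_⟩
  have aX : AnalyticAt ℂ (fun p : ℂ × ℂ => ((p.1 ^ (k + 1) : ℂ), p.2 * (1 + μ * p.1 ^ k + f p))) 0 := by
    refine (analyticAt_fst.pow _).prod (analyticAt_snd.mul ?_)
    exact (analyticAt_const.add (analyticAt_const.mul (analyticAt_fst.pow _))).add hf
  have cden : AnalyticAt ℂ (fun p : ℂ × ℂ => 1 / P.eval p.1 + a p) 0 :=
    (analyticAt_const.div (an_fst aP) P0).add aa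
  have a00 : a 0 = 0 := sub_self (1 / U 0)
  have hden := cden.continuousAt.eventually_ne (y := 0) (by simp [a00, P0])
  refine time_lemma (T := fun p => T p.1) hU aX (by simp) U0 ?_ (an_fst aT) (by simpa using T0) ?_
  · filter_upwards [hden] with p hp
    exact one_div_ne_zero hp
  · filter_upwards [ev_fst hT, ev_fst hsP, ev_fst (as.continuousAt.eventually_ne U0), ev_fst (aP.continuousAt.eventually_ne P0)] with p h1 h2 h3 h4
    have h5 : HasFDerivAt (fun p : ℂ × ℂ => T p.1) _ p := h1.hasFDerivAt.comp p hasFDerivAt_fst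
    rw [h5.fderiv, one_div_one_div]
    simp only [ContinuousLinearMap.comp_apply, ContinuousLinearMap.coe_fst', ContinuousLinearMap.toSpanSingleton_apply, smul_eq_mul, ha]
    have h2' : p.1 ^ (k + 1) * r p.1 = s p.1 - P.eval p.1 := by rw [h2]; ring
    rw [mul_div_assoc', h2']
    field_simp
    ring

lemma step_C {k : ℕ} (hk : 1 ≤ k) {U V : ℂ × ℂ → ℂ} (hU : AnalyticAt ℂ U 0) (U0 : U 0 ≠ 0) (hV : AnalyticAt ℂ V 0) (V0 : V 0 ≠ 0) :
    ∃ (μ : ℂ) (U' f : ℂ × ℂ → ℂ), AnalyticAt ℂ U' 0 ∧ U' 0 ≠ 0 ∧ AnalyticAt ℂ f 0 ∧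
      (∀ᶠ p in 𝓝 (0 : ℂ × ℂ), f (p.1, 0) = 0) ∧
      Conj (fun p => U p • ((p.1 ^ (k + 1) : ℂ), p.2 * V p))
        (fun p => U' p • ((p.1 ^ (k + 1) : ℂ), p.2 * (1 + μ * p.1 ^ k + f p))) := by
  have kne : k ≠ 0 := by omega
  set v : ℂ → ℂ := fun x => V (x, 0) with hv
  have av : AnalyticAt ℂ v 0 := an_line hV
  have v0 : v 0 ≠ 0 := V0
  obtain ⟨μ, ψ, aψ, ψ0, dψ0, hψ⟩ := psi_exists hk av v0
  set Ψ : ℂ × ℂ → ℂ × ℂ := fun p => (ψ p.1, p.2) with hΨ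
  have Ψ0 : Ψ 0 = 0 := by simp [hΨ, ψ0]
  have aΨ : AnalyticAt ℂ Ψ 0 := (an_fst aψ).prod analyticAt_snd
  have dΨ : ∀ p : ℂ × ℂ, DifferentiableAt ℂ ψ p.1 → ∀ v, fderiv ℂ Ψ p v = (deriv ψ p.1 * v.1, v.2) := by
    intro p hp v
    have h1 : HasFDerivAt (fun p : ℂ × ℂ => ψ p.1) _ p := hp.hasDerivAt.hasFDerivAt.comp p hasFDerivAt_fst
    have h2 : HasFDerivAt Ψ _ p := h1.prodMk hasFDerivAt_snd
    rw [h2.fderiv]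
    simp [mul_comm]
  have aUΨ : AnalyticAt ℂ (fun p => U (Ψ p)) 0 := AnalyticAt.comp (g := U) (f := Ψ) (by rwa [Ψ0]) aΨ
  have aVΨ : AnalyticAt ℂ (fun p => V (Ψ p)) 0 := AnalyticAt.comp (g := V) (f := Ψ) (by rwa [Ψ0]) aΨ
  have avψ1 : AnalyticAt ℂ (fun x => v (ψ x)) 0 := AnalyticAt.comp (g := v) (f := ψ) (by rwa [ψ0]) aψ
  have avψ : AnalyticAt ℂ (fun p : ℂ × ℂ => v (ψ p.1)) 0 := an_fst avψ1
  have aden : AnalyticAt ℂ (fun p : ℂ × ℂ => 1 + μ * p.1 ^ k) 0 :=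
    analyticAt_const.add (analyticAt_const.mul (analyticAt_fst.pow _))
  have den0 : (fun p : ℂ × ℂ => 1 + μ * p.1 ^ k) 0 ≠ 0 := by simp [kne]
  have vψ0 : (fun p : ℂ × ℂ => v (ψ p.1)) 0 ≠ 0 := by simpa [ψ0] using v0
  refine ⟨μ, fun p => U (Ψ p) * v (ψ p.1) / (1 + μ * p.1 ^ k), fun p => (1 + μ * p.1 ^ k) * (V (Ψ p) / v (ψ p.1) - 1),
    (aUΨ.mul avψ).div aden den0, ?_, aden.mul ((aVΨ.div avψ vψ0).sub analyticAt_const), ?_, Ψ, aΨ, Ψ0, ?_, ?_⟩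
  · exact div_ne_zero (mul_ne_zero (by rwa [Ψ0]) vψ0) den0
  · filter_upwards [avψ.continuousAt.eventually_ne vψ0] with p hp
    simp only [hΨ]
    rw [show V (ψ p.1, 0) = v (ψ p.1) from rfl, div_self hp]; simp
  · apply equiv_of_inj
    intro w hw
    rw [dΨ 0 aψ.differentiableAt] at hw
    simp only [Prod.fst_zero, Prod.mk_eq_zero, mul_eq_zero, dψ0, false_or] at hw
    exact Prod.ext hw.1 hw.2
  · have hdψ : ContinuousAt (deriv ψ) 0 := aψ.deriv.continuousAt
    filter_upwards [ev_fst hψ, ev_fst (hdψ.eventually_ne dψ0), ev_fst aψ.eventually_analyticAt,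
      avψ.continuousAt.eventually_ne vψ0, aden.continuousAt.eventually_ne den0] with p h1 h2 h3 h4 h5
    rw [dΨ p h3.differentiableAt]
    simp only [Prod.smul_mk, smul_eq_mul]
    refine Prod.ext ?_ ?_
    · simp only [hΨ]
      field_simp
      linear_combination U (ψ p.1, p.2) * h1
    · simp only [hΨ]
      field_simp
      ring

lemma an_comp {E : Type*} [NormedAddCommGroup E] [NormedSpace ℂ E] {g : ℂ × ℂ → ℂ} {f : E → ℂ × ℂ} {q : E} (hg : AnalyticAt ℂ g 0)
    (hf : AnalyticAt ℂ f q) (h : f q = 0) : AnalyticAt ℂ (fun x => g (f x)) q :=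
  AnalyticAt.comp (g := g) (f := f) (by rwa [h]) hf

lemma div_at {f f1 : ℂ × ℂ → ℂ} (hf : AnalyticAt ℂ f 0) (h1 : AnalyticAt ℂ f1 0) (h : ∀ᶠ p in 𝓝 (0 : ℂ × ℂ), f p = f (p.1, 0) + p.2 * f1 p) :
    f1 0 = fderiv ℂ f 0 (0, 1) := by
  have l : HasDerivAt (fun t : ℂ => ((0 : ℂ), t)) ((0 : ℂ), (1 : ℂ)) 0 := (hasDerivAt_const _ _).prodMk (hasDerivAt_id _)
  have d1 : HasDerivAt (fun t : ℂ => f (0, t)) (fderiv ℂ f 0 (0, 1)) 0 :=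
    HasFDerivAt.comp_hasDerivAt (f := fun t : ℂ => ((0 : ℂ), t)) (l := f) 0 hf.differentiableAt.hasFDerivAt l
  have d2 : HasDerivAt (fun t : ℂ => f1 (0, t)) (fderiv ℂ f1 0 (0, 1)) 0 :=
    HasFDerivAt.comp_hasDerivAt (f := fun t : ℂ => ((0 : ℂ), t)) (l := f1) 0 h1.differentiableAt.hasFDerivAt l
  have d3 : HasDerivAt (fun t : ℂ => f (0, 0) + t * f1 (0, t)) (1 * f1 (0, 0) + 0 * fderiv ℂ f1 0 (0, 1)) 0 :=
    ((hasDerivAt_id (0 : ℂ)).mul d2).const_add _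
  have h' : (fun t : ℂ => f (0, t)) =ᶠ[𝓝 0] fun t : ℂ => f (0, 0) + t * f1 (0, t) := by
    have : Tendsto (fun t : ℂ => ((0 : ℂ), t)) (𝓝 0) (𝓝 0) := l.continuousAt.tendsto
    exact this.eventually h
  have := (d3.congr_of_eventuallyEq h').unique d1
  rw [← this]; simp; rfl

lemma order_lemma {g : ℂ → ℂ} (hg : AnalyticAt ℂ g 0) (g0 : g 0 = 0) (dg0 : deriv g 0 = 0) (hi : ∀ᶠ x in 𝓝 (0 : ℂ), g x = 0 → x = 0) :
    ∃ (k : ℕ) (u : ℂ → ℂ), 1 ≤ k ∧ AnalyticAt ℂ u 0 ∧ u 0 ≠ 0 ∧ ∀ᶠ x in 𝓝 (0 : ℂ), g x = x ^ (k + 1) * u x := by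
  have hne : ¬ ∀ᶠ x in 𝓝 (0 : ℂ), g x = 0 := by
    intro h
    have h2 : ∀ᶠ x in 𝓝 (0 : ℂ), x = 0 := by filter_upwards [h, hi] with x h1 h2 using h2 h1
    have h3 : ∀ᶠ x in 𝓝[≠] (0 : ℂ), x = 0 := h2.filter_mono nhdsWithin_le_nhds
    have h4 : ∀ᶠ x in 𝓝[≠] (0 : ℂ), x ≠ 0 := eventually_mem_nhdsWithin
    obtain ⟨x, hx, hx'⟩ := (h3.and h4).exists
    exact hx' hx
  obtain ⟨n, u, hu, u0, h⟩ := hg.exists_eventuallyEq_pow_smul_nonzero_iff.2 hne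
  simp only [sub_zero, smul_eq_mul] at h
  rcases n with _ | _ | k
  · have := h.self_of_nhds
    simp [g0] at this; exact absurd this.symm u0
  · have d : HasDerivAt (fun x => x ^ (0 + 1) * u x) _ (0 : ℂ) := (hasDerivAt_pow (0 + 1) (0 : ℂ)).mul hu.differentiableAt.hasDerivAt
    have := Filter.EventuallyEq.deriv_eq h
    rw [d.deriv, dg0] at this
    simp at this; exact absurd this.symm u0
  · exact ⟨k + 1, u, by omega, hu, u0, h⟩

lemma line_x {f : ℂ × ℂ → ℂ} {p : ℂ × ℂ} (hf : DifferentiableAt ℂ f p) : HasDerivAt (fun x => f (x, p.2)) (fderiv ℂ f p (1, 0)) p.1 :=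
  HasFDerivAt.comp_hasDerivAt (f := fun t : ℂ => (t, p.2)) (l := f) p.1 hf.hasFDerivAt ((hasDerivAt_id _).prodMk (hasDerivAt_const _ _))

lemma line_y {f : ℂ × ℂ → ℂ} {p : ℂ × ℂ} (hf : DifferentiableAt ℂ f p) : HasDerivAt (fun y => f (p.1, y)) (fderiv ℂ f p (0, 1)) p.2 :=
  HasFDerivAt.comp_hasDerivAt (f := fun t : ℂ => (p.1, t)) (l := f) p.2 hf.hasFDerivAt ((hasDerivAt_const _ _).prodMk (hasDerivAt_id _))

lemma fderiv_split {f : ℂ × ℂ → ℂ} {p : ℂ × ℂ} (v : ℂ × ℂ) : fderiv ℂ f p v = v.1 * fderiv ℂ f p (1, 0) + v.2 * fderiv ℂ f p (0, 1) := by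
  have : v = v.1 • ((1 : ℂ), (0 : ℂ)) + v.2 • ((0 : ℂ), (1 : ℂ)) := by ext <;> simp
  conv_lhs => rw [this]
  rw [map_add, map_smul, map_smul]; rfl

/-- straightening the fibration: solve `y h_y = a(h,y) - a(x,0)` -/
lemma h_exists {a : ℂ × ℂ → ℂ} (ha : AnalyticAt ℂ a 0) (da : fderiv ℂ a 0 = 0) :
    ∃ h : ℂ × ℂ → ℂ, AnalyticAt ℂ h 0 ∧ h 0 = 0 ∧ fderiv ℂ h 0 (1, 0) = 1 ∧
      ∀ᶠ p in 𝓝 (0 : ℂ × ℂ), p.2 * fderiv ℂ h p (0, 1) = a (h p, p.2) - a (p.1, 0) := by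
  obtain ⟨a1, aa1, ha1⟩ := div_lemma ha
  have a10 : a1 0 = 0 := by rw [div_at ha aa1 ha1, da]; rfl
  set G : ℂ × ℂ → ℂ := fun p => a (p.1 + p.2, 0) with hG
  have aG : AnalyticAt ℂ G 0 := an_comp (f := fun p : ℂ × ℂ => (p.1 + p.2, (0 : ℂ))) ha
    ((analyticAt_fst.add analyticAt_snd).prod analyticAt_const) (by ext <;> simp)
  obtain ⟨g1, ag1, hg1⟩ := div_lemma aG
  have g10 : g1 0 = 0 := by
    rw [div_at aG ag1 hg1]
    have h1 : HasFDerivAt (fun p : ℂ × ℂ => (p.1 + p.2, (0 : ℂ)))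
        ((ContinuousLinearMap.fst ℂ ℂ ℂ + ContinuousLinearMap.snd ℂ ℂ ℂ).prod 0) (0 : ℂ × ℂ) :=
      (ContinuousLinearMap.hasFDerivAt (ContinuousLinearMap.fst ℂ ℂ ℂ + ContinuousLinearMap.snd ℂ ℂ ℂ)).prodMk (hasFDerivAt_const (0 : ℂ) (0 : ℂ × ℂ))
    have h2 : HasFDerivAt a (0 : ℂ × ℂ →L[ℂ] ℂ) ((fun p : ℂ × ℂ => (p.1 + p.2, (0 : ℂ))) 0) := by
      have := ha.differentiableAt.hasFDerivAt
      rw [da] at this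
      have e : (fun p : ℂ × ℂ => (p.1 + p.2, (0 : ℂ))) 0 = 0 := by ext <;> simp
      rw [e]; exact this
    have h3 : HasFDerivAt G _ 0 := h2.comp (0 : ℂ × ℂ) h1
    rw [h3.fderiv]; rfl
  set F : ℂ × (ℂ × ℂ) → ℂ := fun q => a1 (q.2.2 + q.2.1 * q.1, q.2.1) + q.1 * g1 (q.2.2, q.2.1 * q.1) with hF
  have b1 : AnalyticAt ℂ (fun q : ℂ × (ℂ × ℂ) => q.2.1) 0 := (ContinuousLinearMap.fst ℂ ℂ ℂ ∘L ContinuousLinearMap.snd ℂ ℂ (ℂ × ℂ)).analyticAt 0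
  have b2 : AnalyticAt ℂ (fun q : ℂ × (ℂ × ℂ) => q.2.2) 0 := (ContinuousLinearMap.snd ℂ ℂ ℂ ∘L ContinuousLinearMap.snd ℂ ℂ (ℂ × ℂ)).analyticAt 0
  have b0 : AnalyticAt ℂ (fun q : ℂ × (ℂ × ℂ) => q.1) 0 := analyticAt_fst
  have aF : AnalyticAt ℂ F 0 := by
    have c1 : AnalyticAt ℂ (fun q : ℂ × (ℂ × ℂ) => a1 (q.2.2 + q.2.1 * q.1, q.2.1)) 0 :=
      an_comp (f := fun q : ℂ × (ℂ × ℂ) => (q.2.2 + q.2.1 * q.1, q.2.1)) aa1 ((b2.add (b1.mul b0)).prod b1) (by ext <;> simp)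
    have c2 : AnalyticAt ℂ (fun q : ℂ × (ℂ × ℂ) => g1 (q.2.2, q.2.1 * q.1)) 0 :=
      an_comp (f := fun q : ℂ × (ℂ × ℂ) => (q.2.2, q.2.1 * q.1)) ag1 (b2.prod (b1.mul b0)) (by ext <;> simp)
    exact c1.add (b0.mul c2)
  have a10' : a1 (0, 0) = 0 := a10
  have g10' : g1 (0, 0) = 0 := g10
  obtain ⟨v, ρ, hρ, dv, v0, hv⟩ := pbb aF (by simp [hF, a10']) (by
    have h1 : HasFDerivAt (fun w : ℂ => F (w, 0)) ((fderiv ℂ F 0).comp (ContinuousLinearMap.inl ℂ ℂ (ℂ × ℂ))) 0 :=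
      HasFDerivAt.comp (g := F) (f := fun w : ℂ => (w, (0 : ℂ × ℂ))) 0 aF.differentiableAt.hasFDerivAt (hasFDerivAt_prodMk_left 0 0)
    have h2 : (fun w : ℂ => F (w, 0)) = fun _ => 0 := by
      ext w; simp [hF, a10', g10']
    rw [h2] at h1
    exact h1.unique (hasFDerivAt_const 0 0))
  have av : AnalyticAt ℂ v 0 := analyticAt_of_diff (by
    filter_upwards [ball_mem_nhds 0 hρ] with p hp
    exact dv.differentiableAt (isOpen_ball.mem_nhds hp))
  have avs : AnalyticAt ℂ (fun p : ℂ × ℂ => v (p.2, p.1)) 0 :=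
    AnalyticAt.comp (g := v) (f := fun p : ℂ × ℂ => (p.2, p.1)) av (analyticAt_snd.prod analyticAt_fst)
  set h : ℂ × ℂ → ℂ := fun p => p.1 + p.2 * v (p.2, p.1) with hh
  have ah : AnalyticAt ℂ h 0 := analyticAt_fst.add (analyticAt_snd.mul avs)
  have h0 : h 0 = 0 := by simp [hh]
  refine ⟨h, ah, h0, ?_, ?_⟩
  · have := line_x ah.differentiableAt
    have e : (fun x => h (x, (0 : ℂ × ℂ).2)) = fun x => x := by ext x; simp [hh]
    rw [e] at this
    exact this.unique (hasDerivAt_id _)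
  · have t1 : Tendsto (fun p : ℂ × ℂ => (h p, p.2)) (𝓝 0) (𝓝 0) := by
      have : ContinuousAt (fun p : ℂ × ℂ => (h p, p.2)) 0 := ah.continuousAt.prodMk continuousAt_snd
      have := this.tendsto
      rw [h0] at this
      exact this
    have t2 : Tendsto (fun p : ℂ × ℂ => (p.1, p.2 * v (p.2, p.1))) (𝓝 0) (𝓝 0) := by
      have : ContinuousAt (fun p : ℂ × ℂ => (p.1, p.2 * v (p.2, p.1))) 0 := continuousAt_fst.prodMk (continuousAt_snd.mul avs.continuousAt)
      have := this.tendsto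
      simp only [Prod.fst_zero, Prod.snd_zero, zero_mul] at this
      exact this
    have t3 : Tendsto (fun p : ℂ × ℂ => (p.2, p.1)) (𝓝 0) (𝓝 0) := by
      have : Continuous (fun p : ℂ × ℂ => (p.2, p.1)) := by fun_prop
      exact this.tendsto 0
    filter_upwards [t1.eventually ha1, t2.eventually hg1, t3.eventually (ball_mem_nhds 0 hρ), ah.eventually_analyticAt] with p e1 e2 e3 e4
    have d1 := hv p.2 p.1 e3
    have d2 : HasDerivAt (fun y => h (p.1, y)) (F (v (p.2, p.1), (p.2, p.1))) p.2 := d1.const_add p.1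
    rw [(line_y e4.differentiableAt).unique d2]
    simp only [hF, hG] at e1 e2 ⊢
    have e5 : h p = p.1 + p.2 * v (p.2, p.1) := rfl
    rw [← e5] at e2 ⊢
    rw [add_zero] at e2
    linear_combination -e1 - e2

lemma step_B {A B : ℂ × ℂ → ℂ} (hA : AnalyticAt ℂ A 0) (hB : AnalyticAt ℂ B 0) (A0 : A 0 = 0) (dA : fderiv ℂ A 0 = 0)
    (hB0 : ∀ᶠ x in 𝓝 (0 : ℂ), B (x, 0) = 0) (dB : fderiv ℂ B 0 (0, 1) ≠ 0) (hi : ∀ᶠ x in 𝓝 (0 : ℂ), A (x, 0) = 0 → x = 0) :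
    ∃ (k : ℕ) (U V : ℂ × ℂ → ℂ), 1 ≤ k ∧ AnalyticAt ℂ U 0 ∧ U 0 ≠ 0 ∧ AnalyticAt ℂ V 0 ∧ V 0 ≠ 0 ∧
      Conj (fun p => (A p, B p)) (fun p => U p • ((p.1 ^ (k + 1) : ℂ), p.2 * V p)) := by
  obtain ⟨B1, aB1, hB1⟩ := div_lemma hB
  have B10 : B1 0 ≠ 0 := by rwa [div_at hB aB1 hB1]
  have hB1n := aB1.continuousAt.eventually_ne B10
  set a : ℂ × ℂ → ℂ := fun p => A p * (B1 p)⁻¹ with ha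
  have ai : AnalyticAt ℂ (fun p => (B1 p)⁻¹) 0 := aB1.inv B10
  have aa : AnalyticAt ℂ a 0 := hA.mul ai
  have a0 : a 0 = 0 := by simp [ha, A0]
  have da : fderiv ℂ a 0 = 0 := by
    have h1 : HasFDerivAt a _ 0 := hA.differentiableAt.hasFDerivAt.mul ai.differentiableAt.hasFDerivAt
    rw [h1.fderiv, dA, A0]
    refine ContinuousLinearMap.ext fun v => ?_
    change (0 : ℂ) * _ + _ * (0 : ℂ) = 0
    rw [zero_mul, mul_zero, add_zero]
  have ag : AnalyticAt ℂ (fun x : ℂ => a (x, 0)) 0 := an_line aa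
  have dg : deriv (fun x : ℂ => a (x, 0)) 0 = 0 := by
    have := line_x aa.differentiableAt
    rw [da] at this
    exact this.deriv
  have tl : Tendsto (fun x : ℂ => (x, (0 : ℂ))) (𝓝 0) (𝓝 0) := by
    have : Continuous (fun x : ℂ => (x, (0 : ℂ))) := by fun_prop
    exact this.tendsto 0
  obtain ⟨k, u, hk, au, u0, hg⟩ := order_lemma ag a0 dg (by
    filter_upwards [hi, tl.eventually hB1n] with x h1 h2 h3
    exact h1 ((mul_eq_zero.1 h3).resolve_right (inv_ne_zero h2)))
  obtain ⟨h, ah, h0, dh, hh⟩ := h_exists aa da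
  set Ψ : ℂ × ℂ → ℂ × ℂ := fun p => (h p, p.2) with hΨ
  have Ψ0 : Ψ 0 = 0 := by simp [hΨ, h0]
  have aΨ : AnalyticAt ℂ Ψ 0 := ah.prod analyticAt_snd
  have tΨ : Tendsto Ψ (𝓝 0) (𝓝 0) := by
    have := aΨ.continuousAt.tendsto
    rwa [Ψ0] at this
  have dΨ : ∀ p : ℂ × ℂ, DifferentiableAt ℂ h p → ∀ v, fderiv ℂ Ψ p v = (v.1 * fderiv ℂ h p (1, 0) + v.2 * fderiv ℂ h p (0, 1), v.2) := by
    intro p hp v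
    have h2 : HasFDerivAt Ψ _ p := hp.hasFDerivAt.prodMk hasFDerivAt_snd
    rw [h2.fderiv, ← fderiv_split]
    simp
  set hx : ℂ × ℂ → ℂ := fun p => fderiv ℂ h p (1, 0) with hhx
  have ahx : AnalyticAt ℂ hx 0 :=
    AnalyticAt.comp (g := ContinuousLinearMap.apply ℂ ℂ ((1 : ℂ), (0 : ℂ))) (f := fderiv ℂ h) (ContinuousLinearMap.analyticAt _ _) ah.fderiv
  have hx0 : hx 0 ≠ 0 := by rw [hhx]; simp only; rw [dh]; exact one_ne_zero
  have aβ : AnalyticAt ℂ (fun p => B1 (Ψ p)) 0 := AnalyticAt.comp (g := B1) (f := Ψ) (by rwa [Ψ0]) aΨ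
  refine ⟨k, fun p => B1 (Ψ p) * u p.1 / hx p, fun p => hx p / u p.1, hk, (aβ.mul (an_fst au)).div ahx hx0, ?_,
    ahx.div (an_fst au) u0, div_ne_zero hx0 u0, Ψ, aΨ, Ψ0, ?_, ?_⟩
  · exact div_ne_zero (mul_ne_zero (by rwa [Ψ0]) u0) hx0
  · apply equiv_of_inj
    intro w hw
    rw [dΨ 0 ah.differentiableAt, dh] at hw
    simp only [Prod.mk_eq_zero] at hw
    obtain ⟨h1, h2⟩ := hw
    rw [h2] at h1
    exact Prod.ext (by simpa using h1) h2
  · filter_upwards [hh, ah.eventually_analyticAt, ahx.continuousAt.eventually_ne hx0, ev_fst (au.continuousAt.eventually_ne u0),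
      ev_fst hg, tΨ.eventually hB1n, tΨ.eventually hB1, tΨ.eventually (ev_fst hB0)] with p e1 e2 e3 e4 e5 e6 e7 e8
    rw [dΨ p e2.differentiableAt]
    simp only [Prod.smul_mk, smul_eq_mul]
    rw [e8, zero_add] at e7
    refine Prod.ext ?_ ?_
    · simp only
      have e9 : A (Ψ p) = B1 (Ψ p) * a (Ψ p) := by
        simp only [ha]; field_simp
      rw [e9]
      change _ * hx p + _ = _
      have e10 : a (Ψ p) = p.2 * fderiv ℂ h p (0, 1) + p.1 ^ (k + 1) * u p.1 := by
        rw [← e5, e1]; simp [hΨ]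
      rw [e10]
      field_simp
      ring
    · simp only
      rw [e7]
      simp only [hΨ]
      field_simp

lemma fd_mul {m n : ℂ × ℂ → ℂ} (hm : AnalyticAt ℂ m 0) (hn : AnalyticAt ℂ n 0) (n0 : n 0 = 0) :
    HasFDerivAt (fun p => m p * n p) (m 0 • fderiv ℂ n 0) 0 := by
  have h1 : HasFDerivAt (fun p => m p * n p) _ 0 := hm.differentiableAt.hasFDerivAt.mul hn.differentiableAt.hasFDerivAt
  refine h1.congr_fderiv ?_
  rw [n0]
  refine ContinuousLinearMap.ext fun v => ?_
  change m 0 * fderiv ℂ n 0 v + (0 : ℂ) * _ = m 0 * fderiv ℂ n 0 v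
  rw [zero_mul, add_zero]

lemma step_A (Z : ℂ × ℂ → ℂ × ℂ)
    (hZholo : ∃ U ∈ 𝓝 (0 : ℂ × ℂ), DifferentiableOn ℂ Z U)
    (hZ0 : Z 0 = 0)
    (hiso : ∃ U ∈ 𝓝 (0 : ℂ × ℂ), ∀ p ∈ U, Z p = 0 → p = 0)
    (lam2 : ℂ) (hlam2 : lam2 ≠ 0)
    (w : ℂ × ℂ) (hw : w ≠ 0) (hw2 : fderiv ℂ Z 0 w = lam2 • w)
    (γ : ℂ → ℂ × ℂ) (c : ℂ → ℂ)
    (hγholo : ∃ U ∈ 𝓝 (0 : ℂ), DifferentiableOn ℂ γ U ∧ DifferentiableOn ℂ c U)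
    (hγ0 : γ 0 = 0)
    (hγreg : fderiv ℂ γ 0 1 ≠ 0)
    (hγtangent : fderiv ℂ Z 0 (fderiv ℂ γ 0 1) = 0)
    (hγinv : ∀ᶠ t in 𝓝 (0 : ℂ), Z (γ t) = c t • fderiv ℂ γ t 1) :
    ∃ A B : ℂ × ℂ → ℂ, AnalyticAt ℂ A 0 ∧ AnalyticAt ℂ B 0 ∧ A 0 = 0 ∧ fderiv ℂ A 0 = 0 ∧
      (∀ᶠ x in 𝓝 (0 : ℂ), B (x, 0) = 0) ∧ fderiv ℂ B 0 (0, 1) ≠ 0 ∧ (∀ᶠ x in 𝓝 (0 : ℂ), A (x, 0) = 0 → x = 0) ∧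
      Conj Z (fun p => (A p, B p)) := by
  have aZ : AnalyticAt ℂ Z 0 := by
    obtain ⟨U, hU, h⟩ := hZholo
    refine analyticAt_of_diff2 ?_
    filter_upwards [eventually_mem_nhds_iff.2 hU] with p hp using h.differentiableAt hp
  have aγ : AnalyticAt ℂ γ 0 := by
    obtain ⟨U, hU, h, -⟩ := hγholo
    rw [Complex.analyticAt_iff_eventually_differentiableAt]
    filter_upwards [eventually_mem_nhds_iff.2 hU] with p hp using h.differentiableAt hp
  simp only [fderiv_apply_one_eq_deriv] at hγreg hγtangent hγinv
  set e : ℂ → ℂ × ℂ := deriv γ with he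
  have ae : AnalyticAt ℂ e 0 := aγ.deriv
  have ae1 : AnalyticAt ℂ (fun x => (e x).1) 0 := AnalyticAt.comp (g := Prod.fst) (f := e) analyticAt_fst ae
  have ae2 : AnalyticAt ℂ (fun x => (e x).2) 0 := AnalyticAt.comp (g := Prod.snd) (f := e) analyticAt_snd ae
  set d : ℂ → ℂ := fun x => (e x).1 * w.2 - (e x).2 * w.1 with hd
  have ad : AnalyticAt ℂ d 0 := (ae1.mul analyticAt_const).sub (ae2.mul analyticAt_const)
  have d0 : d 0 ≠ 0 := by
    intro h0
    simp only [hd] at h0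
    have hdep : ∃ t : ℂ, e 0 = t • w := by
      by_cases h1 : w.1 = 0
      · have h2 : w.2 ≠ 0 := fun h2 => hw (Prod.ext h1 h2)
        rw [h1, mul_zero, sub_zero] at h0
        refine ⟨(e 0).2 / w.2, Prod.ext ?_ ?_⟩
        · simp [h1, (mul_eq_zero.1 h0).resolve_right h2]
        · simp [h2]
      · refine ⟨(e 0).1 / w.1, Prod.ext ?_ ?_⟩
        · simp [h1]
        · simp only [Prod.smul_snd, smul_eq_mul]
          field_simp
          linear_combination -h0
    obtain ⟨t, ht⟩ := hdep
    rw [ht, map_smul, hw2, smul_smul, smul_eq_zero] at hγtangent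
    have ht0 : t = 0 := by
      rcases hγtangent with h | h
      · exact (mul_eq_zero.1 h).resolve_right hlam2
      · exact absurd h hw
    rw [ht0, zero_smul] at ht
    exact hγreg ht
  set Ψ : ℂ × ℂ → ℂ × ℂ := fun p => γ p.1 + p.2 • w with hΨ
  have Ψ0 : Ψ 0 = 0 := by simp [hΨ, hγ0]
  have aΨ : AnalyticAt ℂ Ψ 0 := by
    have h1 : AnalyticAt ℂ (fun p : ℂ × ℂ => γ p.1) 0 := AnalyticAt.comp (g := γ) (f := fun p : ℂ × ℂ => p.1) aγ analyticAt_fst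
    exact h1.add (analyticAt_snd.smul analyticAt_const)
  have dΨ : ∀ p : ℂ × ℂ, DifferentiableAt ℂ γ p.1 → ∀ v, fderiv ℂ Ψ p v = v.1 • e p.1 + v.2 • w := by
    intro p hp v
    have h1 : HasFDerivAt (fun p : ℂ × ℂ => γ p.1) _ p := hp.hasDerivAt.hasFDerivAt.comp p hasFDerivAt_fst
    have h2 : HasFDerivAt (fun p : ℂ × ℂ => p.2 • w) _ p := (hasFDerivAt_snd (𝕜 := ℂ) (p := p)).smul_const w
    have h3 : HasFDerivAt Ψ _ p := h1.add h2
    rw [h3.fderiv]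
    simp [he]
  have tΨ : Tendsto Ψ (𝓝 0) (𝓝 0) := by
    have := aΨ.continuousAt.tendsto
    rwa [Ψ0] at this
  have aζ : AnalyticAt ℂ (fun p => Z (Ψ p)) 0 := AnalyticAt.comp (g := Z) (f := Ψ) (by rwa [Ψ0]) aΨ
  have aζ1 : AnalyticAt ℂ (fun p => (Z (Ψ p)).1) 0 := AnalyticAt.comp (g := Prod.fst) (f := fun p => Z (Ψ p)) analyticAt_fst aζ
  have aζ2 : AnalyticAt ℂ (fun p => (Z (Ψ p)).2) 0 := AnalyticAt.comp (g := Prod.snd) (f := fun p => Z (Ψ p)) analyticAt_snd aζ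
  have dζ : HasFDerivAt (fun p => Z (Ψ p)) ((fderiv ℂ Z 0).comp (fderiv ℂ Ψ 0)) 0 :=
    HasFDerivAt.comp (g := Z) (f := Ψ) 0 (by rw [Ψ0]; exact aZ.differentiableAt.hasFDerivAt) aΨ.differentiableAt.hasFDerivAt
  have dZΨ : ∀ v, fderiv ℂ Z 0 (fderiv ℂ Ψ 0 v) = (lam2 * v.2) • w := by
    intro v
    rw [dΨ 0 aγ.differentiableAt, map_add, map_smul, map_smul, hw2, smul_smul]
    simp only [Prod.fst_zero]
    rw [hγtangent, smul_zero, zero_add, mul_comm]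
  have dζ1 : ∀ v, fderiv ℂ (fun p => (Z (Ψ p)).1) 0 v = lam2 * v.2 * w.1 := by
    intro v
    have : HasFDerivAt (fun p => (Z (Ψ p)).1) _ 0 := dζ.fst
    rw [this.fderiv]
    simp [dZΨ]
  have dζ2 : ∀ v, fderiv ℂ (fun p => (Z (Ψ p)).2) 0 v = lam2 * v.2 * w.2 := by
    intro v
    have : HasFDerivAt (fun p => (Z (Ψ p)).2) _ 0 := dζ.snd
    rw [this.fderiv]
    simp [dZΨ]
  have am : ∀ {s : ℂ → ℂ}, AnalyticAt ℂ s 0 → AnalyticAt ℂ (fun p : ℂ × ℂ => s p.1 / d p.1) 0 := fun hs =>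
    an_fst (s := fun x => _ / d x) (hs.div ad d0)
  have cw1 : AnalyticAt ℂ (fun _ : ℂ => w.1) 0 := analyticAt_const
  have cw2 : AnalyticAt ℂ (fun _ : ℂ => w.2) 0 := analyticAt_const
  have ζ10 : (fun p => (Z (Ψ p)).1) 0 = 0 := by simp [Ψ0, hZ0]
  have ζ20 : (fun p => (Z (Ψ p)).2) 0 = 0 := by simp [Ψ0, hZ0]
  have hdA := (fd_mul (am cw2) aζ1 ζ10).sub (fd_mul (am cw1) aζ2 ζ20)
  have hdB := (fd_mul (am ae1) aζ2 ζ20).sub (fd_mul (am ae2) aζ1 ζ10)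
  set A : ℂ × ℂ → ℂ := fun p => w.2 / d p.1 * (Z (Ψ p)).1 - w.1 / d p.1 * (Z (Ψ p)).2 with hA
  set B : ℂ × ℂ → ℂ := fun p => (e p.1).1 / d p.1 * (Z (Ψ p)).2 - (e p.1).2 / d p.1 * (Z (Ψ p)).1 with hB
  have hdA' : HasFDerivAt A _ 0 := hdA
  have hdB' : HasFDerivAt B _ 0 := hdB
  have hdn := ad.continuousAt.eventually_ne d0
  have key : ∀ p : ℂ × ℂ, d p.1 ≠ 0 → A p • e p.1 + B p • w = Z (Ψ p) := by
    intro p hp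
    have hdd : ((e p.1).1 * w.2 - (e p.1).2 * w.1) / d p.1 = 1 := div_self hp
    refine Prod.ext ?_ ?_
    · simp only [Prod.fst_add, Prod.smul_fst, smul_eq_mul, hA, hB]
      generalize d p.1 = D at hdd ⊢
      linear_combination (Z (Ψ p)).1 * hdd
    · simp only [Prod.snd_add, Prod.smul_snd, smul_eq_mul, hA, hB]
      generalize d p.1 = D at hdd ⊢
      linear_combination (Z (Ψ p)).2 * hdd
  have hΨx : ∀ x : ℂ, Ψ (x, 0) = γ x := by intro x; simp [hΨ]
  have hBx : ∀ᶠ x in 𝓝 (0 : ℂ), B (x, 0) = 0 := by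
    filter_upwards [hγinv] with x hx
    simp only [hB, hΨx, hx, Prod.smul_fst, Prod.smul_snd, smul_eq_mul]
    ring
  refine ⟨A, B, ?_, ?_, ?_, ?_, hBx, ?_, ?_, Ψ, aΨ, Ψ0, ?_, ?_⟩
  · exact ((am cw2).mul aζ1).sub ((am cw1).mul aζ2)
  · exact ((am ae1).mul aζ2).sub ((am ae2).mul aζ1)
  · simp [hA, Ψ0, hZ0]
  · rw [hdA'.fderiv]
    refine ContinuousLinearMap.ext fun v => ?_
    change w.2 / d 0 * fderiv ℂ (fun p => (Z (Ψ p)).1) 0 v - w.1 / d 0 * fderiv ℂ (fun p => (Z (Ψ p)).2) 0 v = 0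
    rw [dζ1, dζ2]; ring
  · rw [hdB'.fderiv]
    change (e 0).1 / d 0 * fderiv ℂ (fun p => (Z (Ψ p)).2) 0 (0, 1) - (e 0).2 / d 0 * fderiv ℂ (fun p => (Z (Ψ p)).1) 0 (0, 1) ≠ 0
    rw [dζ1, dζ2]
    have : (e 0).1 / d 0 * (lam2 * ((0 : ℂ), (1 : ℂ)).2 * w.2) - (e 0).2 / d 0 * (lam2 * ((0 : ℂ), (1 : ℂ)).2 * w.1) = lam2 * (d 0 / d 0) := by
      simp only [hd]; ring
    rw [this, div_self d0, mul_one]; exact hlam2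
  · obtain ⟨U, hU, hUi⟩ := hiso
    have tγ : Tendsto γ (𝓝 0) (𝓝 0) := by
      have := aγ.continuousAt.tendsto
      rwa [hγ0] at this
    have hne : ∀ᶠ x in 𝓝 (0 : ℂ), x ≠ 0 → γ x ≠ 0 := by
      have := aγ.differentiableAt.hasDerivAt.eventually_ne (c := 0) hγreg
      exact eventually_nhdsWithin_iff.1 this
    filter_upwards [hBx, hdn, tγ.eventually hU, hne] with x h1 h2 h3 h4 h5
    by_contra hx
    apply h4 hx
    apply hUi _ h3
    rw [← hΨx, ← key (x, 0) h2, h1, h5]; simp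
  · apply equiv_of_inj
    intro v hv
    rw [dΨ 0 aγ.differentiableAt] at hv
    have h1 := congrArg Prod.fst hv
    have h2 := congrArg Prod.snd hv
    simp only [Prod.fst_add, Prod.snd_add, Prod.smul_fst, Prod.smul_snd, smul_eq_mul, Prod.fst_zero, Prod.snd_zero] at h1 h2
    refine Prod.ext ?_ ?_
    · apply (mul_eq_zero.1 (_ : v.1 * d 0 = 0)).resolve_right d0
      simp only [hd]; linear_combination w.2 * h1 - w.1 * h2
    · apply (mul_eq_zero.1 (_ : v.2 * d 0 = 0)).resolve_right d0
      simp only [hd]; linear_combination (e 0).1 * h2 - (e 0).2 * h1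
  · filter_upwards [ev_fst hdn, ev_fst aγ.eventually_analyticAt] with p h1 h2
    rw [dΨ p h2.differentiableAt]
    exact key p h1

/-- **Main Theorem.** Every germ of a convergent saddle-node holomorphic
vector field `Z` on `ℂ²` is analytically conjugate to a normal form
`[P(x)/(1+xP(x)G(x,x^σ y))]·(x^{k+1} ∂ₓ + y(1+μx^k+xR(x,x^σ y)) ∂_y)`, where
`P` is a polynomial of degree `≤ k` with `P(0) ≠ 0` and
`G(x,u) = Σ_{n>0} G_n(x) u^n`, `R(x,u) = Σ_{n>0} R_n(x) u^n` are holomorphic near `(0,0)`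
with every `G_n, R_n` a polynomial in `x` of degree `≤ k−1`; equivalently
`G(x,u) = Σ_{m<k} Gc_m(u) x^m` with `Gc_m` holomorphic and `Gc_m(0) = 0` (similarly `R`).
Here `σ = 0` if `μ ∉ ℝ_{≤0}` and `σ = ⌊−μ⌋+1` otherwise. -/
theorem main_theorem_convergent_saddle_node
    (Z : ℂ × ℂ → ℂ × ℂ)
    -- Z is a germ of a holomorphic vector field at 0
    (hZholo : ∃ U ∈ 𝓝 (0 : ℂ × ℂ), DifferentiableOn ℂ Z U)
    -- 0 is a singular point
    (hZ0 : Z 0 = 0)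
    -- 0 is an isolated common zero of the components
    (hiso : ∃ U ∈ 𝓝 (0 : ℂ × ℂ), ∀ p ∈ U, Z p = 0 → p = 0)
    -- the linear part has eigenvalues 0 and lam2 ≠ 0
    (lam2 : ℂ) (hlam2 : lam2 ≠ 0)
    (v : ℂ × ℂ) (hv : v ≠ 0) (hv0 : fderiv ℂ Z 0 v = 0)
    (w : ℂ × ℂ) (hw : w ≠ 0) (hw2 : fderiv ℂ Z 0 w = lam2 • w)
    -- Z is convergent: there is a germ of an analytic curve through 0, tangent to the
    -- 0-eigendirection, which is invariant under Z
    (γ : ℂ → ℂ × ℂ) (c : ℂ → ℂ)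
    (hγholo : ∃ U ∈ 𝓝 (0 : ℂ), DifferentiableOn ℂ γ U ∧ DifferentiableOn ℂ c U)
    (hγ0 : γ 0 = 0)
    (hγreg : fderiv ℂ γ 0 1 ≠ 0)
    (hγtangent : fderiv ℂ Z 0 (fderiv ℂ γ 0 1) = 0)
    (hγinv : ∀ᶠ t in 𝓝 (0 : ℂ), Z (γ t) = c t • fderiv ℂ γ t 1) :
    ∃ k : ℕ, 1 ≤ k ∧
    ∃ μ : ℂ, ∃ P : Polynomial ℂ, P.natDegree ≤ k ∧ P.eval 0 ≠ 0 ∧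
    ∃ σ : ℕ,
      σ = (if μ.im = 0 ∧ μ.re ≤ 0 then (⌊-μ.re⌋ + 1).toNat else 0) ∧
    -- G and R, given through their coefficients in x: G(x,u) = Σ_{m<k} Gc m u * x^m
    ∃ b : ℝ, 0 < b ∧
    ∃ Gc Rc : Fin k → ℂ → ℂ,
      (∀ i : Fin k, DifferentiableOn ℂ (Gc i) (ball (0:ℂ) b) ∧
        DifferentiableOn ℂ (Rc i) (ball (0:ℂ) b) ∧ Gc i 0 = 0 ∧ Rc i 0 = 0) ∧
    -- the conjugating germ of biholomorphism
    ∃ Ψ : ℂ × ℂ → ℂ × ℂ,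
      Ψ 0 = 0 ∧
      (∃ U ∈ 𝓝 (0 : ℂ × ℂ), DifferentiableOn ℂ Ψ U) ∧
      (∃ e : (ℂ × ℂ) ≃L[ℂ] (ℂ × ℂ), (e : (ℂ × ℂ) →L[ℂ] (ℂ × ℂ)) = fderiv ℂ Ψ 0) ∧
      ∀ᶠ p in 𝓝 (0 : ℂ × ℂ),
        fderiv ℂ Ψ p
            ((Polynomial.eval p.1 P /
                (1 + p.1 * Polynomial.eval p.1 P *
                  (∑ i : Fin k, Gc i (p.1 ^ σ * p.2) * p.1 ^ (i : ℕ)))) •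
              ((p.1 ^ (k+1) : ℂ),
                p.2 * (1 + μ * p.1 ^ k +
                  p.1 * (∑ i : Fin k, Rc i (p.1 ^ σ * p.2) * p.1 ^ (i : ℕ))))) =
          Z (Ψ p) := by
  obtain ⟨A, B, aA, aB, A0, dA, hB0, dB, hi, c1⟩ := step_A Z hZholo hZ0 hiso lam2 hlam2 w hw hw2 γ c hγholo hγ0 hγreg hγtangent hγinv
  obtain ⟨k, U, V, hk, aU, U0, aV, V0, c2⟩ := step_B aA aB A0 dA hB0 dB hi
  obtain ⟨μ, U', f, aU', U'0, af, hf0, c3⟩ := step_C hk aU U0 aV V0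
  obtain ⟨P, a, hP, P0, aa, ha0, c4⟩ := step_D (k := k) (μ := μ) aU' U'0 af
  exact ⟨k, hk, μ, P, hP, P0, assembly hk P0 af aa hf0 ha0 (((c1.trans c2).trans c3).trans c4)⟩
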